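/- There exist an absolute constant C>0 and n₀ such that the following holds for all n ≥ n₀. Let ((d_v)_{v∈V}, (d_w)_{w∈W}) be a pair of sequences of nonnegative integers with identical sums on disjoint sets V and W with |V|=m and |W|=n; define α_v by d_v = (n−1)/2 + α_v√(n−1)/2 for v∈V and β_w by d_w = (n−1)/2 + β_w√(n−1)/2 for w∈W, and suppose (log n)^{−1/4} ≤ m/n ≤ (log n)^{1/4}, |α_v| ≤ log n for each v∈V, |β_w| ≤ log n for each w∈W, and (n/m)Σ_{w∈W} β_w² ≤ n(log n)^{1/9}. Then this pair of sequences is a bipartite-graphic degree sequence. Moreover, letting G be a uniformly random bipartite graph between V and W with these degrees, for any fixed u∈V, any S⊆W with h:=|S| satisfying min(h, n−h) ≥ n/(log n)^{1/8}, and any integer t∈[0,d_u]: (i) if |t−h/2| > n^{3/5}, then P(deg_S(u)=t) ≤ exp(−(t−h/2)²/(Cn)); and (ii) if |t−h/2| ≤ n^{3/5}, then P(deg_S(u)=t) = (1+θ)·[C(h,t)·C(n−h, d_u−t)/C(n, d_u)]·exp(Λ₁ − Λ₂ − Λ₃ + Λ₄) for some θ with |θ| ≤ C n^{−1/10}, where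 Λ₁ = (1/(2mn))(Σ_{i∈W}β_i)(Σ_{i∈W}β_i − 2√(mn)·α_u), Λ₂ = Σ_{i∈S}(1 − 2t/h)·β_i/√m + Σ_{i∈W∖S}(1 − 2(d_u−t)/(n−h))·β_i/√m, Λ₃ = (1/2)Σ_{i∈W} β_i²/m, and Λ₄ = (1/(2mh))Σ_{{i,j}⊆S}(β_i−β_j)² + (1/(2m(n−h)))Σ_{{i,j}⊆W∖S}(β_i−β_j)², the sums in Λ₄ ranging over unordered two-element subsets. -/

import Mathlib

open Finset

open scoped Classical

/-- A bipartite graph between `Fin m` and `Fin n` is encoded as a Boolean adjacency matrix.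
`bdegV E v` is the degree of `v ∈ V`. -/
def bdegV {m n : ℕ} (E : Fin m → Fin n → Bool) (v : Fin m) : ℕ :=
  (univ.filter fun w => E v w).card

/-- `bdegW E w` is the degree of `w ∈ W`. -/
def bdegW {m n : ℕ} (E : Fin m → Fin n → Bool) (w : Fin n) : ℕ :=
  (univ.filter fun v => E v w).card

/-- The set of bipartite graphs between `Fin m` and `Fin n` with degrees `dV` on `V = Fin m`
and `dW` on `W = Fin n`. -/
noncomputable def bipGraphs (m n : ℕ) (dV : Fin m → ℕ) (dW : Fin n → ℕ) :
    Finset (Fin m → Fin n → Bool) :=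
  univ.filter fun E => (∀ v, bdegV E v = dV v) ∧ (∀ w, bdegW E w = dW w)

/-- For a uniformly random bipartite graph with degrees `(dV, dW)`, the probability that the
number of neighbours of `u ∈ V` in `S ⊆ W` equals `t`. -/
noncomputable def bipProb (m n : ℕ) (dV : Fin m → ℕ) (dW : Fin n → ℕ) (u : Fin m)
    (S : Finset (Fin n)) (t : ℕ) : ℝ :=
  (((bipGraphs m n dV dW).filter fun E => (S.filter fun w => E u w).card = t).card : ℝ) /
    ((bipGraphs m n dV dW).card : ℝ)

/-- The normalised deviation of a degree `x`, defined by `x = (n-1)/2 + normDev n x · √(n-1)/2`;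
this gives `α_v = normDev n (dV v)` and `β_w = normDev n (dW w)`. -/
noncomputable def normDev (n : ℕ) (x : ℕ) : ℝ :=
  (2 * (x : ℝ) - ((n : ℝ) - 1)) / Real.sqrt ((n : ℝ) - 1)

noncomputable def bLam1 (m n : ℕ) (dV : Fin m → ℕ) (dW : Fin n → ℕ) (u : Fin m) : ℝ :=
  (1 / (2 * (m : ℝ) * (n : ℝ))) * (∑ i, normDev n (dW i)) *
    ((∑ i, normDev n (dW i)) - 2 * Real.sqrt ((m : ℝ) * (n : ℝ)) * normDev n (dV u))

noncomputable def bLam2 (m n : ℕ) (dV : Fin m → ℕ) (dW : Fin n → ℕ) (u : Fin m)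
    (S : Finset (Fin n)) (t : ℕ) : ℝ :=
  (∑ i ∈ S, (1 - 2 * (t : ℝ) / (S.card : ℝ)) * normDev n (dW i) / Real.sqrt (m : ℝ)) +
    (∑ i ∈ Sᶜ,
      (1 - 2 * ((dV u : ℝ) - (t : ℝ)) / ((n : ℝ) - (S.card : ℝ))) * normDev n (dW i) /
        Real.sqrt (m : ℝ))

noncomputable def bLam3 (m n : ℕ) (dW : Fin n → ℕ) : ℝ :=
  (1 / 2) * ∑ i, (normDev n (dW i)) ^ 2 / (m : ℝ)

/-- `Λ₄`; the sums over unordered two-element subsets are written as halves of the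
corresponding double sums (the diagonal terms vanish). -/
noncomputable def bLam4 (m n : ℕ) (dW : Fin n → ℕ) (S : Finset (Fin n)) : ℝ :=
  (1 / (4 * (m : ℝ) * (S.card : ℝ))) *
      (∑ i ∈ S, ∑ j ∈ S, (normDev n (dW i) - normDev n (dW j)) ^ 2) +
    (1 / (4 * (m : ℝ) * ((n : ℝ) - (S.card : ℝ)))) *
      (∑ i ∈ Sᶜ, ∑ j ∈ Sᶜ, (normDev n (dW i) - normDev n (dW j)) ^ 2)

set_option linter.unusedSectionVars false

section Switching

variable {V W : Type*} [Fintype V] [Fintype W] [DecidableEq V] [DecidableEq W]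

/-- Degree of the row vertex `v` in the bipartite graph `E`. -/
def rowDeg (E : V → W → Bool) (v : V) : ℕ := (univ.filter fun w => E v w = true).card

/-- Degree of the column vertex `w` in the bipartite graph `E`. -/
def colDeg (E : V → W → Bool) (w : W) : ℕ := (univ.filter fun v => E v w = true).card

/-- Number of common neighbours of the column vertices `a` and `b`. -/
def codeg (E : V → W → Bool) (a b : W) : ℕ :=
  (univ.filter fun v => E v a = true ∧ E v b = true).card

/-- Bipartite graphs with row degrees `r` and column degrees `c`. -/
def biClass (r : V → ℕ) (c : W → ℕ) : Finset (V → W → Bool) :=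
  univ.filter fun E => (∀ v, rowDeg E v = r v) ∧ ∀ w, colDeg E w = c w

/-- Exchange the columns `a` and `b` on the rows in `R`. -/
def tog (R : Finset V) (a b : W) (E : V → W → Bool) : V → W → Bool :=
  fun v w => if v ∈ R then E v (Equiv.swap a b w) else E v w

lemma tog_tog (R : Finset V) (a b : W) (E : V → W → Bool) : tog R a b (tog R a b E) = E := by
  funext v w
  simp only [tog]
  split_ifs <;> simp

lemma rowDeg_tog (R : Finset V) (a b : W) (E : V → W → Bool) (v : V) :
    rowDeg (tog R a b E) v = rowDeg E v := by
  unfold rowDeg tog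
  by_cases h : v ∈ R
  · simp only [h, if_true]
    refine card_bij' (fun w _ => Equiv.swap a b w) (fun w _ => Equiv.swap a b w) ?_ ?_ ?_ ?_ <;>
      simp
  · simp [h]

lemma colDeg_tog_of_ne (R : Finset V) {a b w : W} (ha : w ≠ a) (hb : w ≠ b)
    (E : V → W → Bool) : colDeg (tog R a b E) w = colDeg E w := by
  simp [colDeg, tog, Equiv.swap_apply_of_ne_of_ne ha hb]

lemma colDeg_tog_left (R : Finset V) (a b : W) (E : V → W → Bool) :
    colDeg (tog R a b E) a + ∑ v ∈ R, (E v a).toNat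
      = colDeg E a + ∑ v ∈ R, (E v b).toNat := by
  have key : ∀ (F : V → W → Bool) (w : W), colDeg F w = ∑ v, (F v w).toNat := by
    intro F w
    rw [colDeg, card_filter]
    exact sum_congr rfl fun v _ => by cases F v w <;> simp
  rw [key, key, ← sum_add_sum_compl R, ← sum_add_sum_compl R (fun v => (E v a).toNat)]
  have h1 : ∑ v ∈ R, (tog R a b E v a).toNat = ∑ v ∈ R, (E v b).toNat :=
    sum_congr rfl fun v hv => by simp [tog, hv]
  have h2 : ∑ v ∈ Rᶜ, (tog R a b E v a).toNat = ∑ v ∈ Rᶜ, (E v a).toNat :=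
    sum_congr rfl fun v hv => by simp [tog, mem_compl.1 hv]
  omega

lemma tog_comm (R : Finset V) (a b : W) (E : V → W → Bool) : tog R a b E = tog R b a E := by
  funext v w
  simp [tog, Equiv.swap_comm]

lemma colDeg_tog_right (R : Finset V) (a b : W) (E : V → W → Bool) :
    colDeg (tog R a b E) b + ∑ v ∈ R, (E v b).toNat
      = colDeg E b + ∑ v ∈ R, (E v a).toNat := by
  rw [tog_comm]
  exact colDeg_tog_left R b a E

lemma codeg_tog (R : Finset V) (a b : W) (E : V → W → Bool) :
    codeg (tog R a b E) a b = codeg E a b := by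
  unfold codeg tog
  congr 1
  ext v
  simp only [mem_filter, mem_univ, true_and]
  split_ifs <;> simp [and_comm]

lemma codeg_comm (E : V → W → Bool) (a b : W) : codeg E a b = codeg E b a := by
  simp only [codeg, and_comm]

lemma card_diff_add_codeg (E : V → W → Bool) (a b : W) :
    (univ.filter fun v => E v a = true ∧ E v b = false).card + codeg E a b = colDeg E a := by
  unfold codeg colDeg
  rw [← card_union_of_disjoint]
  · congr 1
    ext v
    simp only [mem_union, mem_filter, mem_univ, true_and]
    cases E v a <;> cases E v b <;> simp
  · rw [disjoint_left]
    intro v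
    simp only [mem_filter, mem_univ, true_and]
    rintro ⟨-, h⟩ ⟨-, h'⟩
    simp [h] at h'

/-- Graphs in a degree class with a prescribed codegree of `a` and `b`. -/
def codegClass (r : V → ℕ) (c : W → ℕ) (a b : W) (k : ℕ) : Finset (V → W → Bool) :=
  (biClass r c).filter fun E => codeg E a b = k

/-- Moving one unit of degree from column `a` to column `b`, at fixed codegree. -/
lemma card_codegClass_move (r : V → ℕ) (c c' : W → ℕ) {a b : W} (hab : a ≠ b)
    (ha : c' a + 1 = c a) (hb : c' b = c b + 1) (hc : ∀ w, w ≠ a → w ≠ b → c' w = c w) (k : ℕ) :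
    (codegClass r c a b k).card * (c a - k) = (codegClass r c' a b k).card * (c b + 1 - k) := by
  have h1 : ∀ E ∈ codegClass r c a b k,
      (univ.filter fun v => E v a = true ∧ E v b = false).card = c a - k := by
    intro E hE
    simp only [codegClass, biClass, mem_filter, mem_univ, true_and] at hE
    have := card_diff_add_codeg E a b
    rw [hE.2, hE.1.2 a] at this
    omega
  have h2 : ∀ E ∈ codegClass r c' a b k,
      (univ.filter fun v => E v b = true ∧ E v a = false).card = c b + 1 - k := by
    intro E hE
    simp only [codegClass, biClass, mem_filter, mem_univ, true_and] at hE
    have := card_diff_add_codeg E b a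
    rw [codeg_comm, hE.2, hE.1.2 b, hb] at this
    omega
  have h1' : ((codegClass r c a b k).sigma fun E =>
      univ.filter fun v => E v a = true ∧ E v b = false).card
        = (codegClass r c a b k).card * (c a - k) := by
    rw [card_sigma, sum_congr rfl h1, sum_const, smul_eq_mul]
  have h2' : ((codegClass r c' a b k).sigma fun E =>
      univ.filter fun v => E v b = true ∧ E v a = false).card
        = (codegClass r c' a b k).card * (c b + 1 - k) := by
    rw [card_sigma, sum_congr rfl h2, sum_const, smul_eq_mul]
  rw [← h1', ← h2']
  refine card_nbij' (fun x => ⟨tog {x.2} a b x.1, x.2⟩) (fun x => ⟨tog {x.2} a b x.1, x.2⟩)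
    ?_ ?_ ?_ ?_
  · rintro ⟨E, v⟩ h
    simp only [codegClass, biClass, coe_sigma, coe_filter, mem_filter, mem_univ, true_and,
      Set.mem_sigma_iff, Set.mem_ofPred_eq] at h ⊢
    obtain ⟨⟨⟨hr, hcol⟩, hk⟩, hva, hvb⟩ := h
    refine ⟨⟨⟨fun x => by rw [rowDeg_tog, hr], fun w => ?_⟩, by rw [codeg_tog, hk]⟩, ?_, ?_⟩
    · by_cases hwa : w = a
      · subst hwa
        have := colDeg_tog_left {v} w b E
        simp [hva, hvb, hcol] at this
        omega
      by_cases hwb : w = b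
      · subst hwb
        have := colDeg_tog_right {v} a w E
        simp [hva, hvb, hcol] at this
        omega
      rw [colDeg_tog_of_ne _ hwa hwb, hcol, hc w hwa hwb]
    · simp [tog, hva]
    · simp [tog, hvb]
  · rintro ⟨E, v⟩ h
    simp only [codegClass, biClass, coe_sigma, coe_filter, mem_filter, mem_univ, true_and,
      Set.mem_sigma_iff, Set.mem_ofPred_eq] at h ⊢
    obtain ⟨⟨⟨hr, hcol⟩, hk⟩, hvb, hva⟩ := h
    refine ⟨⟨⟨fun x => by rw [rowDeg_tog, hr], fun w => ?_⟩, by rw [codeg_tog, hk]⟩, ?_, ?_⟩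
    · by_cases hwa : w = a
      · subst hwa
        have := colDeg_tog_left {v} w b E
        simp [hva, hvb, hcol] at this
        omega
      by_cases hwb : w = b
      · subst hwb
        have := colDeg_tog_right {v} a w E
        simp [hva, hvb, hcol] at this
        omega
      rw [colDeg_tog_of_ne _ hwa hwb, hcol, hc w hwa hwb]
    · simp [tog, hvb]
    · simp [tog, hva]
  · rintro ⟨E, v⟩ -
    simp [tog_tog]
  · rintro ⟨E, v⟩ -
    simp [tog_tog]

/-- Graphs in a codegree class whose row `v` contains `J` and `b` but not `a`. -/
def patClass (r : V → ℕ) (c : W → ℕ) (v : V) (J : Finset W) (b a : W) (k : ℕ) :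
    Finset (V → W → Bool) :=
  (codegClass r c a b k).filter fun E =>
    (∀ w ∈ J, E v w = true) ∧ E v b = true ∧ E v a = false

/-- Exchanging `a` and `b` in row `v` by a degree-preserving switch. -/
lemma card_patClass_switch (r : V → ℕ) (c : W → ℕ) (v : V) {J : Finset W} {a b : W}
    (haJ : a ∉ J) (hbJ : b ∉ J) (k : ℕ) :
    (patClass r c v J b a k).card * (c a - k) = (patClass r c v J a b k).card * (c b - k) := by
  have key : ∀ (a b : W), ∀ E ∈ patClass r c v J b a k,
      (univ.filter fun x => E x a = true ∧ E x b = false).card = c a - k := by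
    intro a b E hE
    simp only [patClass, codegClass, biClass, mem_filter, mem_univ, true_and] at hE
    have := card_diff_add_codeg E a b
    rw [hE.1.2, hE.1.1.2 a] at this
    omega
  have key' : ∀ (a b : W), ((patClass r c v J b a k).sigma fun E =>
      univ.filter fun x => E x a = true ∧ E x b = false).card
        = (patClass r c v J b a k).card * (c a - k) := by
    intro a b
    rw [card_sigma, sum_congr rfl (key a b), sum_const, smul_eq_mul]
  have maps : ∀ (a b : W), a ∉ J → b ∉ J → ∀ E x,
      (E ∈ patClass r c v J b a k ∧ E x a = true ∧ E x b = false) →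
      (tog {v, x} a b E ∈ patClass r c v J a b k ∧ tog {v, x} a b E x b = true ∧
        tog {v, x} a b E x a = false) := by
    intro a b haJ hbJ E x h
    simp only [patClass, codegClass, biClass, mem_filter, mem_univ, true_and] at h ⊢
    obtain ⟨⟨⟨⟨hr, hcol⟩, hk⟩, hJ, hvb, hva⟩, hxa, hxb⟩ := h
    have hvx : v ≠ x := by
      rintro rfl
      simp [hva] at hxa
    refine ⟨⟨⟨⟨fun x => by rw [rowDeg_tog, hr], fun w => ?_⟩, ?_⟩, fun w hw => ?_, ?_, ?_⟩, ?_, ?_⟩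
    · by_cases hwa : w = a
      · subst hwa
        have := colDeg_tog_left {v, x} w b E
        simp [sum_pair hvx, hva, hvb, hxa, hxb, hcol] at this
        omega
      by_cases hwb : w = b
      · subst hwb
        have := colDeg_tog_right {v, x} a w E
        simp [sum_pair hvx, hva, hvb, hxa, hxb, hcol] at this
        omega
      rw [colDeg_tog_of_ne _ hwa hwb, hcol]
    · rw [codeg_comm, codeg_tog, hk]
    · have h1 : w ≠ a := fun h => haJ (h ▸ hw)
      have h2 : w ≠ b := fun h => hbJ (h ▸ hw)
      simp [tog, Equiv.swap_apply_of_ne_of_ne h1 h2, hJ w hw]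
    · simp [tog, hvb]
    · simp [tog, hva]
    · simp [tog, hxa]
    · simp [tog, hxb]
  rw [← key' a b, ← key' b a]
  refine card_nbij' (fun x => ⟨tog {v, x.2} a b x.1, x.2⟩) (fun x => ⟨tog {v, x.2} a b x.1, x.2⟩)
    ?_ ?_ ?_ ?_
  · rintro ⟨E, x⟩ h
    simp only [mem_coe, mem_sigma, mem_filter, mem_univ, true_and] at h ⊢
    exact maps a b haJ hbJ E x h
  · rintro ⟨E, x⟩ h
    simp only [mem_coe, mem_sigma, mem_filter, mem_univ, true_and] at h ⊢
    rw [tog_comm]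
    exact maps b a hbJ haJ E x h
  · rintro ⟨E, v⟩ -
    simp [tog_tog]
  · rintro ⟨E, v⟩ -
    simp [tog_tog]

/-- Switches raising the codegree of `a` and `b` by one. -/
def upSwitch (E : V → W → Bool) (a b : W) : Finset (V × V × W) :=
  univ.filter fun x => (E x.1 a = true ∧ E x.1 b = false) ∧ (E x.2.1 b = true ∧ E x.2.1 a = false) ∧
    (E x.1 x.2.2 = true ∧ E x.2.1 x.2.2 = false) ∧ x.2.2 ≠ a

/-- Switches lowering the codegree of `a` and `b` by one. -/
def downSwitch (E : V → W → Bool) (a b : W) : Finset (V × V × W) :=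
  univ.filter fun x => (E x.1 a = true ∧ E x.1 b = true) ∧ (E x.2.1 a = false ∧ E x.2.1 b = false) ∧
    (E x.2.1 x.2.2 = true ∧ E x.1 x.2.2 = false)

lemma codeg_eq_sum (E : V → W → Bool) (a b : W) :
    codeg E a b = ∑ v, (E v a && E v b).toNat := by
  rw [codeg, card_filter]
  exact sum_congr rfl fun v _ => by cases E v a <;> cases E v b <;> simp

lemma codeg_tog_pair {a b w : W} {v v' : V} (hv : v ≠ v') (hab : a ≠ b) (hwa : w ≠ a)
    (E : V → W → Bool) :
    codeg (tog {v, v'} b w E) a b + (E v a && E v b).toNat + (E v' a && E v' b).toNat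
      = codeg E a b + (E v a && E v w).toNat + (E v' a && E v' w).toNat := by
  rw [codeg_eq_sum, codeg_eq_sum, ← sum_add_sum_compl {v, v'},
    ← sum_add_sum_compl {v, v'} (fun x => (E x a && E x b).toNat), sum_pair hv, sum_pair hv]
  have h2 : ∑ x ∈ ({v, v'} : Finset V)ᶜ, (tog {v, v'} b w E x a && tog {v, v'} b w E x b).toNat
      = ∑ x ∈ ({v, v'} : Finset V)ᶜ, (E x a && E x b).toNat :=
    sum_congr rfl fun x hx => by
      have := mem_compl.1 hx
      simp only [tog, this, if_false]
  rw [h2]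
  have h3 : Equiv.swap b w a = a := Equiv.swap_apply_of_ne_of_ne hab (Ne.symm hwa)
  simp [tog, h3]
  omega

/-- Double counting of the switches changing the codegree of `a` and `b`. -/
lemma sum_upSwitch_eq (r : V → ℕ) (c : W → ℕ) {a b : W} (hab : a ≠ b) (k : ℕ) :
    ∑ E ∈ codegClass r c a b k, (upSwitch E a b).card
      = ∑ E ∈ codegClass r c a b (k + 1), (downSwitch E a b).card := by
  rw [← card_sigma, ← card_sigma]
  have coltog : ∀ (E : V → W → Bool) (v v' : V) (w : W), v ≠ v' → E v b ≠ E v' b →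
      E v w = E v' b → E v' w = E v b → ∀ x, colDeg (tog {v, v'} b w E) x = colDeg E x := by
    intro E v v' w hv h1 h2 h3 x
    by_cases hxb : x = b
    · subst hxb
      have := colDeg_tog_left {v, v'} x w E
      rw [sum_pair hv, sum_pair hv, h2, h3] at this
      omega
    by_cases hxw : x = w
    · subst hxw
      have := colDeg_tog_right {v, v'} b x E
      rw [sum_pair hv, sum_pair hv, h2, h3] at this
      omega
    exact colDeg_tog_of_ne _ hxb hxw _
  refine card_nbij' (fun x => ⟨tog {x.2.1, x.2.2.1} b x.2.2.2 x.1, x.2⟩)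
    (fun x => ⟨tog {x.2.1, x.2.2.1} b x.2.2.2 x.1, x.2⟩) ?_ ?_ ?_ ?_
  · rintro ⟨E, v, v', w⟩ h
    simp only [mem_coe, mem_sigma, upSwitch, downSwitch, codegClass, biClass, mem_filter, mem_univ,
      true_and] at h ⊢
    obtain ⟨⟨⟨hr, hcol⟩, hk⟩, ⟨hva, hvb⟩, ⟨hvb', hva'⟩, ⟨hvw, hvw'⟩, hwa⟩ := h
    have hv : v ≠ v' := by
      rintro rfl
      simp [hva'] at hva
    have h3 : Equiv.swap b w a = a := Equiv.swap_apply_of_ne_of_ne hab (Ne.symm hwa)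
    refine ⟨⟨⟨fun x => by rw [rowDeg_tog, hr], fun x => ?_⟩, ?_⟩, ?_⟩
    · rw [coltog E v v' w hv (by simp [hvb, hvb']) (by simp [hvw, hvb']) (by simp [hvw', hvb]), hcol]
    · have := codeg_tog_pair hv hab hwa E
      simp [hva, hvb, hva', hvb', hvw, hvw', hk] at this
      exact this
    · simp [tog, h3, hva, hvb, hva', hvb', hvw, hvw']
  · rintro ⟨E, v, v', w⟩ h
    simp only [mem_coe, mem_sigma, upSwitch, downSwitch, codegClass, biClass, mem_filter, mem_univ,
      true_and] at h ⊢
    obtain ⟨⟨⟨hr, hcol⟩, hk⟩, ⟨hva, hvb⟩, ⟨hva', hvb'⟩, ⟨hvw', hvw⟩⟩ := h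
    have hv : v ≠ v' := by
      rintro rfl
      simp [hva'] at hva
    have hwa : w ≠ a := by
      rintro rfl
      simp [hva'] at hvw'
    have h3 : Equiv.swap b w a = a := Equiv.swap_apply_of_ne_of_ne hab (Ne.symm hwa)
    refine ⟨⟨⟨fun x => by rw [rowDeg_tog, hr], fun x => ?_⟩, ?_⟩, ?_⟩
    · rw [coltog E v v' w hv (by simp [hvb, hvb']) (by simp [hvw, hvb']) (by simp [hvw', hvb]), hcol]
    · have := codeg_tog_pair hv hab hwa E
      simp [hva, hvb, hva', hvb', hvw, hvw', hk] at this
      exact this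
    · simp [tog, h3, hva, hvb, hva', hvb', hvw, hvw', hwa]
  · rintro ⟨E, v⟩ -
    simp [tog_tog]
  · rintro ⟨E, v⟩ -
    simp [tog_tog]

end Switching

section Cut

variable {V W : Type*} [Fintype V] [Fintype W] [DecidableEq V] [DecidableEq W]

/-- The sign `1` for an edge and `-1` for a non-edge. -/
def edgeSign (x : Bool) : ℝ := if x then 1 else -1

/-- Twice the discrepancy of the number of edges between `X` and `Z`. -/
noncomputable def cutSum (E : V → W → Bool) (X : Finset V) (Z : Finset W) : ℝ :=
  ∑ v ∈ X, ∑ w ∈ Z, edgeSign (E v w)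

/-- All discrepancies of `E` are bounded by `s`. -/
def CutGood (s : ℝ) (E : V → W → Bool) : Prop := ∀ X Z, |cutSum E X Z| ≤ s

lemma sum_exp_cutSum_le (X : Finset V) (Z : Finset W) (l : ℝ) :
    ∑ E : V → W → Bool, Real.exp (l * cutSum E X Z)
      ≤ 2 ^ (Fintype.card V * Fintype.card W) *
        Real.exp (Fintype.card V * Fintype.card W * (l ^ 2 / 2)) := by
  have h0 : ∀ E : V → W → Bool, Real.exp (l * cutSum E X Z)
      = ∏ v, ∏ w, (if v ∈ X ∧ w ∈ Z then Real.exp (l * edgeSign (E v w)) else 1) := by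
    intro E
    have : l * cutSum E X Z
        = ∑ v, ∑ w, (if v ∈ X ∧ w ∈ Z then l * edgeSign (E v w) else 0) := by
      rw [cutSum, mul_sum, ← sum_filter_add_sum_filter_not univ (fun v => v ∈ X)]
      have h1 : ∑ v ∈ univ.filter (fun v => v ∉ X),
          ∑ w, (if v ∈ X ∧ w ∈ Z then l * edgeSign (E v w) else 0) = 0 :=
        sum_eq_zero fun v hv => sum_eq_zero fun w _ => by simp [(mem_filter.1 hv).2]
      rw [h1, add_zero, filter_mem_eq_inter, univ_inter]
      refine sum_congr rfl fun v hv => ?_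
      simp only [hv, true_and, sum_ite_mem, univ_inter, mul_sum]
    rw [this, Real.exp_sum]
    refine prod_congr rfl fun v _ => ?_
    rw [Real.exp_sum]
    refine prod_congr rfl fun w _ => ?_
    split_ifs <;> simp
  have h1 : ∑ E : V → W → Bool, Real.exp (l * cutSum E X Z)
      = ∏ v, ∏ w, ∑ x : Bool, (if v ∈ X ∧ w ∈ Z then Real.exp (l * edgeSign x) else 1) := by
    rw [sum_congr rfl fun E _ => h0 E]
    have := prod_univ_sum (fun _ : V => (univ : Finset (W → Bool)))
      (fun v f => ∏ w, (if v ∈ X ∧ w ∈ Z then Real.exp (l * edgeSign (f w)) else 1))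
    rw [Fintype.piFinset_univ] at this
    rw [← this]
    refine prod_congr rfl fun v _ => ?_
    have := prod_univ_sum (fun _ : W => (univ : Finset Bool))
      (fun w x => (if v ∈ X ∧ w ∈ Z then Real.exp (l * edgeSign x) else 1))
    rw [Fintype.piFinset_univ] at this
    rw [← this]
  have h2 : ∀ v w, ∑ x : Bool, (if v ∈ X ∧ w ∈ Z then Real.exp (l * edgeSign x) else 1)
      ≤ 2 * Real.exp (l ^ 2 / 2) := by
    intro v w
    have hc := Real.cosh_le_exp_half_sq l
    rw [Real.cosh_eq] at hc
    have h1 : (1 : ℝ) ≤ Real.exp (l ^ 2 / 2) := Real.one_le_exp (by positivity)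
    split_ifs
    · simp only [edgeSign, Fintype.sum_bool, if_true, Bool.false_eq_true, if_false, mul_one, mul_neg]
      linarith
    · simp only [sum_const, card_univ, Fintype.card_bool, nsmul_eq_mul]
      push_cast
      linarith
  rw [h1]
  calc ∏ v, ∏ w, ∑ x : Bool, (if v ∈ X ∧ w ∈ Z then Real.exp (l * edgeSign x) else 1)
      ≤ ∏ _v : V, ∏ _w : W, (2 * Real.exp (l ^ 2 / 2)) := by
        refine prod_le_prod (fun v _ => prod_nonneg fun w _ => sum_nonneg fun x _ => ?_)
          fun v _ => prod_le_prod (fun w _ => sum_nonneg fun x _ => ?_) fun w _ => h2 v w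
        all_goals split_ifs <;> positivity
    _ = _ := by
        simp only [prod_const, card_univ]
        rw [← pow_mul, mul_comm (Fintype.card W), mul_pow, ← Real.exp_nat_mul]
        push_cast
        ring_nf

lemma card_abs_cutSum_gt_le (hV : 0 < Fintype.card V) (hW : 0 < Fintype.card W)
    (X : Finset V) (Z : Finset W) {s : ℝ} (hs : 0 ≤ s) :
    ((univ.filter fun E : V → W → Bool => s < |cutSum E X Z|).card : ℝ)
      ≤ 2 * 2 ^ (Fintype.card V * Fintype.card W) *
        Real.exp (-(s ^ 2 / (2 * (Fintype.card V * Fintype.card W)))) := by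
  set N : ℝ := Fintype.card V * Fintype.card W with hN
  have hNpos : 0 < N := by positivity
  have h1 := sum_exp_cutSum_le X Z (s / N)
  have h2 := sum_exp_cutSum_le X Z (-(s / N))
  have h3 : ((univ.filter fun E : V → W → Bool => s < |cutSum E X Z|).card : ℝ)
      * Real.exp (s ^ 2 / N)
      ≤ ∑ E : V → W → Bool, (Real.exp (s / N * cutSum E X Z) +
          Real.exp (-(s / N) * cutSum E X Z)) := by
    rw [← nsmul_eq_mul, ← sum_const]
    calc _ ≤ ∑ E ∈ univ.filter (fun E : V → W → Bool => s < |cutSum E X Z|),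
          (Real.exp (s / N * cutSum E X Z) + Real.exp (-(s / N) * cutSum E X Z)) := by
          refine sum_le_sum fun E hE => ?_
          have hE := (mem_filter.1 hE).2
          have h4 : Real.exp (s ^ 2 / N) ≤ Real.exp (s / N * |cutSum E X Z|) := by
            apply Real.exp_le_exp.2
            rw [pow_two, mul_div_right_comm]
            gcongr
          rcases abs_choice (cutSum E X Z) with h | h
          · rw [h] at h4
            linarith [Real.exp_pos (-(s / N) * cutSum E X Z)]
          · rw [h, mul_neg, ← neg_mul] at h4
            linarith [Real.exp_pos ((s / N) * cutSum E X Z)]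
      _ ≤ _ := sum_le_sum_of_subset_of_nonneg (filter_subset _ _) fun _ _ _ => by positivity
  rw [sum_add_distrib] at h3
  have h5 : Real.exp (N * ((s / N) ^ 2 / 2)) = Real.exp (s ^ 2 / N) *
      Real.exp (-(s ^ 2 / (2 * N))) := by
    rw [← Real.exp_add]
    congr 1
    field_simp
    ring
  rw [neg_sq, h5] at h2
  rw [h5] at h1
  have h6 := Real.exp_pos (s ^ 2 / N)
  refine le_of_mul_le_mul_right ?_ h6
  linarith

/-- Most graphs have small discrepancies. -/
lemma card_not_cutGood_le (hV : 0 < Fintype.card V) (hW : 0 < Fintype.card W)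
    {s : ℝ} (hs : 0 ≤ s) :
    ((univ.filter fun E : V → W → Bool => ¬ CutGood s E).card : ℝ)
      ≤ 2 ^ (Fintype.card V + Fintype.card W + 1) * 2 ^ (Fintype.card V * Fintype.card W) *
        Real.exp (-(s ^ 2 / (2 * (Fintype.card V * Fintype.card W)))) := by
  have h1 : (univ.filter fun E : V → W → Bool => ¬ CutGood s E) ⊆
      (univ : Finset (Finset V × Finset W)).biUnion fun p =>
        univ.filter fun E : V → W → Bool => s < |cutSum E p.1 p.2| := by
    intro E hE
    have hE := (mem_filter.1 hE).2
    simp only [CutGood, not_forall, not_le] at hE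
    obtain ⟨X, Z, h⟩ := hE
    exact mem_biUnion.2 ⟨(X, Z), mem_univ _, mem_filter.2 ⟨mem_univ _, h⟩⟩
  calc ((univ.filter fun E : V → W → Bool => ¬ CutGood s E).card : ℝ)
      ≤ ∑ p : Finset V × Finset W,
        ((univ.filter fun E : V → W → Bool => s < |cutSum E p.1 p.2|).card : ℝ) := by
        exact_mod_cast (card_le_card h1).trans card_biUnion_le
    _ ≤ ∑ _p : Finset V × Finset W, 2 * 2 ^ (Fintype.card V * Fintype.card W) *
        Real.exp (-(s ^ 2 / (2 * (Fintype.card V * Fintype.card W)))) :=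
        sum_le_sum fun p _ => card_abs_cutSum_gt_le hV hW p.1 p.2 hs
    _ = _ := by
        rw [sum_const, card_univ, Fintype.card_prod, Fintype.card_finset, Fintype.card_finset,
          nsmul_eq_mul]
        push_cast
        ring

lemma sum_abs_le_of_cutGood {s : ℝ} {E : V → W → Bool} (hE : CutGood s E) (X : Finset V) :
    ∑ w, |∑ v ∈ X, edgeSign (E v w)| ≤ 2 * s := by
  have h1 := (abs_le.1 (hE X (univ.filter fun w => 0 ≤ ∑ v ∈ X, edgeSign (E v w)))).2
  have h2 := (abs_le.1 (hE X (univ.filter fun w => ¬ 0 ≤ ∑ v ∈ X, edgeSign (E v w)))).1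
  rw [cutSum, sum_comm] at h1 h2
  rw [← sum_filter_add_sum_filter_not univ (fun w => 0 ≤ ∑ v ∈ X, edgeSign (E v w))]
  have h3 : ∑ w ∈ univ.filter (fun w => 0 ≤ ∑ v ∈ X, edgeSign (E v w)),
      |∑ v ∈ X, edgeSign (E v w)| = ∑ w ∈ univ.filter (fun w => 0 ≤ ∑ v ∈ X, edgeSign (E v w)),
      ∑ v ∈ X, edgeSign (E v w) :=
    sum_congr rfl fun w hw => abs_of_nonneg (mem_filter.1 hw).2
  have h4 : ∑ w ∈ univ.filter (fun w => ¬ 0 ≤ ∑ v ∈ X, edgeSign (E v w)),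
      |∑ v ∈ X, edgeSign (E v w)| = -∑ w ∈ univ.filter (fun w => ¬ 0 ≤ ∑ v ∈ X,
      edgeSign (E v w)), ∑ v ∈ X, edgeSign (E v w) := by
    rw [← sum_neg_distrib]
    exact sum_congr rfl fun w hw => abs_of_neg (not_le.1 (mem_filter.1 hw).2)
  linarith

lemma sum_edgeSign (E : V → W → Bool) (X : Finset V) (w : W) :
    ∑ v ∈ X, edgeSign (E v w) = 2 * ((X.filter fun v => E v w = true).card : ℝ) - X.card ∧
    ∑ v ∈ X, edgeSign (E v w) = X.card - 2 * ((X.filter fun v => E v w = false).card : ℝ) := by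
  have h1 : ∑ v ∈ X, edgeSign (E v w) = ((X.filter fun v => E v w = true).card : ℝ) -
      ((X.filter fun v => E v w = false).card : ℝ) := by
    rw [card_filter, card_filter]
    push_cast
    rw [← sum_sub_distrib]
    exact sum_congr rfl fun v _ => by cases E v w <;> simp [edgeSign]
  have h2 : ((X.filter fun v => E v w = true).card : ℝ) +
      ((X.filter fun v => E v w = false).card : ℝ) = X.card := by
    have := card_filter_add_card_filter_not (s := X) (fun v => E v w = true)
    simp only [Bool.not_eq_true] at this
    exact_mod_cast this
  constructor <;> linarith

/-- The number of `v ∈ X`, `v' ∈ Y` and `w` with `v ∼ w` and `v' ≁ w`. -/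
def pathCount (E : V → W → Bool) (X Y : Finset V) : ℕ :=
  ∑ w, (X.filter fun v => E v w = true).card * (Y.filter fun v => E v w = false).card

lemma abs_pathCount_sub_le {s : ℝ} {E : V → W → Bool} (hE : CutGood s E) (X Y : Finset V) :
    |(pathCount E X Y : ℝ) - Fintype.card W * (X.card * Y.card) / 4| ≤
      3 / 2 * Fintype.card V * s := by
  have hP := sum_abs_le_of_cutGood hE X
  have hQ := sum_abs_le_of_cutGood hE Y
  set P : W → ℝ := fun w => ∑ v ∈ X, edgeSign (E v w) with hPd
  set Q : W → ℝ := fun w => ∑ v ∈ Y, edgeSign (E v w) with hQd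
  have hs : 0 ≤ s := (abs_nonneg _).trans (hE ∅ ∅)
  have hX : (X.card : ℝ) ≤ Fintype.card V := by exact_mod_cast card_le_univ X
  have hY : (Y.card : ℝ) ≤ Fintype.card V := by exact_mod_cast card_le_univ Y
  have h1 : (pathCount E X Y : ℝ) - Fintype.card W * (X.card * Y.card) / 4
      = ∑ w, (P w * (Y.card - Q w) - X.card * Q w) / 4 := by
    have h2 : (Fintype.card W : ℝ) * (X.card * Y.card) / 4
        = ∑ _w : W, (X.card * Y.card : ℝ) / 4 := by
      rw [sum_const, card_univ, nsmul_eq_mul]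
      ring
    rw [h2, pathCount]
    push_cast
    rw [← sum_sub_distrib]
    refine sum_congr rfl fun w _ => ?_
    have e1 := (sum_edgeSign E X w).1
    have e2 := (sum_edgeSign E Y w).2
    have e3 : ((X.filter fun v => E v w = true).card : ℝ) = (P w + X.card) / 2 := by
      simp only [hPd]
      linarith
    have e4 : ((Y.filter fun v => E v w = false).card : ℝ) = (Y.card - Q w) / 2 := by
      simp only [hQd]
      linarith
    rw [e3, e4]
    ring
  rw [h1]
  calc |∑ w, (P w * (Y.card - Q w) - X.card * Q w) / 4|
      ≤ ∑ w, |(P w * (Y.card - Q w) - X.card * Q w) / 4| := abs_sum_le_sum_abs _ _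
    _ ≤ ∑ w, (2 * Fintype.card V * |P w| + Fintype.card V * |Q w|) / 4 := by
        refine sum_le_sum fun w _ => ?_
        rw [abs_div, abs_of_pos (by norm_num : (0 : ℝ) < 4)]
        gcongr
        refine (abs_sub _ _).trans ?_
        rw [abs_mul, abs_mul, mul_comm |P w|]
        have e2 := (sum_edgeSign E Y w).2
        have e1 := (sum_edgeSign E Y w).1
        have e5 : |(Y.card : ℝ) - Q w| ≤ 2 * Fintype.card V := by
          rw [abs_le]
          have : (0 : ℝ) ≤ ((Y.filter fun v => E v w = false).card : ℝ) := Nat.cast_nonneg _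
          have : (0 : ℝ) ≤ ((Y.filter fun v => E v w = true).card : ℝ) := Nat.cast_nonneg _
          simp only [hQd]
          constructor <;> linarith
        rw [abs_of_nonneg (Nat.cast_nonneg (α := ℝ) X.card)]
        gcongr
    _ = (2 * Fintype.card V * ∑ w, |P w| + Fintype.card V * ∑ w, |Q w|) / 4 := by
        rw [← sum_div, sum_add_distrib, mul_sum, mul_sum]
    _ ≤ (2 * Fintype.card V * (2 * s) + Fintype.card V * (2 * s)) / 4 := by gcongr
    _ = _ := by ring

lemma card_paths (E : V → W → Bool) (X Y : Finset V) :
    (univ.filter fun x : V × V × W => x.1 ∈ X ∧ x.2.1 ∈ Y ∧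
      E x.1 x.2.2 = true ∧ E x.2.1 x.2.2 = false).card = pathCount E X Y := by
  have : pathCount E X Y = ((univ : Finset W).sigma fun w =>
      (X.filter fun v => E v w = true) ×ˢ (Y.filter fun v => E v w = false)).card := by
    rw [card_sigma]
    simp only [card_product, pathCount]
  rw [this]
  refine card_nbij' (fun x => ⟨x.2.2, x.1, x.2.1⟩) (fun x => (x.2.1, x.2.2, x.1)) ?_ ?_ ?_ ?_
  · rintro ⟨v, v', w⟩ h
    simp at h ⊢
    tauto
  · rintro ⟨w, v, v'⟩ h
    simp at h ⊢
    tauto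
  · rintro ⟨v, v', w⟩ h
    rfl
  · rintro ⟨w, v, v'⟩ h
    rfl

lemma card_upSwitch_le {s : ℝ} {E : V → W → Bool} (hE : CutGood s E) (a b : W) :
    ((upSwitch E a b).card : ℝ) ≤ Fintype.card W * (((colDeg E a : ℝ) - codeg E a b) *
      ((colDeg E b : ℝ) - codeg E a b)) / 4 + 3 / 2 * Fintype.card V * s ∧
    Fintype.card W * (((colDeg E a : ℝ) - codeg E a b) *
      ((colDeg E b : ℝ) - codeg E a b)) / 4 - 3 / 2 * Fintype.card V * s - Fintype.card V ^ 2
      ≤ ((upSwitch E a b).card : ℝ) := by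
  set X := univ.filter fun v => E v a = true ∧ E v b = false with hX
  set Y := univ.filter fun v => E v b = true ∧ E v a = false with hY
  have cX : (X.card : ℝ) = (colDeg E a : ℝ) - codeg E a b := by
    rw [← card_diff_add_codeg E a b]; push_cast; ring
  have cY : (Y.card : ℝ) = (colDeg E b : ℝ) - codeg E a b := by
    rw [codeg_comm, ← card_diff_add_codeg E b a]; push_cast; ring
  have h := abs_le.1 (abs_pathCount_sub_le hE X Y)
  rw [cX, cY, ← card_paths] at h
  have h1 : (upSwitch E a b).card ≤ (univ.filter fun x : V × V × W => x.1 ∈ X ∧ x.2.1 ∈ Y ∧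
      E x.1 x.2.2 = true ∧ E x.2.1 x.2.2 = false).card := by
    refine card_le_card fun x hx => ?_
    simp only [upSwitch, hX, hY, mem_filter, mem_univ, true_and] at hx ⊢
    tauto
  have h2 : (univ.filter fun x : V × V × W => x.1 ∈ X ∧ x.2.1 ∈ Y ∧
      E x.1 x.2.2 = true ∧ E x.2.1 x.2.2 = false).card
      ≤ (upSwitch E a b).card + Fintype.card V ^ 2 := by
    have : Fintype.card V ^ 2 = ((univ : Finset (V × V)).map
        ⟨fun p => (p.1, p.2, a), fun p q h => by
          simp only [Prod.mk.injEq] at h; exact Prod.ext h.1 h.2.1⟩).card := by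
      rw [card_map, card_univ, Fintype.card_prod, pow_two]
    rw [this]
    refine (card_le_card fun x hx => ?_).trans (card_union_le _ _)
    obtain ⟨v, v', w⟩ := x
    by_cases hw : w = a
    · exact mem_union_right _ (mem_map.2 ⟨(v, v'), mem_univ _, by rw [hw]; rfl⟩)
    simp only [upSwitch, hX, hY, mem_union, mem_filter, mem_univ, true_and] at hx ⊢
    · left
      tauto
  have h1' : ((upSwitch E a b).card : ℝ) ≤ _ := Nat.cast_le.2 h1
  have h2' := (Nat.cast_le (α := ℝ)).2 h2
  push_cast at h2'
  constructor <;> linarith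

lemma card_downSwitch_bounds {s : ℝ} {E : V → W → Bool} (hE : CutGood s E) (a b : W) :
    |((downSwitch E a b).card : ℝ) - Fintype.card W * (((Fintype.card V : ℝ) - colDeg E a
      - colDeg E b + codeg E a b) * codeg E a b) / 4| ≤ 3 / 2 * Fintype.card V * s := by
  set X := univ.filter fun v => E v a = false ∧ E v b = false with hX
  set Y := univ.filter fun v => E v a = true ∧ E v b = true with hY
  have cY : (Y.card : ℝ) = codeg E a b := rfl
  have cX : (X.card : ℝ) = (Fintype.card V : ℝ) - colDeg E a - colDeg E b + codeg E a b := by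
    have h1 := card_diff_add_codeg E b a
    have h2 : X.card + (univ.filter fun v => E v b = true ∧ E v a = false).card + colDeg E a
        = Fintype.card V := by
      rw [hX, colDeg, card_filter, card_filter, card_filter, ← sum_add_distrib, ← sum_add_distrib,
        ← card_univ, card_eq_sum_ones]
      exact sum_congr rfl fun v _ => by cases E v a <;> cases E v b <;> simp
    rw [codeg_comm] at h1
    have h1' := congrArg (Nat.cast : ℕ → ℝ) h1
    have h2' := congrArg (Nat.cast : ℕ → ℝ) h2
    push_cast at h1' h2'
    linarith
  have h := abs_pathCount_sub_le hE X Y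
  rw [cX, cY, ← card_paths] at h
  suffices h3 : (downSwitch E a b).card = (univ.filter fun x : V × V × W => x.1 ∈ X ∧ x.2.1 ∈ Y ∧
      E x.1 x.2.2 = true ∧ E x.2.1 x.2.2 = false).card by
    rw [h3]
    exact h
  rw [downSwitch]
  refine card_nbij' (fun x => (x.2.1, x.1, x.2.2)) (fun x => (x.2.1, x.1, x.2.2)) ?_ ?_ ?_ ?_
  · rintro ⟨v, v', w⟩ h
    simp [hX, hY] at h ⊢
    tauto
  · rintro ⟨v, v', w⟩ h
    simp [hX, hY] at h ⊢
    tauto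
  · rintro ⟨v, v', w⟩ h
    rfl
  · rintro ⟨v, v', w⟩ h
    rfl

end Cut

section Concentration

variable {V W : Type*} [Fintype V] [Fintype W] [DecidableEq V] [DecidableEq W]

/-- Degree data on a nearly square bipartition, with all degrees close to half of the
number `ν ^ 20` of columns. -/
structure Near (ν : ℝ) (r : V → ℕ) (c : W → ℕ) : Prop where
  large : 10 ^ 6 ≤ ν
  cardW : (Fintype.card W : ℝ) = ν ^ 20
  cardV : |(Fintype.card V : ℝ) - ν ^ 20| ≤ ν ^ 11
  row : ∀ v, |(r v : ℝ) - ν ^ 20 / 2| ≤ ν ^ 11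
  col : ∀ w, |(c w : ℝ) - ν ^ 20 / 2| ≤ ν ^ 11
  sum : ∑ v, r v = ∑ w, c w

lemma mul_pow_le_pow {ν : ℝ} (hν : 10 ^ 6 ≤ ν) (k : ℕ) : 10 ^ 6 * ν ^ k ≤ ν ^ (k + 1) := by
  rw [pow_succ, mul_comm]
  exact mul_le_mul_of_nonneg_left hν (by positivity)

lemma mul_pow_le_pow_of_lt {ν : ℝ} (hν : 10 ^ 6 ≤ ν) {k l : ℕ} (h : k < l) :
    10 ^ 6 * ν ^ k ≤ ν ^ l :=
  (mul_pow_le_pow hν k).trans (pow_le_pow_right₀ (by linarith) h)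

lemma exp_neg_pow_five_le {ν : ℝ} (hν : 10 ^ 6 ≤ ν) :
    Real.exp (-(ν ^ 5 / 3)) ≤ (ν ^ 200)⁻¹ := by
  have h1 : ν ≤ Real.exp ν := by linarith [Real.add_one_le_exp ν]
  have h2 : ν ^ 200 ≤ Real.exp (ν ^ 5 / 3) := by
    calc ν ^ 200 ≤ (Real.exp ν) ^ 200 := by gcongr
      _ = Real.exp (200 * ν) := by rw [← Real.exp_nat_mul]; norm_num
      _ ≤ _ := by
        apply Real.exp_le_exp.2
        have := mul_pow_le_pow_of_lt hν (show 1 < 5 by norm_num)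
        rw [pow_one] at this
        linarith
  rw [Real.exp_neg]
  exact inv_anti₀ (by positivity) h2

lemma exp_neg_pow_le {ν : ℝ} (hν : 10 ^ 6 ≤ ν) {k : ℕ} (hk : 5 ≤ k) :
    Real.exp (-ν ^ k) ≤ (ν ^ 200)⁻¹ := by
  refine le_trans (Real.exp_le_exp.2 ?_) (exp_neg_pow_five_le hν)
  have : ν ^ 5 ≤ ν ^ k := pow_le_pow_right₀ (by linarith) hk
  have : 0 ≤ ν ^ 5 := by positivity
  linarith

lemma Near.card_le {ν : ℝ} {r : V → ℕ} {c : W → ℕ} (h : Near ν r c) :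
    (Fintype.card V : ℝ) ≤ 1.01 * ν ^ 20 := by
  have h1 := (abs_le.1 h.cardV).2
  have h2 := mul_pow_le_pow_of_lt h.large (show 11 < 20 by norm_num)
  linarith

lemma Near.le_card {ν : ℝ} {r : V → ℕ} {c : W → ℕ} (h : Near ν r c) :
    0.99 * ν ^ 20 ≤ (Fintype.card V : ℝ) := by
  have h1 := (abs_le.1 h.cardV).1
  have h2 := mul_pow_le_pow_of_lt h.large (show 11 < 20 by norm_num)
  linarith

lemma Near.card_not_cutGood_le {ν : ℝ} {r : V → ℕ} {c : W → ℕ} (h : Near ν r c)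
    (hN : 2 ^ (Fintype.card V * Fintype.card W) * Real.exp (-ν ^ 23) ≤ (biClass r c).card) :
    ((univ.filter fun E : V → W → Bool => ¬ CutGood (ν ^ 32) E).card : ℝ)
      ≤ Real.exp (-ν ^ 23) * (biClass r c).card := by
  have hν := h.large
  have hpos : 0 < ν := by linarith
  have hm := h.card_le
  have hm' := h.le_card
  have hn := h.cardW
  have hV : 0 < Fintype.card V := by
    have : (0 : ℝ) < Fintype.card V := lt_of_lt_of_le (by positivity) hm'
    exact_mod_cast this
  have hW : 0 < Fintype.card W := by
    have : (0 : ℝ) < Fintype.card W := by rw [hn]; positivity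
    exact_mod_cast this
  refine (_root_.card_not_cutGood_le hV hW (by positivity : 0 ≤ ν ^ 32)).trans ?_
  have h2 : (2 : ℝ) ^ (Fintype.card V + Fintype.card W + 1) ≤ Real.exp (3 * ν ^ 20) := by
    calc (2 : ℝ) ^ (Fintype.card V + Fintype.card W + 1)
        ≤ (Real.exp 1) ^ (Fintype.card V + Fintype.card W + 1) := by
          gcongr
          linarith [Real.add_one_le_exp 1]
      _ = Real.exp (Fintype.card V + Fintype.card W + 1) := by
          rw [← Real.exp_nat_mul]; push_cast; ring_nf
      _ ≤ _ := by
          apply Real.exp_le_exp.2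
          rw [hn]
          have := mul_pow_le_pow_of_lt hν (show 0 < 20 by norm_num)
          rw [pow_zero] at this
          linarith
  have h3 : Real.exp (-((ν ^ 32) ^ 2 / (2 * (Fintype.card V * Fintype.card W))))
      ≤ Real.exp (-(ν ^ 24 / 3)) := by
    apply Real.exp_le_exp.2
    apply neg_le_neg
    rw [hn, le_div_iff₀ (by rw [hn] at *; positivity)]
    calc ν ^ 24 / 3 * (2 * (Fintype.card V * ν ^ 20))
        ≤ ν ^ 24 / 3 * (2 * (1.01 * ν ^ 20 * ν ^ 20)) := by gcongr
      _ ≤ (ν ^ 32) ^ 2 := by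
        have : 0 ≤ ν ^ 64 := by positivity
        nlinarith
  have h4 : Real.exp (3 * ν ^ 20) * Real.exp (-(ν ^ 24 / 3)) ≤
      Real.exp (-ν ^ 23) * Real.exp (-ν ^ 23) := by
    rw [← Real.exp_add, ← Real.exp_add]
    apply Real.exp_le_exp.2
    have := mul_pow_le_pow_of_lt hν (show 20 < 24 by norm_num)
    have := mul_pow_le_pow_of_lt hν (show 23 < 24 by norm_num)
    linarith [pow_pos hpos 20, pow_pos hpos 23]
  calc _ ≤ Real.exp (3 * ν ^ 20) * 2 ^ (Fintype.card V * Fintype.card W) *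
        Real.exp (-(ν ^ 24 / 3)) := by gcongr
    _ = 2 ^ (Fintype.card V * Fintype.card W) * (Real.exp (3 * ν ^ 20) *
        Real.exp (-(ν ^ 24 / 3))) := by ring
    _ ≤ 2 ^ (Fintype.card V * Fintype.card W) * (Real.exp (-ν ^ 23) * Real.exp (-ν ^ 23)) := by
        gcongr
    _ = Real.exp (-ν ^ 23) * (2 ^ (Fintype.card V * Fintype.card W) * Real.exp (-ν ^ 23)) := by
        ring
    _ ≤ _ := by gcongr

lemma switch_ratio_numeric {ν m : ℝ} (hν : 10 ^ 6 ≤ ν) (hm : m ≤ 1.01 * ν ^ 20) (hm0 : 0 ≤ m) :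
    ν ^ 20 * ((ν ^ 20 / 4 - ν ^ 13 / 3) * (ν ^ 20 / 4 - ν ^ 13 / 3)) / 4 + 3 / 2 * m * ν ^ 32 ≤
      (1 - (ν ^ 8)⁻¹) * (ν ^ 20 * ((ν ^ 20 / 4 + ν ^ 13 / 3) * (ν ^ 20 / 4 + ν ^ 13 / 3)) / 4
        - 3 / 2 * m * ν ^ 32 - m ^ 2) ∧
    1 ≤ ν ^ 20 * ((ν ^ 20 / 4 + ν ^ 13 / 3) * (ν ^ 20 / 4 + ν ^ 13 / 3)) / 4
        - 3 / 2 * m * ν ^ 32 - m ^ 2 := by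
  have hpos : 0 < ν := by linarith
  have h1 : m * ν ^ 32 ≤ 1.01 * ν ^ 52 := by
    have : 0 ≤ ν ^ 32 := by positivity
    nlinarith
  have h2 : m ^ 2 ≤ 2 * ν ^ 40 := by
    have : m ^ 2 ≤ (1.01 * ν ^ 20) ^ 2 := by gcongr
    have : 0 ≤ ν ^ 40 := by positivity
    nlinarith
  have h3 : 0 ≤ m * ν ^ 32 := by positivity
  set B := ν ^ 20 * ((ν ^ 20 / 4 + ν ^ 13 / 3) * (ν ^ 20 / 4 + ν ^ 13 / 3)) / 4
        - 3 / 2 * m * ν ^ 32 - m ^ 2 with hB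
  have e60 := mul_pow_le_pow_of_lt hν (show 53 < 60 by norm_num)
  have e60' := mul_pow_le_pow_of_lt hν (show 46 < 60 by norm_num)
  have e60'' := mul_pow_le_pow_of_lt hν (show 52 < 60 by norm_num)
  have e60c := mul_pow_le_pow_of_lt hν (show 40 < 60 by norm_num)
  have e53 := mul_pow_le_pow_of_lt hν (show 52 < 53 by norm_num)
  have e53' := mul_pow_le_pow_of_lt hν (show 40 < 53 by norm_num)
  have e0 := mul_pow_le_pow_of_lt hν (show 0 < 60 by norm_num)
  have p40 : 0 ≤ ν ^ 40 := by positivity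
  have p46 : 0 ≤ ν ^ 46 := by positivity
  have p52 : 0 ≤ ν ^ 52 := by positivity
  have p53 : 0 ≤ ν ^ 53 := by positivity
  have p60 : 0 ≤ ν ^ 60 := by positivity
  have hBe : B = ν ^ 60 / 64 + ν ^ 53 / 24 + ν ^ 46 / 36 - 3 / 2 * (m * ν ^ 32) - m ^ 2 := by
    rw [hB]; ring
  have hBle : B ≤ ν ^ 60 := by
    have := sq_nonneg m
    linarith
  have hB8 : (ν ^ 8)⁻¹ * B ≤ ν ^ 52 := by
    calc (ν ^ 8)⁻¹ * B ≤ (ν ^ 8)⁻¹ * ν ^ 60 := by gcongr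
      _ = ν ^ 52 := by field_simp
  constructor
  · have : ν ^ 20 * ((ν ^ 20 / 4 - ν ^ 13 / 3) * (ν ^ 20 / 4 - ν ^ 13 / 3)) / 4
        + 3 / 2 * m * ν ^ 32 = ν ^ 60 / 64 - ν ^ 53 / 24 + ν ^ 46 / 36 + 3 / 2 * (m * ν ^ 32) := by
      ring
    rw [this, sub_mul, one_mul]
    linarith
  · rw [hBe]
    rw [pow_zero] at e0
    linarith

lemma le_geom_of_rec {h : ℕ → ℝ} {q ε : ℝ} (hq0 : 0 ≤ q) (hq : q ≤ 1) (hε : 0 ≤ ε) {J : ℕ}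
    (hrec : ∀ j < J, h (j + 1) ≤ q * h j + ε) : ∀ j ≤ J, h j ≤ q ^ j * h 0 + j * ε := by
  intro j
  induction j with
  | zero => intro _; simp
  | succ j ih =>
    intro hj
    calc h (j + 1) ≤ q * h j + ε := hrec j hj
      _ ≤ q * (q ^ j * h 0 + j * ε) + ε := by gcongr; exact ih (by omega)
      _ ≤ q ^ (j + 1) * h 0 + (j + 1 : ℕ) * ε := by
        have : q * (j * ε) ≤ 1 * (j * ε) := by gcongr
        push_cast
        rw [pow_succ]
        linarith

/-- Graphs of small discrepancy in a codegree class. -/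
noncomputable def goodClass (ν : ℝ) (r : V → ℕ) (c : W → ℕ) (a b : W) (k : ℕ) :
    Finset (V → W → Bool) :=
  (codegClass r c a b k).filter fun E => CutGood (ν ^ 32) E

lemma codeg_le_colDeg (E : V → W → Bool) (a b : W) :
    codeg E a b ≤ colDeg E a ∧ codeg E a b ≤ colDeg E b := by
  have h1 := card_diff_add_codeg E a b
  have h2 := card_diff_add_codeg E b a
  rw [codeg_comm] at h2
  omega

lemma mem_goodClass {ν : ℝ} {r : V → ℕ} {c : W → ℕ} {a b : W} {k : ℕ} {E : V → W → Bool} :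
    E ∈ goodClass ν r c a b k ↔ ((∀ v, rowDeg E v = r v) ∧ ∀ w, colDeg E w = c w) ∧
      codeg E a b = k ∧ CutGood (ν ^ 32) E := by
  simp [goodClass, codegClass, biClass, and_assoc]

lemma card_switch_le (E : V → W → Bool) (a b : W) :
    (upSwitch E a b).card ≤ Fintype.card V * (Fintype.card V * Fintype.card W) ∧
    (downSwitch E a b).card ≤ Fintype.card V * (Fintype.card V * Fintype.card W) := by
  have := card_le_univ (upSwitch E a b)
  have := card_le_univ (downSwitch E a b)
  simp only [Fintype.card_prod] at *
  omega

/-- A sum over a codegree class, bounded on the graphs of small discrepancy. -/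
lemma sum_codegClass_le {ν F M : ℝ} (hM : 0 ≤ M) (r : V → ℕ) (c : W → ℕ) (a b : W) (k : ℕ)
    (f : (V → W → Bool) → ℕ) (hf : ∀ E ∈ goodClass ν r c a b k, (f E : ℝ) ≤ F)
    (hf' : ∀ E, (f E : ℝ) ≤ M) :
    ∑ E ∈ codegClass r c a b k, (f E : ℝ) ≤ (goodClass ν r c a b k).card * F +
      (univ.filter fun E : V → W → Bool => ¬ CutGood (ν ^ 32) E).card * M := by
  rw [← sum_filter_add_sum_filter_not _ (fun E => CutGood (ν ^ 32) E)]
  refine add_le_add ?_ ?_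
  · rw [← nsmul_eq_mul]
    exact sum_le_card_nsmul _ _ _ hf
  · calc _ ≤ ((codegClass r c a b k).filter fun E => ¬ CutGood (ν ^ 32) E).card • M :=
          sum_le_card_nsmul _ _ _ fun E _ => hf' E
      _ ≤ _ := by
          rw [nsmul_eq_mul]
          gcongr
          exact subset_univ _

lemma le_sum_codegClass {ν B : ℝ} (r : V → ℕ) (c : W → ℕ) (a b : W) (k : ℕ)
    (f : (V → W → Bool) → ℕ) (hf : ∀ E ∈ goodClass ν r c a b k, B ≤ (f E : ℝ)) :
    (goodClass ν r c a b k).card * B ≤ ∑ E ∈ codegClass r c a b k, (f E : ℝ) := by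
  rw [← nsmul_eq_mul]
  exact (card_nsmul_le_sum _ _ _ hf).trans
    (sum_le_sum_of_subset_of_nonneg (filter_subset _ _) fun _ _ _ => Nat.cast_nonneg _)

lemma goodClass_rec {ν : ℝ} {r : V → ℕ} {c : W → ℕ} (h : Near ν r c) {a b : W} (hab : a ≠ b)
    (k : ℕ) :
    (ν ^ 20 / 4 + ν ^ 13 / 2 ≤ k → ((goodClass ν r c a b (k + 1)).card : ℝ) ≤
      (1 - (ν ^ 8)⁻¹) * (goodClass ν r c a b k).card +
      (univ.filter fun E : V → W → Bool => ¬ CutGood (ν ^ 32) E).card * (2 * ν ^ 60)) ∧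
    ((k : ℝ) ≤ ν ^ 20 / 4 - ν ^ 13 / 2 → ((goodClass ν r c a b k).card : ℝ) ≤
      (1 - (ν ^ 8)⁻¹) * (goodClass ν r c a b (k + 1)).card +
      (univ.filter fun E : V → W → Bool => ¬ CutGood (ν ^ 32) E).card * (2 * ν ^ 60)) := by
  have hν := h.large
  have hpos : 0 < ν := by linarith
  have hm := h.card_le
  have hm1 := abs_le.1 h.cardV
  have hn := h.cardW
  have hca := abs_le.1 (h.col a)
  have hcb := abs_le.1 (h.col b)
  have e13 := mul_pow_le_pow_of_lt hν (show 11 < 13 by norm_num)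
  have e13' := mul_pow_le_pow_of_lt hν (show 0 < 13 by norm_num)
  rw [pow_zero] at e13'
  have e20 := mul_pow_le_pow_of_lt hν (show 13 < 20 by norm_num)
  have p11 : 0 < ν ^ 11 := by positivity
  have p20 : 0 < ν ^ 20 := by positivity
  set m : ℝ := (Fintype.card V : ℝ) with hmdef
  obtain ⟨hFB, hB1⟩ := switch_ratio_numeric hν hm (Nat.cast_nonneg _)
  set F := ν ^ 20 * ((ν ^ 20 / 4 - ν ^ 13 / 3) * (ν ^ 20 / 4 - ν ^ 13 / 3)) / 4
    + 3 / 2 * m * ν ^ 32 with hF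
  set B := ν ^ 20 * ((ν ^ 20 / 4 + ν ^ 13 / 3) * (ν ^ 20 / 4 + ν ^ 13 / 3)) / 4
        - 3 / 2 * m * ν ^ 32 - m ^ 2 with hB
  set bad : ℝ := ((univ.filter fun E : V → W → Bool => ¬ CutGood (ν ^ 32) E).card : ℝ) with hbad
  have hbad0 : 0 ≤ bad := Nat.cast_nonneg _
  have hM : m * (m * ν ^ 20) ≤ 2 * ν ^ 60 := by
    calc m * (m * ν ^ 20) ≤ (1.01 * ν ^ 20) * ((1.01 * ν ^ 20) * ν ^ 20) := by gcongr
      _ ≤ _ := by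
        have : 0 ≤ ν ^ 60 := by positivity
        nlinarith
  have hsw : ∀ E : V → W → Bool, ((upSwitch E a b).card : ℝ) ≤ 2 * ν ^ 60 ∧
      ((downSwitch E a b).card : ℝ) ≤ 2 * ν ^ 60 := by
    intro E
    obtain ⟨h1, h2⟩ := card_switch_le E a b
    have h1 := (Nat.cast_le (α := ℝ)).2 h1
    have h2 := (Nat.cast_le (α := ℝ)).2 h2
    push_cast at h1 h2
    rw [hn] at h1 h2
    exact ⟨h1.trans hM, h2.trans hM⟩
  have hconcl : ∀ x y : ℝ, 0 ≤ y → x * B ≤ y * F + bad * (2 * ν ^ 60) →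
      x ≤ (1 - (ν ^ 8)⁻¹) * y + bad * (2 * ν ^ 60) := by
    intro x y hy hxy
    have h1 : y * F ≤ y * ((1 - (ν ^ 8)⁻¹) * B) := by gcongr
    have h2 : bad * (2 * ν ^ 60) * 1 ≤ bad * (2 * ν ^ 60) * B := by gcongr
    refine le_of_mul_le_mul_right ?_ (by linarith : 0 < B)
    linarith
  have hsum : ∑ E ∈ codegClass r c a b k, ((upSwitch E a b).card : ℝ)
      = ∑ E ∈ codegClass r c a b (k + 1), ((downSwitch E a b).card : ℝ) := by
    exact_mod_cast sum_upSwitch_eq r c hab k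
  constructor
  · intro hk
    refine hconcl _ _ (Nat.cast_nonneg _) ?_
    have h1 := sum_codegClass_le (ν := ν) (F := F) (M := 2 * ν ^ 60) (by positivity) r c a b k
      (fun E => (upSwitch E a b).card) ?_ fun E => (hsw E).1
    have h2 := le_sum_codegClass (ν := ν) (B := B) r c a b (k + 1)
      (fun E => (downSwitch E a b).card) ?_
    · rw [hsum] at h1
      exact h2.trans h1
    · intro E hE
      rw [mem_goodClass] at hE
      obtain ⟨⟨-, hcol⟩, hcod, hcut⟩ := hE
      have h3 := (abs_le.1 (card_downSwitch_bounds hcut a b)).1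
      rw [hcol, hcol, hcod, hn, ← hmdef] at h3
      push_cast at h3
      have h4 : (ν ^ 20 / 4 + ν ^ 13 / 3) * (ν ^ 20 / 4 + ν ^ 13 / 3) ≤
          (m - c a - c b + (k + 1)) * (k + 1) := by
        apply mul_le_mul <;> linarith
      have h5 : ν ^ 20 * ((ν ^ 20 / 4 + ν ^ 13 / 3) * (ν ^ 20 / 4 + ν ^ 13 / 3)) ≤
          ν ^ 20 * ((m - c a - c b + (k + 1)) * (k + 1)) := by gcongr
      rw [hB]
      have := sq_nonneg m
      linarith
    · intro E hE
      rw [mem_goodClass] at hE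
      obtain ⟨⟨-, hcol⟩, hcod, hcut⟩ := hE
      have h3 := (card_upSwitch_le hcut a b).1
      have h6 := codeg_le_colDeg E a b
      rw [hcol, hcol, hcod, hn, ← hmdef] at h3
      rw [hcol, hcol, hcod] at h6
      have h6a : (k : ℝ) ≤ c a := by exact_mod_cast h6.1
      have h6b : (k : ℝ) ≤ c b := by exact_mod_cast h6.2
      have h4 : ((c a : ℝ) - k) * (c b - k) ≤
          (ν ^ 20 / 4 - ν ^ 13 / 3) * (ν ^ 20 / 4 - ν ^ 13 / 3) := by
        apply mul_le_mul <;> linarith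
      have h5 : ν ^ 20 * (((c a : ℝ) - k) * (c b - k)) ≤
          ν ^ 20 * ((ν ^ 20 / 4 - ν ^ 13 / 3) * (ν ^ 20 / 4 - ν ^ 13 / 3)) := by gcongr
      rw [hF]
      linarith
  · intro hk
    refine hconcl _ _ (Nat.cast_nonneg _) ?_
    have h1 := sum_codegClass_le (ν := ν) (F := F) (M := 2 * ν ^ 60) (by positivity) r c a b (k + 1)
      (fun E => (downSwitch E a b).card) ?_ fun E => (hsw E).2
    have h2 := le_sum_codegClass (ν := ν) (B := B) r c a b k
      (fun E => (upSwitch E a b).card) ?_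
    · rw [hsum] at h2
      exact h2.trans h1
    · intro E hE
      rw [mem_goodClass] at hE
      obtain ⟨⟨-, hcol⟩, hcod, hcut⟩ := hE
      have h3 := (card_upSwitch_le hcut a b).2
      rw [hcol, hcol, hcod, hn, ← hmdef] at h3
      have h4 : (ν ^ 20 / 4 + ν ^ 13 / 3) * (ν ^ 20 / 4 + ν ^ 13 / 3) ≤
          ((c a : ℝ) - k) * (c b - k) := by
        apply mul_le_mul <;> linarith
      have h5 : ν ^ 20 * ((ν ^ 20 / 4 + ν ^ 13 / 3) * (ν ^ 20 / 4 + ν ^ 13 / 3)) ≤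
          ν ^ 20 * (((c a : ℝ) - k) * (c b - k)) := by gcongr
      rw [hB]
      linarith
    · intro E hE
      rw [mem_goodClass] at hE
      obtain ⟨⟨-, hcol⟩, hcod, hcut⟩ := hE
      have h3 := (abs_le.1 (card_downSwitch_bounds hcut a b)).2
      rw [hcol, hcol, hcod, hn, ← hmdef] at h3
      push_cast at h3
      have h4 : (m - c a - c b + (k + 1)) * (k + 1) ≤
          (ν ^ 20 / 4 - ν ^ 13 / 3) * (ν ^ 20 / 4 - ν ^ 13 / 3) := by
        apply mul_le_mul <;> linarith
      have h5 : ν ^ 20 * ((m - c a - c b + (k + 1)) * (k + 1)) ≤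
          ν ^ 20 * ((ν ^ 20 / 4 - ν ^ 13 / 3) * (ν ^ 20 / 4 - ν ^ 13 / 3)) := by gcongr
      rw [hF]
      linarith

lemma goodClass_card_le {ν : ℝ} {r : V → ℕ} {c : W → ℕ} (h : Near ν r c)
    (hN : 2 ^ (Fintype.card V * Fintype.card W) * Real.exp (-ν ^ 23) ≤ (biClass r c).card)
    {a b : W} (hab : a ≠ b) (k : ℕ) (hk : ν ^ 13 < |(k : ℝ) - ν ^ 20 / 4|) :
    ((goodClass ν r c a b k).card : ℝ) ≤ (ν ^ 100)⁻¹ * (biClass r c).card := by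
  have hν := h.large
  have hpos : 0 < ν := by linarith
  have hm := h.card_le
  set N : ℝ := ((biClass r c).card : ℝ) with hNdef
  have hN0 : 0 ≤ N := Nat.cast_nonneg _
  set bad : ℝ := ((univ.filter fun E : V → W → Bool => ¬ CutGood (ν ^ 32) E).card : ℝ) with hbad
  have hbadle : bad ≤ Real.exp (-ν ^ 23) * N := h.card_not_cutGood_le hN
  have hbad' : bad ≤ (ν ^ 200)⁻¹ * N :=
    hbadle.trans (by gcongr; exact exp_neg_pow_le hν (by norm_num))
  have hbad0 : 0 ≤ bad := Nat.cast_nonneg _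
  have hgN : ∀ k, ((goodClass ν r c a b k).card : ℝ) ≤ N := fun k => by
    exact Nat.cast_le.2 (card_le_card ((filter_subset _ _).trans (filter_subset _ _)))
  have h8 : (ν ^ 8)⁻¹ ≤ 1 := inv_le_one_of_one_le₀ (one_le_pow₀ (by linarith))
  have h80 : 0 ≤ (ν ^ 8)⁻¹ := by positivity
  have e13' := mul_pow_le_pow_of_lt hν (show 0 < 13 by norm_num)
  rw [pow_zero] at e13'
  have e20 := mul_pow_le_pow_of_lt hν (show 13 < 20 by norm_num)
  have p20 : 0 < ν ^ 20 := by positivity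
  have fin : ∀ (x : ℝ) (j : ℕ), ν ^ 13 / 3 ≤ j → (j : ℝ) ≤ 2 * ν ^ 20 →
      x ≤ (1 - (ν ^ 8)⁻¹) ^ j * N + j * (bad * (2 * ν ^ 60)) → x ≤ (ν ^ 100)⁻¹ * N := by
    intro x j hj hj' hx
    have h1 : (1 - (ν ^ 8)⁻¹) ^ j ≤ (ν ^ 200)⁻¹ := by
      calc (1 - (ν ^ 8)⁻¹) ^ j ≤ (Real.exp (-(ν ^ 8)⁻¹)) ^ j := by
            gcongr
            linarith [Real.add_one_le_exp (-(ν ^ 8)⁻¹)]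
        _ = Real.exp (-(j * (ν ^ 8)⁻¹)) := by rw [← Real.exp_nat_mul]; ring_nf
        _ ≤ Real.exp (-(ν ^ 5 / 3)) := by
            apply Real.exp_le_exp.2
            apply neg_le_neg
            calc ν ^ 5 / 3 = ν ^ 13 / 3 * (ν ^ 8)⁻¹ := by field_simp
              _ ≤ _ := by gcongr
        _ ≤ _ := exp_neg_pow_five_le hν
    have h2 : j * (bad * (2 * ν ^ 60)) ≤ (2 * ν ^ 20) * (((ν ^ 200)⁻¹ * N) * (2 * ν ^ 60)) := by
      gcongr
    have h3 : (1 - (ν ^ 8)⁻¹) ^ j * N ≤ (ν ^ 200)⁻¹ * N := by gcongr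
    have h4 : (ν ^ 200)⁻¹ + (2 * ν ^ 20) * ((ν ^ 200)⁻¹ * (2 * ν ^ 60)) ≤ (ν ^ 100)⁻¹ := by
      have : (ν ^ 200)⁻¹ + (2 * ν ^ 20) * ((ν ^ 200)⁻¹ * (2 * ν ^ 60))
          = (1 + 4 * ν ^ 80) / ν ^ 200 := by field_simp; ring
      rw [this, div_le_iff₀ (by positivity)]
      have h5 : (ν ^ 100)⁻¹ * ν ^ 200 = ν ^ 100 := by field_simp
      rw [h5]
      have := mul_pow_le_pow_of_lt hν (show 0 < 100 by norm_num)
      have := mul_pow_le_pow_of_lt hν (show 80 < 100 by norm_num)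
      linarith [pow_pos hpos 80]
    calc x ≤ _ := hx
      _ ≤ ((ν ^ 200)⁻¹ + (2 * ν ^ 20) * ((ν ^ 200)⁻¹ * (2 * ν ^ 60))) * N := by linarith
      _ ≤ _ := by gcongr
  rcases lt_abs.1 hk with hk | hk
  · rcases Nat.lt_or_ge (Fintype.card V) k with hkV | hkV
    · have : goodClass ν r c a b k = ∅ := by
        refine eq_empty_of_forall_notMem fun E hE => ?_
        have h1 := (mem_goodClass.1 hE).2.1
        have h2 : codeg E a b ≤ Fintype.card V := card_le_univ _
        omega
      rw [this]
      simp only [card_empty, Nat.cast_zero]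
      exact mul_nonneg (inv_nonneg.2 (pow_nonneg hpos.le _)) hN0
    have hkV' : (k : ℝ) ≤ Fintype.card V := by exact_mod_cast hkV
    set k0 := ⌈ν ^ 20 / 4 + ν ^ 13 / 2⌉₊ with hk0
    have h1 : ν ^ 20 / 4 + ν ^ 13 / 2 ≤ k0 := Nat.le_ceil _
    have h2 : (k0 : ℝ) < ν ^ 20 / 4 + ν ^ 13 / 2 + 1 := Nat.ceil_lt_add_one (by positivity)
    have h3 : k0 ≤ k := by
      have : (k0 : ℝ) ≤ k := by linarith
      exact_mod_cast this
    have h4 := le_geom_of_rec (h := fun j => ((goodClass ν r c a b (k0 + j)).card : ℝ))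
      (q := 1 - (ν ^ 8)⁻¹) (ε := bad * (2 * ν ^ 60)) (by linarith) (by linarith) (by positivity)
      (J := k - k0) (fun j _ => (goodClass_rec h hab (k0 + j)).1 (by push_cast; linarith [Nat.cast_nonneg (α := ℝ) j]))
      (k - k0) le_rfl
    simp only [add_zero] at h4
    rw [Nat.add_sub_cancel' h3] at h4
    refine fin _ (k - k0) ?_ ?_ (h4.trans ?_)
    · rw [Nat.cast_sub h3]; linarith
    · rw [Nat.cast_sub h3]; linarith [Nat.cast_nonneg (α := ℝ) k0]
    · gcongr
      exact hgN _
  · set k0 := ⌊ν ^ 20 / 4 - ν ^ 13 / 2⌋₊ with hk0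
    have h1 : (k0 : ℝ) ≤ ν ^ 20 / 4 - ν ^ 13 / 2 := Nat.floor_le (by linarith)
    have h2 : ν ^ 20 / 4 - ν ^ 13 / 2 < k0 + 1 := Nat.lt_floor_add_one _
    have h3 : k ≤ k0 := by
      have : (k : ℝ) ≤ k0 := by linarith
      exact_mod_cast this
    have h4 := le_geom_of_rec (h := fun j => ((goodClass ν r c a b (k0 - j)).card : ℝ))
      (q := 1 - (ν ^ 8)⁻¹) (ε := bad * (2 * ν ^ 60)) (by linarith) (by linarith) (by positivity)
      (J := k0 - k) (fun j hj => by
        have h5 := (goodClass_rec h hab (k0 - (j + 1))).2 (by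
          have : ((k0 - (j + 1) : ℕ) : ℝ) ≤ k0 := by exact_mod_cast Nat.sub_le _ _
          linarith)
        rwa [show k0 - (j + 1) + 1 = k0 - j by omega] at h5)
      (k0 - k) le_rfl
    simp only [Nat.sub_zero] at h4
    rw [Nat.sub_sub_self h3] at h4
    refine fin _ (k0 - k) ?_ ?_ (h4.trans ?_)
    · rw [Nat.cast_sub h3]; linarith
    · rw [Nat.cast_sub h3]; linarith [Nat.cast_nonneg (α := ℝ) k]
    · gcongr
      exact hgN _

/-- Codegrees concentrate around a quarter of the number of vertices. -/
lemma card_codeg_far_le {ν : ℝ} {r : V → ℕ} {c : W → ℕ} (h : Near ν r c)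
    (hN : 2 ^ (Fintype.card V * Fintype.card W) * Real.exp (-ν ^ 23) ≤ (biClass r c).card)
    {a b : W} (hab : a ≠ b) :
    (((biClass r c).filter fun E => ν ^ 13 < |(codeg E a b : ℝ) - ν ^ 20 / 4|).card : ℝ)
      ≤ (ν ^ 60)⁻¹ * (biClass r c).card := by
  have hν := h.large
  have hpos : 0 < ν := by linarith
  have hm := h.card_le
  set N : ℝ := ((biClass r c).card : ℝ) with hNdef
  have hN0 : 0 ≤ N := Nat.cast_nonneg _
  have hbadle := h.card_not_cutGood_le hN
  set badS := (univ.filter fun E : V → W → Bool => ¬ CutGood (ν ^ 32) E) with hbad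
  have hbad' : (badS.card : ℝ) ≤ (ν ^ 200)⁻¹ * N :=
    hbadle.trans (by gcongr; exact exp_neg_pow_le hν (by norm_num))
  set K := (range (Fintype.card V + 1)).filter fun k : ℕ => ν ^ 13 < |(k : ℝ) - ν ^ 20 / 4| with hK
  have hsub : ((biClass r c).filter fun E => ν ^ 13 < |(codeg E a b : ℝ) - ν ^ 20 / 4|) ⊆
      badS ∪ K.biUnion fun k => goodClass ν r c a b k := by
    intro E hE
    obtain ⟨h1, h2⟩ := mem_filter.1 hE
    by_cases hc : CutGood (ν ^ 32) E
    · refine mem_union_right _ (mem_biUnion.2 ⟨codeg E a b, mem_filter.2 ⟨mem_range.2 ?_, h2⟩, ?_⟩)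
      · exact Nat.lt_succ_of_le (card_le_univ _)
      · exact mem_goodClass.2 ⟨(mem_filter.1 h1).2, rfl, hc⟩
    · exact mem_union_left _ (mem_filter.2 ⟨mem_univ _, hc⟩)
  calc (((biClass r c).filter fun E => ν ^ 13 < |(codeg E a b : ℝ) - ν ^ 20 / 4|).card : ℝ)
      ≤ badS.card + ∑ k ∈ K, ((goodClass ν r c a b k).card : ℝ) := by
        exact_mod_cast (card_le_card hsub).trans ((card_union_le _ _).trans
          (Nat.add_le_add_left card_biUnion_le _))
    _ ≤ (ν ^ 200)⁻¹ * N + ∑ _k ∈ K, (ν ^ 100)⁻¹ * N := by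
        gcongr with k hk
        exact goodClass_card_le h hN hab k (mem_filter.1 hk).2
    _ ≤ (ν ^ 200)⁻¹ * N + 2 * ν ^ 20 * ((ν ^ 100)⁻¹ * N) := by
        rw [sum_const, nsmul_eq_mul]
        refine add_le_add le_rfl (mul_le_mul_of_nonneg_right ?_
          (mul_nonneg (inv_nonneg.2 (pow_nonneg hpos.le _)) hN0))
        have h1 : (K.card : ℝ) ≤ Fintype.card V + 1 := by
          exact_mod_cast (card_filter_le _ _).trans (card_range _).le
        have : (1 : ℝ) ≤ ν ^ 20 / 10 := by
          have := mul_pow_le_pow_of_lt hν (show 0 < 20 by norm_num)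
          rw [pow_zero] at this
          linarith
        linarith
    _ = ((ν ^ 200)⁻¹ + 2 * ν ^ 20 * (ν ^ 100)⁻¹) * N := by ring
    _ ≤ _ := by
        gcongr
        have : (ν ^ 200)⁻¹ + 2 * ν ^ 20 * (ν ^ 100)⁻¹ = (1 + 2 * ν ^ 120) / ν ^ 200 := by
          field_simp
        rw [this, div_le_iff₀ (by positivity)]
        have h5 : (ν ^ 60)⁻¹ * ν ^ 200 = ν ^ 140 := by field_simp
        rw [h5]
        have := mul_pow_le_pow_of_lt hν (show 0 < 140 by norm_num)
        have := mul_pow_le_pow_of_lt hν (show 120 < 140 by norm_num)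
        linarith [pow_pos hpos 120]

end Concentration

lemma exp_neg_two_mul_le {q : ℝ} (hq0 : 0 ≤ q) (hq : q ≤ 1 / 2) :
    Real.exp (-(2 * q)) ≤ 1 - q := by
  have h1 : (1 + 2 * q) ≤ Real.exp (2 * q) := by linarith [Real.add_one_le_exp (2 * q)]
  rw [Real.exp_neg]
  refine inv_le_of_inv_le₀ (by linarith) ((inv_le_of_inv_le₀ (by linarith) ?_).trans h1)
  rw [inv_le_iff_one_le_mul₀ (by linarith)]
  nlinarith

lemma two_pow_le_choose_middle (n : ℕ) : 2 ^ n ≤ (n + 1) * n.choose (n / 2) := by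
  rw [← Nat.sum_range_choose]
  calc ∑ i ∈ range (n + 1), n.choose i ≤ ∑ _i ∈ range (n + 1), n.choose (n / 2) :=
        sum_le_sum fun i _ => Nat.choose_le_middle i n
    _ = _ := by simp

lemma choose_lower_of_ge {n r : ℕ} {D : ℝ} (hD : 1 ≤ D) (hDn : 8 * D ≤ n) (hr : n / 2 ≤ r)
    (h : (r : ℝ) - n / 2 ≤ D) :
    2 ^ n * Real.exp (-(16 * D ^ 2 / n)) / (n + 1) ≤ n.choose r := by
  have hn : (0 : ℝ) < n := by linarith
  have hmid : ((n / 2 : ℕ) : ℝ) ≤ n / 2 := Nat.cast_div_le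
  have hmid' : (n : ℝ) / 2 - 1 / 2 ≤ ((n / 2 : ℕ) : ℝ) := by
    have : n ≤ 2 * (n / 2) + 1 := by omega
    have : (n : ℝ) ≤ 2 * ((n / 2 : ℕ) : ℝ) + 1 := by exact_mod_cast this
    linarith
  set q := 4 * D / n with hq
  have hq0 : 0 ≤ q := by positivity
  have hq2 : q ≤ 1 / 2 := by
    rw [hq, div_le_iff₀ hn]
    linarith
  have key : ∀ j : ℕ, ((n / 2 + j : ℕ) : ℝ) - n / 2 ≤ D →
      (n.choose (n / 2) : ℝ) * (1 - q) ^ j ≤ n.choose (n / 2 + j) := by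
    intro j
    induction j with
    | zero => simp
    | succ j ih =>
      intro hj
      push_cast at hj ih
      have h1 := ih (by linarith)
      have h2 := Nat.choose_succ_right_eq n (n / 2 + j)
      have hle : n / 2 + j ≤ n := by
        have : ((n / 2 + j : ℕ) : ℝ) ≤ n := by push_cast; linarith
        exact_mod_cast this
      have h3 : (n.choose (n / 2 + (j + 1)) : ℝ) * (((n / 2 : ℕ) : ℝ) + j + 1)
          = n.choose (n / 2 + j) * (n - (((n / 2 : ℕ) : ℝ) + j)) := by
        have := congrArg (Nat.cast (R := ℝ)) h2
        push_cast [Nat.cast_sub hle] at this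
        rw [add_assoc] at this
        rw [← this]
      have hp : 0 < ((n / 2 : ℕ) : ℝ) + j + 1 := by positivity
      refine le_of_mul_le_mul_right ?_ hp
      rw [h3, pow_succ, ← mul_assoc]
      have h4 : (1 - q) * (((n / 2 : ℕ) : ℝ) + j + 1) ≤ n - (((n / 2 : ℕ) : ℝ) + j) := by
        have : 2 * D ≤ q * (((n / 2 : ℕ) : ℝ) + j + 1) := by
          calc 2 * D = q * (n / 2) := by rw [hq]; field_simp; ring
            _ ≤ _ := by gcongr; linarith [Nat.cast_nonneg (α := ℝ) j]
        linarith
      calc (n.choose (n / 2) : ℝ) * (1 - q) ^ j * (1 - q) * (((n / 2 : ℕ) : ℝ) + j + 1)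
          = (n.choose (n / 2) : ℝ) * (1 - q) ^ j * ((1 - q) * (((n / 2 : ℕ) : ℝ) + j + 1)) := by
            ring
        _ ≤ n.choose (n / 2 + j) * ((1 - q) * (((n / 2 : ℕ) : ℝ) + j + 1)) := by
            refine mul_le_mul_of_nonneg_right h1 (mul_nonneg (by linarith) hp.le)
        _ ≤ _ := by gcongr
  obtain ⟨j, rfl⟩ := Nat.exists_eq_add_of_le hr
  have h1 := key j h
  push_cast at h
  have hj : (j : ℝ) ≤ 2 * D := by linarith
  have h2 : Real.exp (-(16 * D ^ 2 / n)) ≤ (1 - q) ^ j := by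
    calc Real.exp (-(16 * D ^ 2 / n)) ≤ Real.exp (j * (-(2 * q))) := by
          apply Real.exp_le_exp.2
          have : (j : ℝ) * (2 * q) ≤ 2 * D * (2 * q) := by gcongr
          have h3 : 2 * D * (2 * q) = 16 * D ^ 2 / n := by rw [hq]; ring
          linarith
      _ = (Real.exp (-(2 * q))) ^ j := by rw [← Real.exp_nat_mul]
      _ ≤ _ := by gcongr; exact exp_neg_two_mul_le hq0 hq2
  have h3 : (2 : ℝ) ^ n / (n + 1) ≤ n.choose (n / 2) := by
    rw [div_le_iff₀ (by positivity), mul_comm]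
    exact_mod_cast two_pow_le_choose_middle n
  calc 2 ^ n * Real.exp (-(16 * D ^ 2 / n)) / (n + 1)
      = 2 ^ n / (n + 1) * Real.exp (-(16 * D ^ 2 / n)) := by ring
    _ ≤ n.choose (n / 2) * (1 - q) ^ j := by gcongr
    _ ≤ _ := h1

/-- Binomial coefficients near the middle. -/
lemma choose_lower {n r : ℕ} {D : ℝ} (hD : 1 ≤ D) (hDn : 8 * D ≤ n)
    (h : |(r : ℝ) - n / 2| ≤ D) :
    2 ^ n * Real.exp (-(16 * D ^ 2 / n)) / (n + 1) ≤ n.choose r := by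
  obtain ⟨h1, h2⟩ := abs_le.1 h
  have hrn : r ≤ n := by
    have : (r : ℝ) ≤ n := by linarith
    exact_mod_cast this
  rcases Nat.le_total (n / 2) r with hr | hr
  · exact choose_lower_of_ge hD hDn hr h2
  · rw [← Nat.choose_symm hrn]
    refine choose_lower_of_ge hD hDn (by omega) ?_
    rw [Nat.cast_sub hrn]
    linarith

section Count

variable {V W : Type*} [Fintype V] [Fintype W] [DecidableEq V] [DecidableEq W]

lemma card_filter_bool (k : ℕ) :
    (univ.filter fun f : W → Bool => (univ.filter fun w => f w = true).card = k).card
      = (Fintype.card W).choose k := by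
  rw [← card_univ, ← card_powersetCard]
  refine card_bij' (fun f _ => univ.filter fun w => f w = true) (fun s _ w => decide (w ∈ s))
    ?_ ?_ ?_ ?_
  · intro f hf
    simpa [mem_powersetCard] using hf
  · intro s hs
    simpa [mem_powersetCard] using hs
  · intro f _
    funext w
    simp
  · intro s _
    ext w
    simp

lemma card_rowDeg_eq (r : V → ℕ) :
    (univ.filter fun E : V → W → Bool => ∀ v, rowDeg E v = r v).card
      = ∏ v, (Fintype.card W).choose (r v) := by
  have : (univ.filter fun E : V → W → Bool => ∀ v, rowDeg E v = r v)
      = Fintype.piFinset fun v => univ.filter fun f : W → Bool =>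
        (univ.filter fun w => f w = true).card = r v := by
    ext E
    rw [mem_filter, Fintype.mem_piFinset]
    simp [rowDeg]
  rw [this, Fintype.card_piFinset]
  simp only [card_filter_bool]

lemma sum_rowDeg_eq_sum_colDeg (E : V → W → Bool) : ∑ v, rowDeg E v = ∑ w, colDeg E w := by
  simp only [rowDeg, colDeg, card_filter]
  exact sum_comm

lemma sum_eq_of_mem_biClass {r : V → ℕ} {c : W → ℕ} {E : V → W → Bool} (hE : E ∈ biClass r c) :
    ∑ v, r v = ∑ w, c w := by
  obtain ⟨h1, h2⟩ := (mem_filter.1 hE).2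
  rw [← sum_congr rfl fun v _ => h1 v, ← sum_congr rfl fun w _ => h2 w]
  exact sum_rowDeg_eq_sum_colDeg E

lemma sum_card_codegClass (r : V → ℕ) (c : W → ℕ) (a b : W) :
    ∑ k ∈ range (Fintype.card V + 1), (codegClass r c a b k).card = (biClass r c).card := by
  unfold codegClass
  exact (card_eq_sum_card_fiberwise fun E _ => by
    exact mem_coe.2 (mem_range.2 (Nat.lt_succ_of_le (card_le_univ _)))).symm

lemma card_biClass_move_ge (r : V → ℕ) (c c' : W → ℕ) {a b : W} (hab : a ≠ b)
    (ha : c' a + 1 = c a) (hb : c' b = c b + 1) (hc : ∀ w, w ≠ a → w ≠ b → c' w = c w)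
    (h2 : c b + 2 ≤ c a) : (biClass r c).card ≤ (biClass r c').card := by
  rw [← sum_card_codegClass r c a b, ← sum_card_codegClass r c' a b]
  refine sum_le_sum fun k _ => ?_
  rcases Nat.lt_or_ge (c b) k with hk | hk
  · have : codegClass r c a b k = ∅ := by
      refine eq_empty_of_forall_notMem fun E hE => ?_
      simp only [codegClass, biClass, mem_filter, mem_univ, true_and] at hE
      have := (codeg_le_colDeg E a b).2
      rw [hE.1.2] at this
      omega
    simp [this]
  · have h := card_codegClass_move r c c' hab ha hb hc k
    refine le_of_mul_le_mul_right ?_ (show 0 < c b + 1 - k by omega)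
    rw [← h]
    gcongr
    omega

/-- Some balanced column degree sequence has at least the average number of graphs. -/
lemma exists_balanced (r : V → ℕ) :
    ∃ c : W → ℕ, (∀ a b, c a ≤ c b + 1) ∧
      ∏ v, (Fintype.card W).choose (r v) ≤
        (Fintype.card V + 1) ^ Fintype.card W * (biClass r c).card := by
  set P : Finset (W → ℕ) := Fintype.piFinset fun _ => range (Fintype.card V + 1) with hP
  have hPne : P.Nonempty := ⟨fun _ => 0, by simp [hP]⟩
  set M : (W → ℕ) → ℕ := fun c => (biClass r c).card with hM
  obtain ⟨c0, hc0, hmax⟩ := exists_max_image P M hPne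
  have hcolP : ∀ E : V → W → Bool, (fun w => colDeg E w) ∈ P := by
    intro E
    simp only [hP, Fintype.mem_piFinset, mem_range, Nat.lt_succ_iff]
    exact fun w => card_le_univ _
  have havg : ∏ v, (Fintype.card W).choose (r v) ≤
        (Fintype.card V + 1) ^ Fintype.card W * M c0 := by
    rw [← card_rowDeg_eq, card_eq_sum_card_fiberwise (f := fun E w => colDeg E w) (t := P)
      fun E _ => hcolP E]
    calc _ ≤ ∑ _c ∈ P, M c0 := by
          refine sum_le_sum fun c hc => le_trans (le_of_eq ?_) (hmax c hc)
          simp only [hM, biClass, filter_filter]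
          congr 1
          ext E
          simp [funext_iff]
      _ = _ := by simp [hP, Fintype.card_piFinset]
  set Q := P.filter fun c => M c = M c0 with hQ
  obtain ⟨c, hc, hmin⟩ := exists_min_image Q (fun c => ∑ w, c w ^ 2) ⟨c0, by simp [hQ, hc0]⟩
  obtain ⟨hcP, hcM⟩ := mem_filter.1 hc
  refine ⟨c, fun a b => ?_, ?_⟩
  · by_contra! hlt
    have hab : a ≠ b := by rintro rfl; omega
    set c' : W → ℕ := Function.update (Function.update c a (c a - 1)) b (c b + 1) with hc'
    have ha : c' a + 1 = c a := by simp [hc', hab]; omega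
    have hb : c' b = c b + 1 := by simp [hc']
    have hw : ∀ w, w ≠ a → w ≠ b → c' w = c w := fun w h1 h2 => by simp [hc', h1, h2]
    have hc'P : c' ∈ P := by
      simp only [hP, Fintype.mem_piFinset, mem_range] at hcP ⊢
      intro w
      by_cases h1 : w = a
      · subst h1; have := hcP w; omega
      by_cases h2 : w = b
      · subst h2; have := hcP a; omega
      · rw [hw w h1 h2]; exact hcP w
    have hge : M c ≤ M c' := card_biClass_move_ge r c c' hab ha hb hw (by omega)
    have hc'Q : c' ∈ Q := mem_filter.2 ⟨hc'P, le_antisymm (hmax c' hc'P) (hcM ▸ hge)⟩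
    have h1 := hmin c' hc'Q
    have key : ∀ g : W → ℕ, ∑ w, g w ^ 2 = g a ^ 2 + (g b ^ 2 + ∑ w ∈ (univ.erase a).erase b, g w ^ 2) := by
      intro g
      rw [add_sum_erase _ (fun w => g w ^ 2) (mem_erase.2 ⟨hab.symm, mem_univ b⟩),
        add_sum_erase _ (fun w => g w ^ 2) (mem_univ a)]
    have hrest : ∑ w ∈ (univ.erase a).erase b, c' w ^ 2 = ∑ w ∈ (univ.erase a).erase b, c w ^ 2 :=
      sum_congr rfl fun w hw' => by
        rw [hw w (ne_of_mem_erase (mem_of_mem_erase hw')) (ne_of_mem_erase hw')]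
    rw [key c, key c', hb, hrest, ← ha] at h1
    nlinarith
  · rw [← hcM] at havg
    exact havg

lemma card_biClass_move_lower {ν : ℝ} {r : V → ℕ} {c c' : W → ℕ} (h : Near ν r c)
    (hN : 2 ^ (Fintype.card V * Fintype.card W) * Real.exp (-ν ^ 23) ≤ (biClass r c).card)
    {a b : W} (hab : a ≠ b)
    (ha : c' a + 1 = c a) (hb : c' b = c b + 1) (hc : ∀ w, w ≠ a → w ≠ b → c' w = c w) :
    (1 - 20 / ν ^ 9) * (biClass r c).card ≤ (biClass r c').card := by
  have hν := h.large
  have hpos : 0 < ν := by linarith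
  have hca := abs_le.1 (h.col a)
  have hcb := abs_le.1 (h.col b)
  have e13 := mul_pow_le_pow_of_lt hν (show 11 < 13 by norm_num)
  have e11 := mul_pow_le_pow_of_lt hν (show 0 < 11 by norm_num)
  have e9 := mul_pow_le_pow_of_lt hν (show 0 < 9 by norm_num)
  rw [pow_zero] at e11 e9
  have e20 := mul_pow_le_pow_of_lt hν (show 13 < 20 by norm_num)
  have p20 : 0 < ν ^ 20 := by positivity
  set N : ℝ := ((biClass r c).card : ℝ) with hNd
  have hN0 : 0 ≤ N := Nat.cast_nonneg _
  set G := (range (Fintype.card V + 1)).filter fun k : ℕ => |(k : ℝ) - ν ^ 20 / 4| ≤ ν ^ 13 with hG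
  have hfar := card_codeg_far_le h hN hab
  have h1 : (1 - (ν ^ 60)⁻¹) * N ≤ ∑ k ∈ G, ((codegClass r c a b k).card : ℝ) := by
    have h2 : (biClass r c).filter (fun E => |(codeg E a b : ℝ) - ν ^ 20 / 4| ≤ ν ^ 13) ⊆
        G.biUnion fun k => codegClass r c a b k := by
      intro E hE
      obtain ⟨h3, h4⟩ := mem_filter.1 hE
      refine mem_biUnion.2 ⟨codeg E a b, mem_filter.2 ⟨mem_range.2 (Nat.lt_succ_of_le
        (card_le_univ _)), h4⟩, mem_filter.2 ⟨h3, rfl⟩⟩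
    have h3 : (((biClass r c).filter (fun E => |(codeg E a b : ℝ) - ν ^ 20 / 4| ≤ ν ^ 13)).card : ℝ)
        ≤ ∑ k ∈ G, ((codegClass r c a b k).card : ℝ) := by
      exact_mod_cast (card_le_card h2).trans card_biUnion_le
    have h4 := card_filter_add_card_filter_not (s := biClass r c)
      (fun E => |(codeg E a b : ℝ) - ν ^ 20 / 4| ≤ ν ^ 13)
    simp only [not_le] at h4
    have h5 := congrArg (Nat.cast (R := ℝ)) h4
    push_cast at h5
    linarith
  have h2 : ∑ k ∈ G, ((1 - 10 / ν ^ 9) * ((codegClass r c a b k).card : ℝ)) ≤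
      ((biClass r c').card : ℝ) := by
    rw [← sum_card_codegClass r c' a b, Nat.cast_sum]
    refine (sum_le_sum fun k hk => ?_).trans (sum_le_sum_of_subset_of_nonneg (filter_subset _ _)
      fun _ _ _ => Nat.cast_nonneg _)
    have hk' := abs_le.1 (mem_filter.1 hk).2
    have h3 := congrArg (Nat.cast (R := ℝ)) (card_codegClass_move r c c' hab ha hb hc k)
    have hka : k ≤ c a := by
      have : (k : ℝ) ≤ c a := by linarith
      exact_mod_cast this
    have hkb : k ≤ c b + 1 := by
      have : (k : ℝ) ≤ c b := by linarith
      have : k ≤ c b := by exact_mod_cast this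
      omega
    push_cast [Nat.cast_sub hka, Nat.cast_sub hkb] at h3
    have hy : 6 * ν ^ 20 / 25 ≤ (c b : ℝ) + 1 - k := by linarith
    refine le_of_mul_le_mul_right ?_ (show 0 < (c b : ℝ) + 1 - k by linarith)
    rw [← h3, mul_comm (1 - 10 / ν ^ 9), mul_assoc]
    gcongr
    have : 2.4 * ν ^ 11 ≤ 10 / ν ^ 9 * ((c b : ℝ) + 1 - k) := by
      calc 2.4 * ν ^ 11 = 10 / ν ^ 9 * (6 * ν ^ 20 / 25) := by field_simp; norm_num
        _ ≤ _ := by gcongr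
    linarith
  rw [← mul_sum] at h2
  have h10 : 0 ≤ 1 - 10 / ν ^ 9 := by
    rw [sub_nonneg, div_le_one (by positivity)]
    linarith
  have h60 : (ν ^ 60)⁻¹ ≤ 10 / ν ^ 9 := by
    rw [inv_eq_one_div]
    gcongr
    · norm_num
    · linarith
    · norm_num
  calc (1 - 20 / ν ^ 9) * N ≤ (1 - 10 / ν ^ 9) * ((1 - (ν ^ 60)⁻¹) * N) := by
        rw [← mul_assoc]
        gcongr
        have : 0 ≤ 10 / ν ^ 9 * (ν ^ 60)⁻¹ := by positivity
        have : 20 / ν ^ 9 = 10 / ν ^ 9 + 10 / ν ^ 9 := by ring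
        linarith
    _ ≤ (1 - 10 / ν ^ 9) * ∑ k ∈ G, ((codegClass r c a b k).card : ℝ) := by gcongr
    _ ≤ _ := h2

lemma Near.move {ν : ℝ} {r : V → ℕ} {c c₁ c' : W → ℕ} (h : Near ν r c) (h₁ : Near ν r c₁)
    {a b : W} (hab : a ≠ b) (ha : c' a = c a + 1) (hb : c' b + 1 = c b)
    (hc : ∀ w, w ≠ a → w ≠ b → c' w = c w) (ha₁ : c a < c₁ a) (hb₁ : c₁ b < c b) :
    Near ν r c' := by
  refine ⟨h.large, h.cardW, h.cardV, h.row, fun w => ?_, ?_⟩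
  · by_cases h1 : w = a
    · subst h1
      have h2 := abs_le.1 (h.col w)
      have h3 := abs_le.1 (h₁.col w)
      have h4 : (c w : ℝ) + 1 ≤ c₁ w := by exact_mod_cast ha₁
      rw [ha, abs_le]
      push_cast
      constructor <;> linarith
    by_cases h2 : w = b
    · subst h2
      have h2 := abs_le.1 (h.col w)
      have h3 := abs_le.1 (h₁.col w)
      have h4 : (c₁ w : ℝ) + 1 ≤ c w := by exact_mod_cast hb₁
      have h5 : (c' w : ℝ) + 1 = c w := by exact_mod_cast hb
      rw [abs_le]
      constructor <;> linarith
    · rw [hc w h1 h2]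
      exact h.col w
  · rw [h.sum]
    have key : ∀ g : W → ℕ, ∑ w, g w = g a + (g b + ∑ w ∈ (univ.erase a).erase b, g w) := by
      intro g
      rw [add_sum_erase _ _ (mem_erase.2 ⟨hab.symm, mem_univ b⟩), add_sum_erase _ _ (mem_univ a)]
    have hrest : ∑ w ∈ (univ.erase a).erase b, c' w = ∑ w ∈ (univ.erase a).erase b, c w :=
      sum_congr rfl fun w hw' => hc w (ne_of_mem_erase (mem_of_mem_erase hw')) (ne_of_mem_erase hw')
    rw [key c, key c', hrest, ha, ← hb]
    ring

lemma near_of_balanced {ν : ℝ} {r : V → ℕ} {c c₁ : W → ℕ} (h : Near ν r c)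
    (hbal : ∀ a b, c₁ a ≤ c₁ b + 1) (hsum : ∑ v, r v = ∑ w, c₁ w) : Near ν r c₁ := by
  have hs : ∑ w, c₁ w = ∑ w, c w := by rw [← hsum, h.sum]
  refine ⟨h.large, h.cardW, h.cardV, h.row, fun w => ?_, hsum⟩
  have h1 : ∃ x, c₁ w ≤ c x := by
    by_contra! hlt
    refine absurd hs (ne_of_gt (sum_lt_sum (fun x _ => ?_) ⟨w, mem_univ w, hlt w⟩))
    have := hlt x
    have := hbal w x
    omega
  have h2 : ∃ x, c x ≤ c₁ w := by
    by_contra! hlt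
    refine absurd hs (ne_of_lt (sum_lt_sum (fun x _ => ?_) ⟨w, mem_univ w, hlt w⟩))
    have := hlt x
    have := hbal x w
    omega
  obtain ⟨x, hx⟩ := h1
  obtain ⟨y, hy⟩ := h2
  have hx' : (c₁ w : ℝ) ≤ c x := by exact_mod_cast hx
  have hy' : (c y : ℝ) ≤ c₁ w := by exact_mod_cast hy
  have h3 := abs_le.1 (h.col x)
  have h4 := abs_le.1 (h.col y)
  rw [abs_le]
  constructor <;> linarith

lemma pow_le_exp_sq {ν : ℝ} (hν : 10 ^ 6 ≤ ν) {k : ℕ} (hk : k ≤ 10 ^ 6) :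
    ν ^ k ≤ Real.exp (ν ^ 2) := by
  have h1 : ν ≤ Real.exp ν := by linarith [Real.add_one_le_exp ν]
  calc ν ^ k ≤ (Real.exp ν) ^ k := by gcongr
    _ = Real.exp (k * ν) := by rw [← Real.exp_nat_mul]
    _ ≤ _ := by
      apply Real.exp_le_exp.2
      have : (k : ℝ) ≤ 10 ^ 6 := by exact_mod_cast hk
      nlinarith

/-- Nearly regular degree data is realised by many bipartite graphs. -/
lemma Near.count {ν : ℝ} {r : V → ℕ} {c : W → ℕ} (h : Near ν r c) :
    2 ^ (Fintype.card V * Fintype.card W) * Real.exp (-ν ^ 23) ≤ (biClass r c).card := by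
  have hν := h.large
  have hpos : 0 < ν := by linarith
  have hm := h.card_le
  have hm' := h.le_card
  have hn := h.cardW
  have p20 : 0 < ν ^ 20 := by positivity
  have p22 : 0 < ν ^ 22 := by positivity
  have e22 := mul_pow_le_pow_of_lt hν (show 22 < 23 by norm_num)
  have e20 := mul_pow_le_pow_of_lt hν (show 11 < 20 by norm_num)
  have e11 := mul_pow_le_pow_of_lt hν (show 0 < 11 by norm_num)
  have e9 := mul_pow_le_pow_of_lt hν (show 0 < 9 by norm_num)
  have e21 := mul_pow_le_pow_of_lt hν (show 20 < 21 by norm_num)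
  have e0 := mul_pow_le_pow_of_lt hν (show 0 < 21 by norm_num)
  rw [pow_zero] at e11 e9 e0
  set M := Fintype.card V with hM
  set N := Fintype.card W with hNd
  obtain ⟨c₁, hbal, hprod⟩ := exists_balanced (W := W) r
  rw [← hM, ← hNd] at hprod
  have hn1 : (N : ℝ) + 1 ≤ Real.exp (ν ^ 2) := by
    rw [hn]; linarith [pow_le_exp_sq hν (show 21 ≤ 10 ^ 6 by norm_num)]
  have hm1 : (M : ℝ) + 1 ≤ Real.exp (ν ^ 2) := by
    linarith [pow_le_exp_sq hν (show 21 ≤ 10 ^ 6 by norm_num)]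
  have hbase : (2 : ℝ) ^ (M * N) * Real.exp (-(20 * ν ^ 22)) ≤ (biClass r c₁).card := by
    have h1 : ∀ v, 2 ^ N * Real.exp (-(17 * ν ^ 2)) ≤ ((N.choose (r v) : ℕ) : ℝ) := by
      intro v
      have h2 := choose_lower (n := N) (r := r v) (D := ν ^ 11) (by linarith) (by linarith)
        (by rw [hn]; exact h.row v)
      refine le_trans ?_ h2
      rw [hn, le_div_iff₀ (by positivity), mul_assoc]
      gcongr
      rw [show -(16 * (ν ^ 11) ^ 2 / ν ^ 20) = -(17 * ν ^ 2) + ν ^ 2 by field_simp; ring,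
        Real.exp_add, ← hn]
      gcongr
    have h3 : ((2 : ℝ) ^ N * Real.exp (-(17 * ν ^ 2))) ^ M ≤
        (Real.exp (ν ^ 2)) ^ N * (biClass r c₁).card := by
      calc ((2 : ℝ) ^ N * Real.exp (-(17 * ν ^ 2))) ^ M
          = ∏ _v : V, ((2 : ℝ) ^ N * Real.exp (-(17 * ν ^ 2))) := by simp [hM]
        _ ≤ ∏ v, ((N.choose (r v) : ℕ) : ℝ) := by
          refine prod_le_prod (fun _ _ => by positivity) fun v _ => h1 v
        _ ≤ ((M + 1 : ℕ) : ℝ) ^ N * (biClass r c₁).card := by exact_mod_cast hprod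
        _ ≤ _ := by push_cast; gcongr
    rw [← Real.exp_nat_mul, mul_comm (Real.exp (N * ν ^ 2)), ← div_le_iff₀ (Real.exp_pos _), div_eq_mul_inv,
      ← Real.exp_neg, mul_pow, ← Real.exp_nat_mul, ← pow_mul, mul_assoc, ← Real.exp_add,
      mul_comm N M] at h3
    refine le_trans ?_ h3
    gcongr
    rw [hn]
    have : (M : ℝ) * (17 * ν ^ 2) ≤ (1.01 * ν ^ 20) * (17 * ν ^ 2) := by gcongr
    nlinarith
  have hne : 0 < (biClass r c₁).card := by
    have : (0 : ℝ) < (biClass r c₁).card := lt_of_lt_of_le (by positivity) hbase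
    exact_mod_cast this
  obtain ⟨E, hE⟩ := card_pos.1 hne
  have h₁ : Near ν r c₁ := near_of_balanced h hbal (sum_eq_of_mem_biClass hE)
  set q : ℝ := 20 / ν ^ 9 with hq
  have hq0 : 0 ≤ q := by positivity
  have hq1 : q ≤ 1 / 2 := by
    rw [hq, div_le_iff₀ (by positivity)]
    linarith
  have hlow : ∀ c, Near ν r c → (1 - q) ^ (∑ w, (c₁ w - c w)) * ((biClass r c₁).card : ℝ) ≤
      (biClass r c).card → 2 ^ (M * N) * Real.exp (-ν ^ 23) ≤ (biClass r c).card := by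
    intro c hc hle
    refine le_trans ?_ hle
    have h1 : ((∑ w, (c₁ w - c w) : ℕ) : ℝ) ≤ 2 * ν ^ 31 := by
      push_cast
      calc ∑ w, ((c₁ w - c w : ℕ) : ℝ) ≤ ∑ _w : W, 2 * ν ^ 11 := by
            refine sum_le_sum fun w _ => ?_
            rcases Nat.le_total (c₁ w) (c w) with h2 | h2
            · rw [Nat.sub_eq_zero_of_le h2]
              simp only [Nat.cast_zero]
              positivity
            · rw [Nat.cast_sub h2]
              have h3 := abs_le.1 (h₁.col w)
              have h4 := abs_le.1 (hc.col w)
              linarith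
        _ = 2 * ν ^ 31 := by
            rw [sum_const, card_univ, nsmul_eq_mul, ← hNd, hn]; ring
    have h2 : Real.exp (-(80 * ν ^ 22)) ≤ (1 - q) ^ (∑ w, (c₁ w - c w)) := by
      calc Real.exp (-(80 * ν ^ 22)) ≤ Real.exp ((∑ w, (c₁ w - c w) : ℕ) * (-(2 * q))) := by
            apply Real.exp_le_exp.2
            have : ((∑ w, (c₁ w - c w) : ℕ) : ℝ) * (2 * q) ≤ 2 * ν ^ 31 * (2 * q) := by gcongr
            have h3 : 2 * ν ^ 31 * (2 * q) = 80 * ν ^ 22 := by rw [hq]; field_simp; norm_num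
            linarith
        _ = (Real.exp (-(2 * q))) ^ (∑ w, (c₁ w - c w)) := by rw [← Real.exp_nat_mul]
        _ ≤ _ := by gcongr; exact exp_neg_two_mul_le hq0 hq1
    calc (2 : ℝ) ^ (M * N) * Real.exp (-ν ^ 23)
        ≤ 2 ^ (M * N) * (Real.exp (-(80 * ν ^ 22)) * Real.exp (-(20 * ν ^ 22))) := by
          gcongr
          rw [← Real.exp_add]
          apply Real.exp_le_exp.2
          linarith
      _ = Real.exp (-(80 * ν ^ 22)) * (2 ^ (M * N) * Real.exp (-(20 * ν ^ 22))) := by ring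
      _ ≤ _ := mul_le_mul h2 hbase (by positivity) (pow_nonneg (by linarith) _)
  refine hlow c h ?_
  have key : ∀ j : ℕ, ∀ c, Near ν r c → ∑ w, (c₁ w - c w) = j →
      (1 - q) ^ j * ((biClass r c₁).card : ℝ) ≤ (biClass r c).card := by
    intro j
    induction j with
    | zero =>
      intro c hc hj
      have h1 : ∀ w ∈ univ, c₁ w ≤ c w := fun w hw => by
        have := (sum_eq_zero_iff.1 hj) w hw
        omega
      have h2 : c₁ = c := by
        funext w
        exact (sum_eq_sum_iff_of_le h1).1 (by rw [← h₁.sum, hc.sum]) w (mem_univ w)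
      simp [h2]
    | succ j ih =>
      intro c hc hj
      have hsum : ∑ w, c₁ w = ∑ w, c w := by rw [← h₁.sum, hc.sum]
      obtain ⟨a, ha⟩ : ∃ a, c a < c₁ a := by
        by_contra! hle
        rw [sum_eq_zero fun w _ => Nat.sub_eq_zero_of_le (hle w)] at hj
        omega
      obtain ⟨b, hb⟩ : ∃ b, c₁ b < c b := by
        by_contra! hle
        exact absurd hsum (ne_of_gt (sum_lt_sum (fun x _ => hle x) ⟨a, mem_univ a, ha⟩))
      have hab : a ≠ b := by rintro rfl; omega
      set c' : W → ℕ := Function.update (Function.update c a (c a + 1)) b (c b - 1) with hc'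
      have ha' : c' a = c a + 1 := by simp [hc', hab]
      have hb' : c' b + 1 = c b := by simp [hc']; omega
      have hw' : ∀ w, w ≠ a → w ≠ b → c' w = c w := fun w h1 h2 => by simp [hc', h1, h2]
      have hnear := hc.move h₁ hab ha' hb' hw' ha hb
      have hj' : ∑ w, (c₁ w - c' w) = j := by
        have key : ∀ g : W → ℕ, ∑ w, g w = g a + (g b + ∑ w ∈ (univ.erase a).erase b, g w) := by
          intro g
          rw [add_sum_erase _ _ (mem_erase.2 ⟨hab.symm, mem_univ b⟩),
            add_sum_erase _ _ (mem_univ a)]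
        have hrest : ∑ w ∈ (univ.erase a).erase b, (c₁ w - c' w) =
            ∑ w ∈ (univ.erase a).erase b, (c₁ w - c w) :=
          sum_congr rfl fun w hw => by
            rw [hw' w (ne_of_mem_erase (mem_of_mem_erase hw)) (ne_of_mem_erase hw)]
        rw [key] at hj ⊢
        rw [hrest]
        omega
      have h1 := ih c' hnear hj'
      have h2 := hlow c' hnear (by rw [hj']; exact h1)
      have h3 := card_biClass_move_lower hnear h2 (c' := c) hab ha'.symm hb'.symm
        fun w h1 h2 => (hw' w h1 h2).symm
      calc (1 - q) ^ (j + 1) * ((biClass r c₁).card : ℝ)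
          = (1 - q) * ((1 - q) ^ j * ((biClass r c₁).card : ℝ)) := by ring
        _ ≤ (1 - q) * (biClass r c').card := by
          refine mul_le_mul_of_nonneg_left h1 (by linarith)
        _ ≤ _ := h3
  exact key _ c h rfl

lemma Near.card_pos {ν : ℝ} {r : V → ℕ} {c : W → ℕ} (h : Near ν r c) :
    (0 : ℝ) < (biClass r c).card :=
  lt_of_lt_of_le (by positivity) h.count

end Count

section Patterns

variable {V W : Type*} [Fintype V] [Fintype W] [DecidableEq V] [DecidableEq W]

/-- Number of graphs in which the row vertex `v` is adjacent to all of `J`. -/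
noncomputable def incCount (r : V → ℕ) (c : W → ℕ) (v : V) (J : Finset W) : ℕ :=
  ((biClass r c).filter fun E => ∀ w ∈ J, E v w = true).card

/-- Number of graphs in which `v` is adjacent to all of `J` and to `b`, but not to `a`. -/
noncomputable def diffCount (r : V → ℕ) (c : W → ℕ) (v : V) (J : Finset W) (b a : W) : ℕ :=
  ((biClass r c).filter fun E => (∀ w ∈ J, E v w = true) ∧ E v b = true ∧ E v a = false).card

lemma incCount_le (r : V → ℕ) (c : W → ℕ) (v : V) (J : Finset W) :
    incCount r c v J ≤ (biClass r c).card := card_filter_le _ _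

lemma diffCount_le (r : V → ℕ) (c : W → ℕ) (v : V) (J : Finset W) (b a : W) :
    diffCount r c v J b a ≤ (biClass r c).card := card_filter_le _ _

lemma diffCount_add (r : V → ℕ) (c : W → ℕ) (v : V) (J : Finset W) (b a : W) :
    diffCount r c v J b a + incCount r c v (insert a (insert b J)) = incCount r c v (insert b J) := by
  unfold diffCount incCount
  rw [← card_filter_add_card_filter_not (s := (biClass r c).filter
    fun E => ∀ w ∈ insert b J, E v w = true) (fun E => E v a = false), filter_filter, filter_filter]
  congr 2
  · ext E
    simp only [mem_filter, mem_insert, forall_eq_or_imp]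
    tauto
  · ext E
    simp only [mem_filter, mem_insert, forall_eq_or_imp, Bool.not_eq_false]
    tauto

lemma sum_incCount_insert (r : V → ℕ) (c : W → ℕ) (v : V) (J : Finset W) :
    ∑ w, incCount r c v (insert w J) = r v * incCount r c v J := by
  have h1 : ∀ w, incCount r c v (insert w J) = ∑ E ∈ (biClass r c).filter
      (fun E => ∀ w ∈ J, E v w = true), if E v w = true then 1 else 0 := by
    intro w
    rw [← card_filter, filter_filter, incCount]
    congr 1
    ext E
    simp only [mem_filter, mem_insert, forall_eq_or_imp]
    tauto
  rw [sum_congr rfl fun w _ => h1 w, sum_comm, incCount, mul_comm, ← smul_eq_mul, ← sum_const]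
  refine sum_congr rfl fun E hE => ?_
  rw [← card_filter]
  exact (mem_filter.1 (mem_filter.1 hE).1).2.1 v

lemma sum_incCount_singleton (r : V → ℕ) (c : W → ℕ) (a : W) :
    ∑ v, incCount r c v {a} = c a * (biClass r c).card := by
  have h1 : ∀ v, incCount r c v {a} = ∑ E ∈ biClass r c, if E v a = true then 1 else 0 := by
    intro v
    rw [← card_filter, incCount]
    simp
  rw [sum_congr rfl fun v _ => h1 v, sum_comm, mul_comm, ← smul_eq_mul, ← sum_const]
  refine sum_congr rfl fun E hE => ?_
  rw [← card_filter]
  exact (mem_filter.1 hE).2.2 a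

lemma sum_incCount_pair (r : V → ℕ) (c : W → ℕ) (a b : W) :
    ∑ v, incCount r c v {b, a} = ∑ E ∈ biClass r c, codeg E a b := by
  have h1 : ∀ v, incCount r c v {b, a} =
      ∑ E ∈ biClass r c, if E v a = true ∧ E v b = true then 1 else 0 := by
    intro v
    rw [← card_filter, incCount]
    simp [and_comm]
  rw [sum_congr rfl fun v _ => h1 v, sum_comm]
  refine sum_congr rfl fun E hE => ?_
  rw [← card_filter, codeg]

/-- Switching on row `v` compares the two one-sided patterns. -/
lemma diffCount_switch {ν : ℝ} {r : V → ℕ} {c : W → ℕ} (h : Near ν r c) (v : V) {J : Finset W}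
    {a b : W} (hab : a ≠ b) (ha : a ∉ J) (hb : b ∉ J) :
    |(diffCount r c v J a b : ℝ) - (1 + 4 * ((c a : ℝ) - c b) / ν ^ 20) * diffCount r c v J b a|
      ≤ (ν ^ 15)⁻¹ * (biClass r c).card := by
  have hν := h.large
  have hpos : 0 < ν := by linarith
  have hca := abs_le.1 (h.col a)
  have hcb := abs_le.1 (h.col b)
  have e13 := mul_pow_le_pow_of_lt hν (show 11 < 13 by norm_num)
  have e11 := mul_pow_le_pow_of_lt hν (show 0 < 11 by norm_num)
  have e9 := mul_pow_le_pow_of_lt hν (show 0 < 9 by norm_num)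
  rw [pow_zero] at e11 e9
  have e20 := mul_pow_le_pow_of_lt hν (show 13 < 20 by norm_num)
  have p20 : 0 < ν ^ 20 := by positivity
  set N : ℝ := ((biClass r c).card : ℝ) with hNd
  have hN0 : 0 ≤ N := Nat.cast_nonneg _
  set lam : ℝ := 4 * ((c a : ℝ) - c b) / ν ^ 20 with hlam
  have hlam1 : |1 + lam| ≤ 2 := by
    have : |lam| ≤ 1 := by
      rw [hlam, abs_div, abs_of_pos p20, div_le_one p20, abs_le]
      constructor <;> linarith
    calc |1 + lam| ≤ |1| + |lam| := abs_add_le _ _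
      _ ≤ 2 := by rw [abs_one]; linarith
  have hfar := card_codeg_far_le h h.count hab
  set K := range (Fintype.card V + 1) with hK
  set G := K.filter fun k : ℕ => |(k : ℝ) - ν ^ 20 / 4| ≤ ν ^ 13 with hG
  have hcls : ∀ k, codegClass r c b a k = codegClass r c a b k := by
    intro k
    simp only [codegClass, codeg_comm]
  set p : ℕ → ℝ := fun k => ((patClass r c v J b a k).card : ℝ) with hp
  set q : ℕ → ℝ := fun k => ((patClass r c v J a b k).card : ℝ) with hq
  have fib : ∀ x y : W, (diffCount r c v J x y : ℝ) =
      ∑ k ∈ K, ((patClass r c v J x y k).card : ℝ) := by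
    intro x y
    rw [diffCount, card_eq_sum_card_fiberwise (f := fun E => codeg E y x) (t := K) fun E _ =>
      mem_coe.2 (mem_range.2 (Nat.lt_succ_of_le (card_le_univ _)))]
    rw [Nat.cast_sum]
    refine sum_congr rfl fun k _ => ?_
    congr 2
    ext E
    simp only [patClass, codegClass, mem_filter]
    tauto
  have hple : ∀ k, p k ≤ (codegClass r c a b k).card := fun k => by
    exact Nat.cast_le.2 (card_filter_le _ _)
  have hqle : ∀ k, q k ≤ (codegClass r c a b k).card := fun k => by
    rw [← hcls]
    exact Nat.cast_le.2 (card_filter_le _ _)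
  have hcod : ∑ k ∈ K, ((codegClass r c a b k).card : ℝ) = N := by
    rw [← Nat.cast_sum, hNd, hK, sum_card_codegClass]
  have hgood : ∀ k ∈ G, |q k - (1 + lam) * p k| ≤
      (2 * ν ^ 15)⁻¹ * (codegClass r c a b k).card := by
    intro k hk
    have hk' := abs_le.1 (mem_filter.1 hk).2
    have h3 := congrArg (Nat.cast (R := ℝ)) (card_patClass_switch r c v (a := a) (b := b) ha hb k)
    have hka : k ≤ c a := by
      have : (k : ℝ) ≤ c a := by linarith
      exact_mod_cast this
    have hkb : k ≤ c b := by
      have : (k : ℝ) ≤ c b := by linarith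
      exact_mod_cast this
    push_cast [Nat.cast_sub hka, Nat.cast_sub hkb] at h3
    have hy : 6 * ν ^ 20 / 25 ≤ (c b : ℝ) - k := by linarith
    have hy0 : 0 < (c b : ℝ) - k := by linarith
    have h4 : q k = p k * ((c a - k) / (c b - k)) := by
      rw [← mul_div_assoc, eq_div_iff hy0.ne']
      exact h3.symm
    have h5 : q k - (1 + lam) * p k =
        p k * (((c a : ℝ) - c b) * (ν ^ 20 - 4 * (c b - k)) / (ν ^ 20 * (c b - k))) := by
      rw [h4, hlam]
      field_simp
      ring
    rw [h5, abs_mul, abs_of_nonneg (Nat.cast_nonneg _ : (0 : ℝ) ≤ p k), mul_comm]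
    refine mul_le_mul ?_ (hple k) (Nat.cast_nonneg _) (by positivity)
    rw [abs_div, abs_mul, abs_of_pos (by positivity : 0 < ν ^ 20 * ((c b : ℝ) - k)),
      div_le_iff₀ (by positivity)]
    have h6 : |(c a : ℝ) - c b| ≤ 2 * ν ^ 11 := by
      rw [abs_le]; constructor <;> linarith
    have h7 : |ν ^ 20 - 4 * ((c b : ℝ) - k)| ≤ 5 * ν ^ 13 := by
      rw [abs_le]; constructor <;> linarith
    calc |(c a : ℝ) - c b| * |ν ^ 20 - 4 * ((c b : ℝ) - k)| ≤ (2 * ν ^ 11) * (5 * ν ^ 13) := by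
          gcongr
      _ ≤ (2 * ν ^ 15)⁻¹ * (ν ^ 20 * (6 * ν ^ 20 / 25)) := by
          have : (2 * ν ^ 15)⁻¹ * (ν ^ 20 * (6 * ν ^ 20 / 25)) = 3 / 25 * ν ^ 25 := by
            field_simp; norm_num
          rw [this]
          have := mul_pow_le_pow_of_lt hν (show 24 < 25 by norm_num)
          have : 0 < ν ^ 24 := by positivity
          linarith
      _ ≤ _ := by gcongr
  have hbad : ∀ k, |q k - (1 + lam) * p k| ≤ 3 * (codegClass r c a b k).card := by
    intro k
    calc |q k - (1 + lam) * p k| ≤ |q k| + |(1 + lam) * p k| := abs_sub _ _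
      _ ≤ (codegClass r c a b k).card + 2 * (codegClass r c a b k).card := by
        rw [abs_mul, abs_of_nonneg (Nat.cast_nonneg _ : (0 : ℝ) ≤ p k),
          abs_of_nonneg (Nat.cast_nonneg _ : (0 : ℝ) ≤ q k)]
        refine add_le_add (hqle k) (mul_le_mul hlam1 (hple k) (Nat.cast_nonneg _) (by norm_num))
      _ = _ := by ring
  have hbadsum : ∑ k ∈ K.filter (fun k : ℕ => ¬ |(k : ℝ) - ν ^ 20 / 4| ≤ ν ^ 13),
      ((codegClass r c a b k).card : ℝ) ≤ (ν ^ 60)⁻¹ * N := by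
    refine le_trans (le_of_eq ?_) hfar
    rw [← Nat.cast_sum]
    congr 1
    rw [card_eq_sum_card_fiberwise (f := fun E => codeg E a b)
      (t := K.filter (fun k : ℕ => ¬ |(k : ℝ) - ν ^ 20 / 4| ≤ ν ^ 13))]
    · refine sum_congr rfl fun k hk => ?_
      congr 1
      ext E
      simp only [codegClass, mem_filter]
      have := (mem_filter.1 hk).2
      constructor
      · rintro ⟨h1, rfl⟩
        exact ⟨⟨h1, not_le.1 this⟩, rfl⟩
      · rintro ⟨⟨h1, -⟩, rfl⟩
        exact ⟨h1, rfl⟩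
    · intro E hE
      exact mem_coe.2 (mem_filter.2 ⟨mem_range.2 (Nat.lt_succ_of_le (card_le_univ _)),
        not_le.2 (mem_filter.1 hE).2⟩)
  have h60 : 3 * (ν ^ 60)⁻¹ ≤ (2 * ν ^ 15)⁻¹ := by
    rw [← div_eq_mul_inv, div_le_iff₀ (by positivity)]
    have : (2 * ν ^ 15)⁻¹ * ν ^ 60 = ν ^ 45 / 2 := by field_simp
    rw [this]
    have := mul_pow_le_pow_of_lt hν (show 0 < 45 by norm_num)
    linarith
  rw [fib a b, fib b a, mul_sum, ← sum_sub_distrib]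
  calc |∑ k ∈ K, (q k - (1 + lam) * p k)| ≤ ∑ k ∈ K, |q k - (1 + lam) * p k| :=
        abs_sum_le_sum_abs _ _
    _ = ∑ k ∈ G, |q k - (1 + lam) * p k| +
        ∑ k ∈ K.filter (fun k : ℕ => ¬ |(k : ℝ) - ν ^ 20 / 4| ≤ ν ^ 13), |q k - (1 + lam) * p k| :=
        (sum_filter_add_sum_filter_not _ _ _).symm
    _ ≤ ∑ k ∈ G, (2 * ν ^ 15)⁻¹ * ((codegClass r c a b k).card : ℝ) +
        ∑ k ∈ K.filter (fun k : ℕ => ¬ |(k : ℝ) - ν ^ 20 / 4| ≤ ν ^ 13),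
          3 * ((codegClass r c a b k).card : ℝ) :=
        add_le_add (sum_le_sum hgood) (sum_le_sum fun k _ => hbad k)
    _ ≤ (2 * ν ^ 15)⁻¹ * N + 3 * ((ν ^ 60)⁻¹ * N) := by
        rw [← mul_sum, ← mul_sum, ← hcod]
        refine add_le_add ?_ ?_
        · gcongr
          exact filter_subset _ _
        · rw [hcod]
          gcongr
    _ ≤ (2 * ν ^ 15)⁻¹ * N + (2 * ν ^ 15)⁻¹ * N := by
        rw [← mul_assoc]
        gcongr
    _ = _ := by
        rw [mul_inv]; ring

end Patterns

section ExpectedCodegree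

variable {V W : Type*} [Fintype V] [Fintype W] [DecidableEq V] [DecidableEq W]

lemma incCount_sub_incCount (r : V → ℕ) (c : W → ℕ) (v : V) (J : Finset W) (a b : W) :
    (incCount r c v (insert a J) : ℝ) - incCount r c v (insert b J) =
      (diffCount r c v J a b : ℝ) - diffCount r c v J b a := by
  have h1 := congrArg (Nat.cast (R := ℝ)) (diffCount_add r c v J a b)
  have h2 := congrArg (Nat.cast (R := ℝ)) (diffCount_add r c v J b a)
  rw [insert_comm] at h1
  push_cast at h1 h2
  linarith

/-- The relative difference of two column degrees is small. -/
lemma Near.abs_switch_coeff {ν : ℝ} {r : V → ℕ} {c : W → ℕ} (h : Near ν r c) (a b : W) :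
    |4 * ((c a : ℝ) - c b) / ν ^ 20| ≤ 8 * (ν ^ 9)⁻¹ := by
  have hpos : 0 < ν := by linarith [h.large]
  have hca := abs_le.1 (h.col a)
  have hcb := abs_le.1 (h.col b)
  have e : 8 * (ν ^ 9)⁻¹ = 8 * ν ^ 11 / ν ^ 20 := by field_simp
  rw [e, abs_div, abs_of_pos (by positivity : 0 < ν ^ 20)]
  gcongr
  rw [abs_le]
  constructor <;> linarith

lemma abs_incCount_sub_le {ν : ℝ} {r : V → ℕ} {c : W → ℕ} (h : Near ν r c) (v : V) {J : Finset W}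
    {a b : W} (ha : a ∉ J) (hb : b ∉ J) :
    |(incCount r c v (insert a J) : ℝ) - incCount r c v (insert b J) -
      4 * ((c a : ℝ) - c b) / ν ^ 20 * diffCount r c v J b a| ≤
      (ν ^ 15)⁻¹ * (biClass r c).card := by
  have hpos : 0 < ν := by linarith [h.large]
  by_cases hab : a = b
  · subst hab
    simp only [sub_self, mul_zero, zero_div, zero_mul, abs_zero]
    positivity
  · refine le_trans (le_of_eq ?_) (diffCount_switch h v hab ha hb)
    rw [incCount_sub_incCount]
    congr 1
    ring

/-- Adding a vertex to the pattern halves the count, to first order. -/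
lemma incCount_insert_half {ν : ℝ} {r : V → ℕ} {c : W → ℕ} (h : Near ν r c) (v : V) {J : Finset W}
    (hJ : J.card ≤ 2) {b : W} (hb : b ∉ J) :
    |(incCount r c v (insert b J) : ℝ) - incCount r c v J / 2| ≤
      (ν ^ 8)⁻¹ * (biClass r c).card := by
  have hν := h.large
  have hpos : 0 < ν := by linarith
  set N : ℝ := ((biClass r c).card : ℝ) with hNd
  have hN0 : 0 ≤ N := Nat.cast_nonneg _
  have p20 : 0 < ν ^ 20 := by positivity
  have hle : ∀ K : Finset W, (incCount r c v K : ℝ) ≤ N := fun K => Nat.cast_le.2 (incCount_le _ _ _ _)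
  have hnn : ∀ K : Finset W, 0 ≤ (incCount r c v K : ℝ) := fun K => Nat.cast_nonneg _
  have hterm : ∀ w, |(incCount r c v (insert w J) : ℝ) - incCount r c v (insert b J)| ≤
      9 * (ν ^ 9)⁻¹ * N + if w ∈ J then N else 0 := by
    intro w
    split_ifs with hw
    · have : |(incCount r c v (insert w J) : ℝ) - incCount r c v (insert b J)| ≤ N := by
        rw [abs_le]
        constructor <;> linarith [hle (insert w J), hle (insert b J), hnn (insert w J),
          hnn (insert b J)]
      have h0 : 0 ≤ 9 * (ν ^ 9)⁻¹ * N := by positivity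
      linarith
    · have h1 := abs_incCount_sub_le h v hw hb
      have h2 : |4 * ((c w : ℝ) - c b) / ν ^ 20 * diffCount r c v J b w| ≤ 8 * (ν ^ 9)⁻¹ * N := by
        rw [abs_mul, abs_of_nonneg (Nat.cast_nonneg _ : (0 : ℝ) ≤ diffCount r c v J b w)]
        exact mul_le_mul (h.abs_switch_coeff w b) (Nat.cast_le.2 (diffCount_le _ _ _ _ _ _))
          (Nat.cast_nonneg _) (by positivity)
      have h3 : (ν ^ 15)⁻¹ * N ≤ (ν ^ 9)⁻¹ * N := by
        refine mul_le_mul_of_nonneg_right (inv_anti₀ (by positivity) ?_) hN0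
        exact pow_le_pow_right₀ (by linarith) (by norm_num)
      rw [← hNd] at h1
      have := abs_le.1 h1
      have := abs_le.1 h2
      rw [abs_le]
      constructor <;> linarith
  have hsum : |(r v : ℝ) * incCount r c v J - ν ^ 20 * incCount r c v (insert b J)| ≤
      10 * ν ^ 11 * N := by
    have h1 := congrArg (Nat.cast (R := ℝ)) (sum_incCount_insert r c v J)
    push_cast at h1
    rw [← h1, ← h.cardW]
    have e : (Fintype.card W : ℝ) * incCount r c v (insert b J) =
        ∑ _w : W, (incCount r c v (insert b J) : ℝ) := by
      rw [sum_const, card_univ, nsmul_eq_mul]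
    rw [e, ← sum_sub_distrib]
    refine (abs_sum_le_sum_abs _ _).trans ((sum_le_sum fun w _ => hterm w).trans ?_)
    rw [sum_add_distrib, sum_const, card_univ, nsmul_eq_mul, h.cardW, ← sum_filter, sum_const,
      nsmul_eq_mul]
    have hJ' : ((univ.filter fun w => w ∈ J).card : ℝ) ≤ 2 := by
      rw [filter_mem_eq_inter, univ_inter]
      exact_mod_cast hJ
    have e2 : ν ^ 20 * (9 * (ν ^ 9)⁻¹ * N) = 9 * ν ^ 11 * N := by field_simp
    rw [e2]
    have h2 : ((univ.filter fun w => w ∈ J).card : ℝ) * N ≤ ν ^ 11 * N := by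
      refine mul_le_mul_of_nonneg_right (hJ'.trans ?_) hN0
      have := mul_pow_le_pow_of_lt hν (show 0 < 11 by norm_num)
      linarith
    linarith
  have hr := abs_le.1 (h.row v)
  have h3 : |((r v : ℝ) - ν ^ 20 / 2) * incCount r c v J| ≤ ν ^ 11 * N := by
    rw [abs_mul, abs_of_nonneg (hnn J)]
    exact mul_le_mul (h.row v) (hle J) (hnn J) (by positivity)
  have e4 : ν ^ 20 * ((ν ^ 8)⁻¹ * N) = ν ^ 12 * N := by field_simp
  have h5 : 11 * ν ^ 11 * N ≤ ν ^ 12 * N := by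
    refine mul_le_mul_of_nonneg_right ?_ hN0
    have := mul_pow_le_pow_of_lt hν (show 11 < 12 by norm_num)
    have : 0 < ν ^ 11 := by positivity
    linarith
  refine le_of_mul_le_mul_left ?_ p20
  rw [e4, ← abs_of_pos p20, ← abs_mul]
  have hs := abs_le.1 hsum
  have h3' := abs_le.1 h3
  rw [abs_le]
  constructor <;> nlinarith

lemma incCount_pair_sub {ν : ℝ} {r : V → ℕ} {c : W → ℕ} (h : Near ν r c) (v : V)
    {a b x : W} (hb : b ≠ a) (hx : x ≠ a) :
    |(incCount r c v {x, a} : ℝ) - incCount r c v {b, a} -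
      ((c x : ℝ) - c b) / (2 * ν ^ 20) * (biClass r c).card| ≤
      2 * (ν ^ 15)⁻¹ * (biClass r c).card := by
  have hν := h.large
  have hpos : 0 < ν := by linarith
  set N : ℝ := ((biClass r c).card : ℝ) with hNd
  have hN0 : 0 ≤ N := Nat.cast_nonneg _
  by_cases hxb : x = b
  · subst hxb
    simp only [sub_self, zero_div, zero_mul, abs_zero]
    positivity
  have h1 := abs_incCount_sub_le h v (J := {a}) (a := x) (b := b) (by simpa using hx)
    (by simpa using hb)
  have h0 : (incCount r c v ∅ : ℝ) = N := by simp [incCount, hNd]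
  have i1 := abs_le.1 (incCount_insert_half h v (J := ∅) (by simp) (b := a) (by simp))
  have i2 := abs_le.1 (incCount_insert_half h v (J := {a}) (by simp) (b := b) (by simpa using hb))
  have i3 := abs_le.1 (incCount_insert_half h v (J := {b, a}) card_le_two (b := x)
    (by simp [hxb, hx]))
  have hD := congrArg (Nat.cast (R := ℝ)) (diffCount_add r c v {a} b x)
  push_cast at hD
  rw [h0] at i1
  rw [insert_empty_eq] at i1
  set D : ℝ := (diffCount r c v {a} b x : ℝ) with hDd
  have hDN : |D - N / 8| ≤ 4 * ((ν ^ 8)⁻¹ * N) := by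
    rw [abs_le]
    constructor <;> linarith
  have h2 : |4 * ((c x : ℝ) - c b) / ν ^ 20 * (D - N / 8)| ≤ 8 * (ν ^ 9)⁻¹ * (4 * ((ν ^ 8)⁻¹ * N)) := by
    rw [abs_mul]
    exact mul_le_mul (h.abs_switch_coeff x b) hDN (abs_nonneg _) (by positivity)
  have h3 : 8 * (ν ^ 9)⁻¹ * (4 * ((ν ^ 8)⁻¹ * N)) ≤ (ν ^ 15)⁻¹ * N := by
    have : 8 * (ν ^ 9)⁻¹ * (4 * ((ν ^ 8)⁻¹ * N)) = 32 / ν ^ 2 * ((ν ^ 15)⁻¹ * N) := by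
      field_simp; ring
    rw [this]
    refine mul_le_of_le_one_left (by positivity) ?_
    rw [div_le_one (by positivity)]
    have := mul_pow_le_pow_of_lt hν (show 0 < 2 by norm_num)
    linarith
  have e : 4 * ((c x : ℝ) - c b) / ν ^ 20 * D = 4 * ((c x : ℝ) - c b) / ν ^ 20 * (D - N / 8) +
      ((c x : ℝ) - c b) / (2 * ν ^ 20) * N := by
    field_simp; ring
  rw [e] at h1
  have h1' := abs_le.1 h1
  have h2' := abs_le.1 h2
  rw [abs_le]
  constructor <;> linarith

lemma incCount_pair_row {ν : ℝ} {r : V → ℕ} {c : W → ℕ} (h : Near ν r c) (v : V)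
    {a b : W} (hb : b ≠ a) :
    |(r v : ℝ) * incCount r c v {a} - ν ^ 20 * incCount r c v {b, a} -
      ((∑ w, c w : ℕ) - ν ^ 20 * c b) / (2 * ν ^ 20) * (biClass r c).card| ≤
      3 * ν ^ 5 * (biClass r c).card := by
  have hν := h.large
  have hpos : 0 < ν := by linarith
  set N : ℝ := ((biClass r c).card : ℝ) with hNd
  have hN0 : 0 ≤ N := Nat.cast_nonneg _
  have hle : ∀ K : Finset W, (incCount r c v K : ℝ) ≤ N := fun K => Nat.cast_le.2 (incCount_le _ _ _ _)
  have hnn : ∀ K : Finset W, 0 ≤ (incCount r c v K : ℝ) := fun K => Nat.cast_nonneg _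
  have hterm : ∀ x, |(incCount r c v {x, a} : ℝ) - incCount r c v {b, a} -
      ((c x : ℝ) - c b) / (2 * ν ^ 20) * N| ≤ 2 * (ν ^ 15)⁻¹ * N + if x = a then 2 * N else 0 := by
    intro x
    have h0 : 0 ≤ 2 * (ν ^ 15)⁻¹ * N := by positivity
    split_ifs with hx
    · have h1 : |((c x : ℝ) - c b) / (2 * ν ^ 20) * N| ≤ N := by
        have e : ((c x : ℝ) - c b) / (2 * ν ^ 20) = (4 * ((c x : ℝ) - c b) / ν ^ 20) / 8 := by
          field_simp; ring
        rw [e, abs_mul, abs_of_nonneg hN0]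
        refine mul_le_of_le_one_left hN0 ?_
        rw [abs_div, abs_of_pos (by norm_num : (0:ℝ) < 8), div_le_one (by norm_num)]
        refine (h.abs_switch_coeff x b).trans ?_
        have : (ν ^ 9)⁻¹ ≤ 1 := inv_le_one_of_one_le₀ (one_le_pow₀ (by linarith))
        linarith
      have := abs_le.1 h1
      rw [abs_le]
      constructor <;> linarith [hle {x, a}, hle {b, a}, hnn {x, a}, hnn {b, a}]
    · rw [add_zero]
      exact incCount_pair_sub h v hb hx
  have h1 := congrArg (Nat.cast (R := ℝ)) (sum_incCount_insert r c v {a})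
  push_cast at h1
  have e : (r v : ℝ) * incCount r c v {a} - ν ^ 20 * incCount r c v {b, a} -
      ((∑ w, c w : ℕ) - ν ^ 20 * c b) / (2 * ν ^ 20) * N =
      ∑ x, ((incCount r c v {x, a} : ℝ) - incCount r c v {b, a} -
      ((c x : ℝ) - c b) / (2 * ν ^ 20) * N) := by
    rw [sum_sub_distrib, sum_sub_distrib, ← sum_mul, ← sum_div, sum_sub_distrib, h1, sum_const,
      sum_const, card_univ, nsmul_eq_mul, nsmul_eq_mul, h.cardW]
    push_cast
    ring
  rw [e]
  refine (abs_sum_le_sum_abs _ _).trans ((sum_le_sum fun x _ => hterm x).trans ?_)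
  rw [sum_add_distrib, sum_const, card_univ, nsmul_eq_mul, h.cardW, sum_ite_eq' univ a,
    if_pos (mem_univ _)]
  have e2 : ν ^ 20 * (2 * (ν ^ 15)⁻¹ * N) = 2 * ν ^ 5 * N := by field_simp
  rw [e2]
  have h2 : 2 * N ≤ ν ^ 5 * N := by
    refine mul_le_mul_of_nonneg_right ?_ hN0
    have := mul_pow_le_pow_of_lt hν (show 0 < 5 by norm_num)
    linarith
  linarith

lemma sum_row_mul_incCount {ν : ℝ} {r : V → ℕ} {c : W → ℕ} (h : Near ν r c) (a : W) :
    |∑ v, (r v : ℝ) * incCount r c v {a} -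
      (∑ w, c w : ℕ) / (Fintype.card V : ℝ) * (c a * (biClass r c).card)| ≤
      2 * ν ^ 3 * (Fintype.card V : ℝ) * (biClass r c).card := by
  have hν := h.large
  have hpos : 0 < ν := by linarith
  have p20 : 0 < ν ^ 20 := by positivity
  set N : ℝ := ((biClass r c).card : ℝ) with hNd
  have hN0 : 0 ≤ N := Nat.cast_nonneg _
  set m : ℝ := (Fintype.card V : ℝ) with hm
  have hm0 : 0 < m := by linarith [h.le_card]
  set R : ℝ := ((∑ w, c w : ℕ) : ℝ) / m with hR
  have hRsum : ∑ v, ((r v : ℝ) - R) = 0 := by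
    rw [sum_sub_distrib, sum_const, card_univ, nsmul_eq_mul, ← hm, hR, mul_div_cancel₀ _ hm0.ne',
      ← h.sum]
    push_cast
    ring
  have hRc : |R - ν ^ 20 / 2| ≤ ν ^ 11 := by
    have e : R - ν ^ 20 / 2 = (∑ v, ((r v : ℝ) - ν ^ 20 / 2)) / m := by
      rw [sum_sub_distrib, sum_const, card_univ, nsmul_eq_mul, ← hm, hR, ← h.sum, sub_div,
        mul_div_cancel_left₀ _ hm0.ne']
      push_cast
      rfl
    rw [e, abs_div, abs_of_pos hm0, div_le_iff₀ hm0]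
    refine (abs_sum_le_sum_abs _ _).trans ((sum_le_sum fun v _ => h.row v).trans (le_of_eq ?_))
    rw [sum_const, card_univ, nsmul_eq_mul, hm, mul_comm]
  have h0 : (∑ v, (incCount r c v {a} : ℝ)) = c a * N := by
    have := congrArg (Nat.cast (R := ℝ)) (sum_incCount_singleton r c a)
    push_cast at this
    exact this
  have e : ∑ v, (r v : ℝ) * incCount r c v {a} - R * (c a * N) =
      ∑ v, ((r v : ℝ) - R) * (incCount r c v {a} - N / 2) := by
    have : ∑ v, ((r v : ℝ) - R) * (incCount r c v {a} - N / 2) =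
        ∑ v, (r v : ℝ) * incCount r c v {a} - R * ∑ v, (incCount r c v {a} : ℝ) -
          (∑ v, ((r v : ℝ) - R)) * (N / 2) := by
      rw [mul_sum, sum_mul, ← sum_sub_distrib, ← sum_sub_distrib]
      refine sum_congr rfl fun v _ => ?_
      ring
    rw [this, hRsum, h0]
    ring
  rw [e]
  have hterm : ∀ v, |((r v : ℝ) - R) * (incCount r c v {a} - N / 2)| ≤ 2 * ν ^ 3 * N := by
    intro v
    have h1 : |(r v : ℝ) - R| ≤ 2 * ν ^ 11 := by
      have := abs_le.1 (h.row v)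
      have := abs_le.1 hRc
      rw [abs_le]
      constructor <;> linarith
    have h2 := incCount_insert_half h v (J := ∅) (by simp) (b := a) (by simp)
    have h0 : (incCount r c v ∅ : ℝ) = N := by simp [incCount, hNd]
    rw [h0, insert_empty_eq] at h2
    rw [abs_mul]
    calc |(r v : ℝ) - R| * |(incCount r c v {a} : ℝ) - N / 2| ≤ (2 * ν ^ 11) * ((ν ^ 8)⁻¹ * N) :=
          mul_le_mul h1 h2 (abs_nonneg _) (by positivity)
      _ = _ := by field_simp
  refine (abs_sum_le_sum_abs _ _).trans ((sum_le_sum fun v _ => hterm v).trans (le_of_eq ?_))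
  rw [sum_const, card_univ, nsmul_eq_mul, hm]
  ring

/-- The expected codegree of two columns. -/
lemma sum_codeg_near {ν : ℝ} {r : V → ℕ} {c : W → ℕ} (h : Near ν r c) {a b : W} (hb : b ≠ a) :
    |∑ E ∈ biClass r c,
      ((codeg E a b : ℝ) - (((c a : ℝ) + c b) / 2 - (Fintype.card V : ℝ) / 4))| ≤
      ν ^ 6 * (biClass r c).card := by
  have hν := h.large
  have hpos : 0 < ν := by linarith
  have p20 : 0 < ν ^ 20 := by positivity
  have hmu := h.card_le
  have hml := h.le_card
  have hmV := abs_le.1 h.cardV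
  have h1 := sum_row_mul_incCount h a
  have hrow : |∑ v, ((r v : ℝ) * incCount r c v {a} - ν ^ 20 * incCount r c v {b, a} -
      ((∑ w, c w : ℕ) - ν ^ 20 * c b) / (2 * ν ^ 20) * (biClass r c).card)| ≤
      (Fintype.card V : ℝ) * (3 * ν ^ 5 * (biClass r c).card) := by
    refine (abs_sum_le_sum_abs _ _).trans
      ((sum_le_sum fun v _ => incCount_pair_row h v hb).trans (le_of_eq ?_))
    rw [sum_const, card_univ, nsmul_eq_mul]
  rw [sum_sub_distrib, sum_sub_distrib, ← mul_sum, sum_const, card_univ, nsmul_eq_mul] at hrow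
  have hS := congrArg (Nat.cast (R := ℝ)) (sum_incCount_pair r c a b)
  push_cast at hS
  rw [hS] at hrow
  rw [sum_sub_distrib, sum_const, nsmul_eq_mul]
  set N : ℝ := ((biClass r c).card : ℝ) with hNd
  have hN0 : 0 ≤ N := Nat.cast_nonneg _
  set m : ℝ := (Fintype.card V : ℝ) with hm
  have hm0 : 0 < m := by linarith
  set S : ℝ := ∑ E ∈ biClass r c, (codeg E a b : ℝ) with hSd
  have hC : |((∑ w, c w : ℕ) : ℝ) / ν ^ 20 - ν ^ 20 / 2| ≤ ν ^ 11 := by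
    have e : ((∑ w, c w : ℕ) : ℝ) / ν ^ 20 - ν ^ 20 / 2 =
        (∑ w, ((c w : ℝ) - ν ^ 20 / 2)) / ν ^ 20 := by
      rw [sum_sub_distrib, sum_const, card_univ, nsmul_eq_mul, h.cardW, sub_div,
        mul_div_cancel_left₀ _ p20.ne']
      push_cast
      rfl
    rw [e, abs_div, abs_of_pos p20, div_le_iff₀ p20]
    refine (abs_sum_le_sum_abs _ _).trans ((sum_le_sum fun v _ => h.col v).trans (le_of_eq ?_))
    rw [sum_const, card_univ, nsmul_eq_mul, h.cardW, mul_comm]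
  set M : ℝ := ((∑ w, c w : ℕ) : ℝ) with hM
  obtain ⟨C, hCM⟩ : ∃ C, M = ν ^ 20 * C := ⟨M / ν ^ 20, by field_simp⟩
  rw [hCM] at hrow h1 hC
  rw [mul_div_cancel_left₀ _ p20.ne'] at hC
  have hC' := abs_le.1 hC
  have hca := abs_le.1 (h.col a)
  have hcb := abs_le.1 (h.col b)
  have q1 : |(C - m / 2) * ((c a : ℝ) - m / 2) / m| ≤ 3 * ν ^ 2 := by
    rw [abs_div, abs_mul, abs_of_pos hm0, div_le_iff₀ hm0]
    have u1 : |C - m / 2| ≤ 3 / 2 * ν ^ 11 := by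
      rw [abs_le]; constructor <;> linarith
    have u2 : |(c a : ℝ) - m / 2| ≤ 3 / 2 * ν ^ 11 := by
      rw [abs_le]; constructor <;> linarith
    calc _ ≤ (3 / 2 * ν ^ 11) * (3 / 2 * ν ^ 11) := mul_le_mul u1 u2 (abs_nonneg _) (by positivity)
      _ ≤ 3 * ν ^ 2 * (0.99 * ν ^ 20) := by
        have : 0 < ν ^ 22 := by positivity
        nlinarith
      _ ≤ _ := by gcongr
  have q2 : |((c b : ℝ) - C) * ((m - ν ^ 20) / (2 * ν ^ 20))| ≤ ν ^ 2 := by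
    rw [abs_mul, abs_div, abs_of_pos (by positivity : 0 < 2 * ν ^ 20), ← mul_div_assoc,
      div_le_iff₀ (by positivity)]
    have u1 : |(c b : ℝ) - C| ≤ 2 * ν ^ 11 := by
      rw [abs_le]; constructor <;> linarith
    calc _ ≤ (2 * ν ^ 11) * ν ^ 11 := mul_le_mul u1 h.cardV (abs_nonneg _) (by positivity)
      _ = _ := by ring
  set k₀ : ℝ := ((c a : ℝ) + c b) / 2 - m / 4 with hk₀
  have hkey : ν ^ 20 * (S - N * k₀) = (∑ v, (r v : ℝ) * incCount r c v {a} * 1 -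
      (ν ^ 20 * C / m * (c a * N))) -
      (∑ v, (r v : ℝ) * incCount r c v {a} - ν ^ 20 * S -
        m * ((ν ^ 20 * C - ν ^ 20 * c b) / (2 * ν ^ 20) * N)) +
      ν ^ 20 * N * ((C - m / 2) * ((c a : ℝ) - m / 2) / m +
        ((c b : ℝ) - C) * ((m - ν ^ 20) / (2 * ν ^ 20))) := by
    rw [hk₀]
    simp only [mul_one]
    field_simp
    ring
  simp only [mul_one] at hkey
  have q3 : |ν ^ 20 * N * ((C - m / 2) * ((c a : ℝ) - m / 2) / m +
        ((c b : ℝ) - C) * ((m - ν ^ 20) / (2 * ν ^ 20)))| ≤ ν ^ 20 * N * (4 * ν ^ 2) := by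
    rw [abs_mul, abs_of_nonneg (by positivity : 0 ≤ ν ^ 20 * N)]
    refine mul_le_mul_of_nonneg_left ((abs_add_le _ _).trans ?_) (by positivity)
    linarith
  have q4 : |ν ^ 20 * (S - N * k₀)| ≤ 2 * ν ^ 3 * m * N + m * (3 * ν ^ 5 * N) +
      ν ^ 20 * N * (4 * ν ^ 2) := by
    rw [hkey]
    refine (abs_add_le _ _).trans (add_le_add ((abs_sub _ _).trans (add_le_add h1 ?_)) q3)
    exact hrow
  rw [abs_mul, abs_of_pos p20] at q4
  refine le_of_mul_le_mul_left (q4.trans ?_) p20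
  have w1 : 2 * ν ^ 3 * m * N ≤ 2 * ν ^ 3 * (1.01 * ν ^ 20) * N := by gcongr
  have w2 : m * (3 * ν ^ 5 * N) ≤ (1.01 * ν ^ 20) * (3 * ν ^ 5 * N) := by gcongr
  refine (add_le_add (add_le_add w1 w2) le_rfl).trans ?_
  have e : 2 * ν ^ 3 * (1.01 * ν ^ 20) * N + 1.01 * ν ^ 20 * (3 * ν ^ 5 * N) +
      ν ^ 20 * N * (4 * ν ^ 2) = (2.02 * ν ^ 3 + 3.03 * ν ^ 5 + 4 * ν ^ 2) * (ν ^ 20 * N) := by ring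
  rw [e, show ν ^ 20 * (ν ^ 6 * N) = ν ^ 6 * (ν ^ 20 * N) by ring]
  refine mul_le_mul_of_nonneg_right ?_ (by positivity)
  have a1 := mul_pow_le_pow_of_lt hν (show 3 < 6 by norm_num)
  have a2 := mul_pow_le_pow_of_lt hν (show 5 < 6 by norm_num)
  have a3 := mul_pow_le_pow_of_lt hν (show 2 < 6 by norm_num)
  have : 0 < ν ^ 3 := by positivity
  have : 0 < ν ^ 5 := by positivity
  have : 0 < ν ^ 2 := by positivity
  linarith

end ExpectedCodegree

section Ratio

lemma abs_log_le_of_abs_sub_one_le {x e : ℝ} (h : |x - 1| ≤ e) (he : e ≤ 1 / 2) :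
    |Real.log x| ≤ 2 * e := by
  have h' := abs_le.1 h
  have hx : 0 < x := by linarith
  have h1 := Real.log_le_sub_one_of_pos hx
  have h2 := Real.one_sub_inv_le_log_of_pos hx
  have h3 : -(2 * e) ≤ 1 - x⁻¹ := by
    have : 1 - x⁻¹ = (x - 1) / x := by field_simp
    rw [this, le_div_iff₀ hx]
    nlinarith
  rw [abs_le]
  constructor <;> linarith

/-- Second order comparison of `(s + g / 2) / (s - g / 2)` with an exponential. -/
lemma abs_ratio_sub_exp_le {x ε : ℝ} (hx : |x| ≤ 1 / 4) (hε0 : 0 ≤ ε) :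
    |1 + x / (1 + ε - x / 2) - Real.exp x| ≤ 4 * |x| * ε + 2 * |x| ^ 3 := by
  have hx' := abs_le.1 hx
  have h1 := Real.exp_bound (x := x) (by linarith) (n := 3) (by norm_num)
  simp only [sum_range_succ, sum_range_zero, Nat.factorial] at h1
  norm_num at h1
  have hd : 1 / 2 ≤ 1 + ε - x / 2 := by linarith
  have e1 : x / (1 + ε - x / 2) - x - x ^ 2 / 2 =
      x * (x ^ 2 / 4 - ε * (1 + x / 2)) / (1 + ε - x / 2) := by
    have hne : 1 + ε - x / 2 ≠ 0 := by
      have : 0 < 1 + ε - x / 2 := by linarith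
      exact this.ne'
    rw [eq_div_iff hne, sub_mul, sub_mul, div_mul_cancel₀ _ hne]
    ring
  have h2 : |x / (1 + ε - x / 2) - x - x ^ 2 / 2| ≤ |x| * (x ^ 2 / 4 + ε * 2) * 2 := by
    rw [e1, abs_div, abs_mul, abs_of_pos (by linarith : 0 < 1 + ε - x / 2),
      div_le_iff₀ (by linarith)]
    have h3 : |x ^ 2 / 4 - ε * (1 + x / 2)| ≤ x ^ 2 / 4 + ε * 2 := by
      rw [abs_le]
      constructor <;> nlinarith [sq_nonneg x]
    have h4 : |x| * |x ^ 2 / 4 - ε * (1 + x / 2)| ≤ |x| * (x ^ 2 / 4 + ε * 2) :=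
      mul_le_mul_of_nonneg_left h3 (abs_nonneg _)
    have h5 : 0 ≤ |x| * (x ^ 2 / 4 + ε * 2) := by positivity
    nlinarith
  have e2 : |x| * (x ^ 2 / 4 + ε * 2) * 2 = 4 * |x| * ε + |x| ^ 3 / 2 := by
    rw [← sq_abs]; ring
  rw [e2] at h2
  have h0 : 0 ≤ |x| ^ 3 := by positivity
  have h1' := abs_le.1 h1
  have h2' := abs_le.1 h2
  rw [abs_le]
  constructor <;> linarith

variable {V W : Type*} [Fintype V] [Fintype W] [DecidableEq V] [DecidableEq W]

/-- Sums over all codegrees of a pair of columns. -/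
lemma sum_codegClass_weighted (r : V → ℕ) (c : W → ℕ) (a b : W) (f : ℕ → ℝ) :
    ∑ k ∈ range (Fintype.card V + 1), ((codegClass r c a b k).card : ℝ) * f k =
      ∑ E ∈ biClass r c, f (codeg E a b) := by
  have hm : ∀ E ∈ biClass r c, codeg E a b ∈ range (Fintype.card V + 1) := fun E _ =>
    mem_range.2 (Nat.lt_succ_of_le (card_le_univ _))
  rw [← sum_fiberwise_of_maps_to hm]
  refine sum_congr rfl fun k _ => ?_
  rw [← nsmul_eq_mul, ← sum_const]
  exact sum_congr rfl fun E hE => by rw [(mem_filter.1 hE).2]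

/-- The codegrees far from a quarter of the number of rows are negligible. -/
lemma sum_codegClass_far {ν : ℝ} {r : V → ℕ} {c : W → ℕ} (h : Near ν r c) {a b : W} (hab : a ≠ b) :
    ∑ k ∈ (range (Fintype.card V + 1)).filter (fun k : ℕ => ¬ |(k : ℝ) - ν ^ 20 / 4| ≤ ν ^ 13),
      ((codegClass r c a b k).card : ℝ) ≤ (ν ^ 60)⁻¹ * (biClass r c).card := by
  refine le_trans (le_of_eq ?_) (card_codeg_far_le h h.count hab)
  rw [sum_filter]
  have := sum_codegClass_weighted r c a b
    (fun k : ℕ => if ¬ |(k : ℝ) - ν ^ 20 / 4| ≤ ν ^ 13 then 1 else 0)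
  simp only [mul_ite, mul_one, mul_zero] at this
  rw [this, ← sum_filter, sum_const, nsmul_eq_mul, mul_one]
  simp only [not_le]

lemma card_biClass_move_ratio {ν : ℝ} {r : V → ℕ} {c c' : W → ℕ} (h : Near ν r c)
    (h' : Near ν r c') {a b : W} (hab : a ≠ b) (ha : c' a + 1 = c a) (hb : c' b = c b + 1)
    (hc : ∀ w, w ≠ a → w ≠ b → c' w = c w) :
    |((biClass r c').card : ℝ) - (biClass r c).card *
      (1 + ((c a : ℝ) - c b - 1) /
        ((c b : ℝ) + 1 - (((c a : ℝ) + c b) / 2 - (Fintype.card V : ℝ) / 4)))| ≤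
      (ν ^ 60)⁻¹ * (biClass r c').card + (4 * ν ^ 22)⁻¹ * (biClass r c).card := by
  have hν := h.large
  have hpos : 0 < ν := by linarith
  have p20 : 0 < ν ^ 20 := by positivity
  have hmu := h.card_le
  have hml := h.le_card
  have hmV := abs_le.1 h.cardV
  have hca := abs_le.1 (h.col a)
  have hcb := abs_le.1 (h.col b)
  have e13 := mul_pow_le_pow_of_lt hν (show 11 < 13 by norm_num)
  have e11 := mul_pow_le_pow_of_lt hν (show 0 < 11 by norm_num)
  rw [pow_zero] at e11
  have e20 := mul_pow_le_pow_of_lt hν (show 13 < 20 by norm_num)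
  have hS := sum_codeg_near h hab.symm
  rw [← sum_codegClass_weighted r c a b
    (fun k : ℕ => (k : ℝ) - (((c a : ℝ) + c b) / 2 - (Fintype.card V : ℝ) / 4))] at hS
  have hN' : ∑ k ∈ range (Fintype.card V + 1), ((codegClass r c' a b k).card : ℝ) =
      ((biClass r c').card : ℝ) := by
    rw [← Nat.cast_sum, sum_card_codegClass]
  have hN : ∑ k ∈ range (Fintype.card V + 1), ((codegClass r c a b k).card : ℝ) =
      ((biClass r c).card : ℝ) := by
    rw [← Nat.cast_sum, sum_card_codegClass]
  have hfar := sum_codegClass_far h hab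
  have hfar' := sum_codegClass_far h' hab
  set N : ℝ := ((biClass r c).card : ℝ) with hNd
  set N' : ℝ := ((biClass r c').card : ℝ) with hNd'
  have hN0 : 0 ≤ N := Nat.cast_nonneg _
  have hN'0 : 0 ≤ N' := Nat.cast_nonneg _
  set m : ℝ := (Fintype.card V : ℝ) with hm
  set k₀ : ℝ := ((c a : ℝ) + c b) / 2 - m / 4 with hk₀
  set g : ℝ := (c a : ℝ) - c b - 1 with hg
  set y : ℝ := (c b : ℝ) + 1 - k₀ with hy
  set K := range (Fintype.card V + 1) with hK
  set P : ℕ → Prop := fun k : ℕ => |(k : ℝ) - ν ^ 20 / 4| ≤ ν ^ 13 with hP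
  have hyl : ν ^ 20 / 5 ≤ y := by rw [hy, hk₀]; linarith
  have hy0 : 0 < y := by linarith
  have hga : |g| ≤ 3 * ν ^ 11 := by
    rw [hg, abs_le]; constructor <;> linarith
  have hgy : |g / y ^ 2| ≤ 75 * (ν ^ 29)⁻¹ := by
    rw [abs_div, abs_of_pos (by positivity : 0 < y ^ 2), div_le_iff₀ (by positivity)]
    calc |g| ≤ 3 * ν ^ 11 := hga
      _ = 75 * (ν ^ 29)⁻¹ * (ν ^ 20 / 5) ^ 2 := by field_simp; ring
      _ ≤ _ := by gcongr
  have hterm : ∀ k ∈ K.filter P, |((codegClass r c' a b k).card : ℝ) -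
      ((codegClass r c a b k).card : ℝ) * (1 + g / y + g / y ^ 2 * ((k : ℝ) - k₀))| ≤
      (100 * ν ^ 22)⁻¹ * ((codegClass r c a b k).card : ℝ) := by
    intro k hk
    have hk' := abs_le.1 (mem_filter.1 hk).2
    have h3 := congrArg (Nat.cast (R := ℝ)) (card_codegClass_move r c c' hab ha hb hc k)
    have hka : k ≤ c a := by
      have : (k : ℝ) ≤ c a := by linarith
      exact_mod_cast this
    have hkb : k ≤ c b + 1 := by
      have : (k : ℝ) ≤ (c b : ℝ) + 1 := by linarith
      exact_mod_cast this
    push_cast [Nat.cast_sub hka, Nat.cast_sub hkb] at h3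
    set δ : ℝ := (k : ℝ) - k₀ with hδ
    have hδa : |δ| ≤ 2 * ν ^ 13 := by
      rw [hδ, hk₀, abs_le]; constructor <;> linarith
    have hδ' := abs_le.1 hδa
    have hyδ : (c b : ℝ) + 1 - k = y - δ := by rw [hy, hδ]; ring
    have hyδ0 : ν ^ 20 / 6 ≤ y - δ := by linarith
    have hyδ1 : 0 < y - δ := by linarith
    have hx : (c a : ℝ) - k = y - δ + g := by rw [hy, hδ, hg]; ring
    rw [hyδ, hx] at h3
    have h4 : ((codegClass r c' a b k).card : ℝ) =
        ((codegClass r c a b k).card : ℝ) * ((y - δ + g) / (y - δ)) := by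
      rw [← mul_div_assoc, eq_div_iff hyδ1.ne', h3]
    rw [h4, ← mul_sub, abs_mul, abs_of_nonneg (Nat.cast_nonneg _ : (0 : ℝ) ≤ _), mul_comm]
    refine mul_le_mul_of_nonneg_right ?_ (Nat.cast_nonneg _)
    have e : (y - δ + g) / (y - δ) - (1 + g / y + g / y ^ 2 * δ) =
        g / y ^ 2 * (δ ^ 2 / (y - δ)) := by
      field_simp
      ring
    rw [e, abs_mul]
    have h5 : |δ ^ 2 / (y - δ)| ≤ 24 * ν ^ 6 := by
      rw [abs_of_nonneg (by positivity), div_le_iff₀ hyδ1, ← sq_abs]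
      calc |δ| ^ 2 ≤ (2 * ν ^ 13) ^ 2 := by gcongr
        _ = 24 * ν ^ 6 * (ν ^ 20 / 6) := by ring
        _ ≤ _ := by gcongr
    calc |g / y ^ 2| * |δ ^ 2 / (y - δ)| ≤ (75 * (ν ^ 29)⁻¹) * (24 * ν ^ 6) :=
          mul_le_mul hgy h5 (abs_nonneg _) (by positivity)
      _ = 180000 / ν * (100 * ν ^ 22)⁻¹ := by field_simp; ring
      _ ≤ 1 * (100 * ν ^ 22)⁻¹ := by
        gcongr
        rw [div_le_one hpos]
        linarith
      _ = _ := one_mul _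
  have hsumT : |∑ k ∈ K.filter P, (((codegClass r c' a b k).card : ℝ) -
      ((codegClass r c a b k).card : ℝ) * (1 + g / y + g / y ^ 2 * ((k : ℝ) - k₀)))| ≤
      (100 * ν ^ 22)⁻¹ * N := by
    refine (abs_sum_le_sum_abs _ _).trans ((sum_le_sum hterm).trans ?_)
    rw [← mul_sum, ← hN]
    gcongr
    exact filter_subset _ _
  have hbadδ : |∑ k ∈ K.filter (fun k => ¬ P k), ((codegClass r c a b k).card : ℝ) *
      (1 + g / y + g / y ^ 2 * ((k : ℝ) - k₀))| ≤ ν ^ 21 * ((ν ^ 60)⁻¹ * N) := by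
    refine (abs_sum_le_sum_abs _ _).trans ?_
    have : ∀ k ∈ K.filter (fun k => ¬ P k), |((codegClass r c a b k).card : ℝ) *
        (1 + g / y + g / y ^ 2 * ((k : ℝ) - k₀))| ≤ ν ^ 21 * ((codegClass r c a b k).card : ℝ) := by
      intro k hk
      have hkm : (k : ℝ) ≤ m := by
        rw [hm]
        exact Nat.cast_le.2 (Nat.lt_succ_iff.1 (mem_range.1 (mem_filter.1 hk).1))
      have hk0 : (0 : ℝ) ≤ k := Nat.cast_nonneg _
      rw [abs_mul, abs_of_nonneg (Nat.cast_nonneg _ : (0 : ℝ) ≤ _), mul_comm]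
      refine mul_le_mul_of_nonneg_right ?_ (Nat.cast_nonneg _)
      have h1 : |g / y| ≤ 1 := by
        rw [abs_div, abs_of_pos hy0, div_le_one hy0]
        linarith
      have h2 : |g / y ^ 2| ≤ 1 := by
        refine hgy.trans ?_
        rw [← div_eq_mul_inv, div_le_one (by positivity)]
        have := mul_pow_le_pow_of_lt hν (show 0 < 29 by norm_num)
        linarith
      have h3 : |(k : ℝ) - k₀| ≤ 2 * ν ^ 20 := by
        rw [hk₀, abs_le]; constructor <;> linarith
      have h4 : |g / y ^ 2 * ((k : ℝ) - k₀)| ≤ 1 * (2 * ν ^ 20) := by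
        rw [abs_mul]
        exact mul_le_mul h2 h3 (abs_nonneg _) (by norm_num)
      have e21 := mul_pow_le_pow_of_lt hν (show 20 < 21 by norm_num)
      have h5 : |1 + g / y + g / y ^ 2 * ((k : ℝ) - k₀)| ≤ 1 + |g / y| +
          |g / y ^ 2 * ((k : ℝ) - k₀)| := by
        refine (abs_add_le _ _).trans (add_le_add ((abs_add_le _ _).trans ?_) le_rfl)
        rw [abs_one]
      linarith
    refine (sum_le_sum this).trans ?_
    rw [← mul_sum]
    exact mul_le_mul_of_nonneg_left hfar (by positivity)
  have htot : ∑ k ∈ K, ((codegClass r c a b k).card : ℝ) *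
      (1 + g / y + g / y ^ 2 * ((k : ℝ) - k₀)) = N * (1 + g / y) +
      g / y ^ 2 * ∑ k ∈ K, ((codegClass r c a b k).card : ℝ) * ((k : ℝ) - k₀) := by
    rw [← hN, sum_mul, mul_sum, ← sum_add_distrib]
    refine sum_congr rfl fun k _ => ?_
    ring
  have hlin : |g / y ^ 2 * ∑ k ∈ K, ((codegClass r c a b k).card : ℝ) * ((k : ℝ) - k₀)| ≤
      (100 * ν ^ 22)⁻¹ * N := by
    rw [abs_mul]
    calc _ ≤ (75 * (ν ^ 29)⁻¹) * (ν ^ 6 * N) := mul_le_mul hgy hS (abs_nonneg _) (by positivity)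
      _ = 7500 / ν * ((100 * ν ^ 22)⁻¹ * N) := by field_simp; ring
      _ ≤ _ := by
        refine mul_le_of_le_one_left (by positivity) ?_
        rw [div_le_one hpos]
        linarith
  have hb1 : ν ^ 21 * ((ν ^ 60)⁻¹ * N) ≤ (100 * ν ^ 22)⁻¹ * N := by
    have : ν ^ 21 * ((ν ^ 60)⁻¹ * N) = 100 / ν ^ 17 * ((100 * ν ^ 22)⁻¹ * N) := by field_simp
    rw [this]
    refine mul_le_of_le_one_left (by positivity) ?_
    rw [div_le_one (by positivity)]
    have := mul_pow_le_pow_of_lt hν (show 0 < 17 by norm_num)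
    linarith
  have hfar'0 : 0 ≤ ∑ k ∈ K.filter (fun k => ¬ P k), ((codegClass r c' a b k).card : ℝ) :=
    sum_nonneg fun _ _ => Nat.cast_nonneg _
  rw [← sum_filter_add_sum_filter_not K P] at hN' htot
  rw [sum_sub_distrib] at hsumT
  have hsplit : (4 * ν ^ 22)⁻¹ * N = 25 * ((100 * ν ^ 22)⁻¹ * N) := by field_simp; ring
  have hnn : 0 ≤ (100 * ν ^ 22)⁻¹ * N := by positivity
  have a1 := abs_le.1 hsumT
  have a2 := abs_le.1 hbadδ
  have a3 := abs_le.1 hlin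
  rw [hsplit, abs_le]
  constructor <;> linarith

/-- Moving one unit between two columns changes the number of graphs by an explicit factor. -/
lemma abs_log_card_move_le {ν : ℝ} {r : V → ℕ} {c c' : W → ℕ} (h : Near ν r c)
    (h' : Near ν r c') {a b : W} (hab : a ≠ b) (ha : c' a + 1 = c a) (hb : c' b = c b + 1)
    (hc : ∀ w, w ≠ a → w ≠ b → c' w = c w) :
    |Real.log ((biClass r c').card : ℝ) - Real.log ((biClass r c).card : ℝ) -
      4 * ((c a : ℝ) - c b - 1) / (Fintype.card V : ℝ)| ≤ 8 * (ν ^ 22)⁻¹ := by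
  have hν := h.large
  have hpos : 0 < ν := by linarith
  have p20 : 0 < ν ^ 20 := by positivity
  have hml := h.le_card
  have hca := abs_le.1 (h.col a)
  have hcb := abs_le.1 (h.col b)
  have e11 := mul_pow_le_pow_of_lt hν (show 0 < 11 by norm_num)
  rw [pow_zero] at e11
  have key := card_biClass_move_ratio h h' hab ha hb hc
  have hN := h.card_pos
  have hN' := h'.card_pos
  set N : ℝ := ((biClass r c).card : ℝ) with hNd
  set N' : ℝ := ((biClass r c').card : ℝ) with hNd'
  set m : ℝ := (Fintype.card V : ℝ) with hm
  have hm0 : 0 < m := by linarith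
  set g : ℝ := (c a : ℝ) - c b - 1 with hg
  set x : ℝ := 4 * g / m with hx
  have hxa : |x| ≤ 13 * (ν ^ 9)⁻¹ := by
    rw [hx, abs_div, abs_of_pos hm0, div_le_iff₀ hm0]
    have : |4 * g| ≤ 12.8 * ν ^ 11 := by
      rw [hg, abs_le]; constructor <;> linarith
    calc |4 * g| ≤ 12.8 * ν ^ 11 := this
      _ ≤ 13 * (ν ^ 9)⁻¹ * (0.99 * ν ^ 20) := by
        have : 13 * (ν ^ 9)⁻¹ * (0.99 * ν ^ 20) = 12.87 * ν ^ 11 := by field_simp; norm_num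
        rw [this]
        have : 0 < ν ^ 11 := by positivity
        linarith
      _ ≤ _ := by gcongr
  have hinv : ∀ k : ℕ, 0 < (ν ^ k)⁻¹ := fun k => by positivity
  have hdec : ∀ {k l : ℕ}, k < l → 10 ^ 6 * (ν ^ l)⁻¹ ≤ (ν ^ k)⁻¹ := by
    intro k l hkl
    rw [← div_eq_mul_inv, div_le_iff₀ (by positivity), ← div_eq_inv_mul, le_div_iff₀ (by positivity)]
    exact mul_pow_le_pow_of_lt hν hkl
  have d9 := hdec (show 0 < 9 by norm_num)
  rw [pow_zero, inv_one] at d9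
  have hε : 2 / m ≤ 3 * (ν ^ 20)⁻¹ := by
    rw [div_le_iff₀ hm0]
    calc (2 : ℝ) ≤ 3 * (ν ^ 20)⁻¹ * (0.99 * ν ^ 20) := by
          have : 3 * (ν ^ 20)⁻¹ * (0.99 * ν ^ 20) = 2.97 := by field_simp; norm_num
          rw [this]; norm_num
      _ ≤ _ := by gcongr
  have d20 := hdec (show 0 < 20 by norm_num)
  rw [pow_zero, inv_one] at d20
  have hr := abs_ratio_sub_exp_le (x := x) (ε := 2 / m) (by linarith) (by positivity)
  have hr2 : 4 * |x| * (2 / m) + 2 * |x| ^ 3 ≤ (4 * ν ^ 22)⁻¹ := by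
    have h1 : 4 * |x| * (2 / m) ≤ 4 * (13 * (ν ^ 9)⁻¹) * (3 * (ν ^ 20)⁻¹) := by gcongr
    have h2 : 2 * |x| ^ 3 ≤ 2 * (13 * (ν ^ 9)⁻¹) ^ 3 := by gcongr
    have e1 : 4 * (13 * (ν ^ 9)⁻¹) * (3 * (ν ^ 20)⁻¹) = 156 * (ν ^ 29)⁻¹ := by field_simp; ring
    have e2 : 2 * (13 * (ν ^ 9)⁻¹) ^ 3 = 4394 * (ν ^ 27)⁻¹ := by field_simp; ring
    have e3 : (4 * ν ^ 22)⁻¹ = (ν ^ 22)⁻¹ / 4 := by rw [mul_inv]; ring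
    have d1 := hdec (show 22 < 29 by norm_num)
    have d2 := hdec (show 22 < 27 by norm_num)
    have := hinv 29
    have := hinv 27
    rw [e1] at h1
    rw [e2] at h2
    rw [e3]
    linarith
  have hden : g / ((c b : ℝ) + 1 - (((c a : ℝ) + c b) / 2 - m / 4)) = x / (1 + 2 / m - x / 2) := by
    have hy : (c b : ℝ) + 1 - (((c a : ℝ) + c b) / 2 - m / 4) = m / 4 * (1 + 2 / m - x / 2) := by
      rw [hx, hg]; field_simp; ring
    have hx' := abs_le.1 hxa
    have hm2 : 0 < 2 / m := by positivity
    have hne : 1 + 2 / m - x / 2 ≠ 0 := by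
      have : 0 < 1 + 2 / m - x / 2 := by linarith
      exact this.ne'
    rw [hy, div_eq_div_iff (mul_ne_zero (by positivity) hne) hne]
    rw [hx]; field_simp
  rw [hden] at key
  set ρ : ℝ := 1 + x / (1 + 2 / m - x / 2) with hρ
  have hx' := abs_le.1 hxa
  have hex1 : Real.exp x ≤ 2 := by
    have := Real.exp_bound_div_one_sub_of_interval' (x := 1/2) (by norm_num) (by norm_num)
    calc Real.exp x ≤ Real.exp (1 / 2) := Real.exp_le_exp.2 (by linarith)
      _ ≤ 2 := by norm_num at this ⊢; linarith
  have hex0 : 1 / 2 ≤ Real.exp x := by linarith [Real.add_one_le_exp x]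
  have hρe := abs_le.1 (hr.trans hr2)
  have d60 := hdec (show 22 < 60 by norm_num)
  have e3 : (4 * ν ^ 22)⁻¹ = (ν ^ 22)⁻¹ / 4 := by rw [mul_inv]; ring
  rw [e3] at key hρe
  have d22 := hdec (show 0 < 22 by norm_num)
  rw [pow_zero, inv_one] at d22
  have key' := abs_le.1 key
  have i22 := hinv 22
  have i60 := hinv 60
  have hN'up : N' ≤ 6 * N := by
    have : (ν ^ 60)⁻¹ * N' ≤ 1 / 4 * N' := by gcongr; linarith
    have : N * ρ ≤ N * (9 / 4) := by gcongr; linarith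
    have : (ν ^ 22)⁻¹ / 4 * N ≤ 1 * N := by gcongr; linarith
    linarith
  have hfin : |N' - N * Real.exp x| ≤ 2 * (ν ^ 22)⁻¹ * (N * Real.exp x) := by
    have b1 : (ν ^ 60)⁻¹ * N' ≤ (ν ^ 22)⁻¹ / 100 * N := by
      calc (ν ^ 60)⁻¹ * N' ≤ (ν ^ 60)⁻¹ * (6 * N) := by gcongr
        _ = 6 * (ν ^ 60)⁻¹ * N := by ring
        _ ≤ _ := by gcongr; linarith
    have b2 : |N * ρ - N * Real.exp x| ≤ (ν ^ 22)⁻¹ / 4 * N := by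
      rw [← mul_sub, abs_mul, abs_of_pos hN, mul_comm]
      exact mul_le_mul_of_nonneg_right (abs_le.2 hρe) hN.le
    have b2' := abs_le.1 b2
    have b3 : (ν ^ 22)⁻¹ * N ≤ 2 * (ν ^ 22)⁻¹ * (N * Real.exp x) := by
      calc (ν ^ 22)⁻¹ * N = 2 * (ν ^ 22)⁻¹ * (N * (1 / 2)) := by ring
        _ ≤ _ := by gcongr
    have : 0 ≤ (ν ^ 22)⁻¹ * N := by positivity
    rw [abs_le]
    constructor <;> linarith
  have hNe : 0 < N * Real.exp x := by positivity
  have hq : |N' / (N * Real.exp x) - 1| ≤ 2 * (ν ^ 22)⁻¹ := by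
    rw [div_sub_one hNe.ne', abs_div, abs_of_pos hNe, div_le_iff₀ hNe]
    exact hfin
  have hl := abs_log_le_of_abs_sub_one_le hq (by linarith)
  rw [Real.log_div hN'.ne' hNe.ne', Real.log_mul hN.ne' (Real.exp_pos _).ne', Real.log_exp,
    ← sub_sub] at hl
  linarith

end Ratio

section RowRemoval

variable {V W : Type*} [Fintype V] [Fintype W] [DecidableEq V] [DecidableEq W]

/-- Column degrees left after deleting a row with neighbourhood `T`. -/
def residualDeg (c : W → ℕ) (T : Finset W) (w : W) : ℕ := c w - if w ∈ T then 1 else 0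

/-- Weighted count of the subsets of `S` of size `j`. -/
noncomputable def expSum (x : W → ℝ) (S : Finset W) (j : ℕ) : ℝ :=
  ∑ T ∈ S.powersetCard j, Real.exp (∑ w ∈ T, x w)

lemma card_nbhd_eq (r : V → ℕ) (c : W → ℕ) (hc : ∀ w, 1 ≤ c w) (u : V) {T : Finset W}
    (hT : T.card = r u) :
    ((biClass r c).filter fun E => (univ.filter fun w => E u w = true) = T).card =
      (biClass (fun v : {v : V // v ≠ u} => r v) (residualDeg c T)).card := by
  have hcol : ∀ (E : V → W → Bool) (w : W), colDeg E w =
      (if E u w = true then 1 else 0) + colDeg (fun (v : {v : V // v ≠ u}) w => E v w) w := by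
    intro E w
    rw [colDeg, colDeg, card_filter, card_filter]
    exact Fintype.sum_eq_add_sum_subtype_ne (fun v => if E v w = true then 1 else 0) u
  refine card_nbij' (fun E (v : {v : V // v ≠ u}) w => E v w)
    (fun E v w => if h : v = u then decide (w ∈ T) else E ⟨v, h⟩ w) ?_ ?_ ?_ ?_
  · intro E hE
    rw [mem_coe, mem_filter] at hE
    obtain ⟨hE, hET⟩ := hE
    obtain ⟨hr, hcE⟩ := (mem_filter.1 hE).2
    refine mem_coe.2 (mem_filter.2 ⟨mem_univ _, fun v => hr v, fun w => ?_⟩)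
    have h1 := hcol E w
    rw [hcE w] at h1
    have h2 : w ∈ T ↔ E u w = true := by rw [← hET]; simp
    simp only [residualDeg, h2]
    omega
  · intro E hE
    obtain ⟨hr, hcE⟩ := (mem_filter.1 (mem_coe.1 hE)).2
    refine mem_coe.2 (mem_filter.2 ⟨mem_filter.2 ⟨mem_univ _, fun v => ?_, fun w => ?_⟩, ?_⟩)
    · by_cases hv : v = u
      · subst hv
        simp [rowDeg, hT]
      · have := hr ⟨v, hv⟩
        simpa [rowDeg, hv] using this
    · rw [hcol]
      have h1 : colDeg (fun (v : {v : V // v ≠ u}) w =>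
          if h : (v : V) = u then decide (w ∈ T) else E ⟨v, h⟩ w) w = colDeg E w := by
        simp only [colDeg]
        congr 1
        ext v
        simp [v.2]
      rw [h1, hcE w]
      have := hc w
      simp only [residualDeg, dif_pos, decide_eq_true_eq]
      split_ifs <;> omega
    · ext w
      simp
  · intro E hE
    rw [mem_coe, mem_filter] at hE
    funext v w
    by_cases hv : v = u
    · subst hv
      have h2 : w ∈ T ↔ E v w = true := by rw [← hE.2]; simp
      simp [h2]
    · simp [hv]
  · intro E _
    funext v w
    simp [v.2]

/-- A function of sets that changes little under swaps is nearly constant on sets of equal size. -/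
lemma abs_sub_le_of_swap {f : Finset W → ℝ} {ε : ℝ} {d : ℕ}
    (hf : ∀ T : Finset W, T.card = d → ∀ b ∈ T, ∀ a ∉ T, |f (insert a (T.erase b)) - f T| ≤ ε)
    {T T' : Finset W} (hT : T.card = d) (hT' : T'.card = d) :
    |f T' - f T| ≤ (T \ T').card * ε := by
  induction hk : (T \ T').card generalizing T with
  | zero =>
    have h1 : T ⊆ T' := by rw [← sdiff_eq_empty_iff_subset, ← card_eq_zero, hk]
    rw [eq_of_subset_of_card_le h1 (by omega)]
    simp
  | succ k ih =>
    obtain ⟨b, hb⟩ : (T \ T').Nonempty := card_pos.1 (by omega)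
    have hcard : (T' \ T).card = (T \ T').card := by
      have h1 := card_sdiff_add_card_inter T T'
      have h2 := card_sdiff_add_card_inter T' T
      rw [inter_comm] at h2
      omega
    obtain ⟨a, ha⟩ : (T' \ T).Nonempty := card_pos.1 (by omega)
    rw [mem_sdiff] at ha hb
    have hne : a ≠ b := fun h => hb.2 (h ▸ ha.1)
    have hU : (insert a (T.erase b)).card = d := by
      rw [card_insert_of_notMem (fun h => ha.2 (mem_of_mem_erase h)), card_erase_of_mem hb.1]
      have := card_pos.2 ⟨b, hb.1⟩
      omega
    have hUd : (insert a (T.erase b) \ T').card = k := by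
      have : insert a (T.erase b) \ T' = (T \ T').erase b := by
        ext w
        simp only [mem_sdiff, mem_insert, mem_erase]
        constructor
        · rintro ⟨rfl | ⟨h1, h2⟩, h3⟩
          · exact absurd ha.1 h3
          · exact ⟨h1, h2, h3⟩
        · rintro ⟨h1, h2, h3⟩
          exact ⟨Or.inr ⟨h1, h2⟩, h3⟩
      rw [this, card_erase_of_mem (mem_sdiff.2 hb), hk]
      rfl
    have h1 := ih hU hUd
    have h2 := hf T hT b hb.1 a ha.2
    calc |f T' - f T| ≤ |f T' - f (insert a (T.erase b))| + |f (insert a (T.erase b)) - f T| :=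
          abs_sub_le _ _ _
      _ ≤ k * ε + ε := add_le_add h1 h2
      _ = _ := by push_cast; ring

/-- The number of completions of a neighbourhood is nearly proportional to an exponential. -/
lemma abs_log_card_residual_sub_le {ν : ℝ} {r : V → ℕ} {c : W → ℕ} {d : ℕ} (hc : ∀ w, 1 ≤ c w)
    (hnear : ∀ T : Finset W, T.card = d → Near ν r (residualDeg c T)) {T T' : Finset W}
    (hT : T.card = d) (hT' : T'.card = d) :
    |(Real.log ((biClass r (residualDeg c T')).card : ℝ) -
        ∑ w ∈ T', 4 / (Fintype.card V : ℝ) * (c w : ℝ)) -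
      (Real.log ((biClass r (residualDeg c T)).card : ℝ) -
        ∑ w ∈ T, 4 / (Fintype.card V : ℝ) * (c w : ℝ))| ≤ 8 * (ν ^ 2)⁻¹ := by
  have hpos : 0 < ν := by linarith [(hnear T hT).large]
  have h1 := abs_sub_le_of_swap (ε := 8 * (ν ^ 22)⁻¹) (d := d)
    (f := fun T => Real.log ((biClass r (residualDeg c T)).card : ℝ) -
        ∑ w ∈ T, 4 / (Fintype.card V : ℝ) * (c w : ℝ)) ?_ hT hT'
  · refine h1.trans ?_
    have h2 : ((T \ T').card : ℝ) ≤ ν ^ 20 := by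
      rw [← (hnear T hT).cardW]
      exact Nat.cast_le.2 (card_le_univ _)
    calc ((T \ T').card : ℝ) * (8 * (ν ^ 22)⁻¹) ≤ ν ^ 20 * (8 * (ν ^ 22)⁻¹) := by gcongr
      _ = _ := by field_simp
  · intro T hT b hb a ha
    have hne : a ≠ b := fun h => ha (h ▸ hb)
    have hU : (insert a (T.erase b)).card = d := by
      rw [card_insert_of_notMem (fun h => ha (mem_of_mem_erase h)), card_erase_of_mem hb]
      have := card_pos.2 ⟨b, hb⟩
      omega
    have ca := hc a
    have cb := hc b
    have key := abs_log_card_move_le (hnear T hT) (hnear _ hU) hne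
      (by simp [residualDeg, ha]; omega) (by simp [residualDeg, hb, hne.symm]; omega) (by
        intro w hwa hwb
        simp [residualDeg, hwa, hwb])
    have e1 : ((residualDeg c T a : ℕ) : ℝ) - (residualDeg c T b : ℕ) - 1 = (c a : ℝ) - c b := by
      simp [residualDeg, ha, hb, Nat.cast_sub cb]
      ring
    rw [e1] at key
    have e2 : ∑ w ∈ insert a (T.erase b), 4 / (Fintype.card V : ℝ) * (c w : ℝ) =
        ∑ w ∈ T, 4 / (Fintype.card V : ℝ) * (c w : ℝ) +
          4 * ((c a : ℝ) - c b) / (Fintype.card V : ℝ) := by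
      rw [sum_insert (fun h => ha (mem_of_mem_erase h)), ← add_sum_erase _ _ hb]
      ring
    rw [e2]
    refine le_trans (le_of_eq ?_) key
    congr 1
    ring

lemma sum_powersetCard_filter (x : W → ℝ) (S : Finset W) {d t : ℕ} (ht : t ≤ d) :
    ∑ T ∈ ((univ : Finset W).powersetCard d).filter (fun T => (S ∩ T).card = t),
      Real.exp (∑ w ∈ T, x w) = expSum x S t * expSum x Sᶜ (d - t) := by
  rw [expSum, expSum, sum_mul_sum, ← sum_product']
  refine sum_nbij' (fun T => (S ∩ T, Sᶜ ∩ T)) (fun p => p.1 ∪ p.2) ?_ ?_ ?_ ?_ ?_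
  · intro T hT
    rw [mem_filter, mem_powersetCard] at hT
    have h1 : (S ∩ T).card + (Sᶜ ∩ T).card = T.card := by
      rw [← card_union_of_disjoint, ← union_inter_distrib_right, union_compl, univ_inter]
      exact (show Disjoint S Sᶜ from disjoint_compl_right).mono inter_subset_left inter_subset_left
    refine mem_product.2 ⟨mem_powersetCard.2 ⟨inter_subset_left, hT.2⟩,
      mem_powersetCard.2 ⟨inter_subset_left, ?_⟩⟩
    dsimp only
    omega
  · rintro ⟨A, B⟩ hp
    rw [mem_product, mem_powersetCard, mem_powersetCard] at hp
    obtain ⟨⟨hA, hAc⟩, hB, hBc⟩ := hp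
    have hd : Disjoint A B := (show Disjoint S Sᶜ from disjoint_compl_right).mono hA hB
    have hSB : S ∩ B = ∅ := disjoint_iff_inter_eq_empty.1 ((show Disjoint S Sᶜ from disjoint_compl_right).mono_right hB)
    rw [mem_filter, mem_powersetCard]
    refine ⟨⟨subset_univ _, ?_⟩, ?_⟩
    · rw [card_union_of_disjoint hd]
      dsimp only at hAc hBc ⊢
      omega
    · dsimp only
      rw [inter_union_distrib_left, hSB, union_empty, inter_eq_right.2 hA]
      exact hAc
  · intro T _
    dsimp only
    rw [← union_inter_distrib_right, union_compl, univ_inter]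
  · rintro ⟨A, B⟩ hp
    rw [mem_product, mem_powersetCard, mem_powersetCard] at hp
    obtain ⟨⟨hA, hAc⟩, hB, hBc⟩ := hp
    dsimp only at hA hB ⊢
    have hSB : S ∩ B = ∅ := disjoint_iff_inter_eq_empty.1 ((show Disjoint S Sᶜ from disjoint_compl_right).mono_right hB)
    have hSA : Sᶜ ∩ A = ∅ := disjoint_iff_inter_eq_empty.1 ((show Disjoint Sᶜ S from disjoint_compl_left).mono_right hA)
    rw [inter_union_distrib_left, inter_union_distrib_left, hSB, hSA, union_empty, empty_union,
      inter_eq_right.2 hA, inter_eq_right.2 hB]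
  · intro T _
    dsimp only
    rw [← Real.exp_add, ← sum_union, ← union_inter_distrib_right, union_compl, univ_inter]
    exact (show Disjoint S Sᶜ from disjoint_compl_right).mono inter_subset_left inter_subset_left

lemma expSum_nonneg (x : W → ℝ) (S : Finset W) (j : ℕ) : 0 ≤ expSum x S j :=
  sum_nonneg fun _ _ => (Real.exp_pos _).le

lemma expSum_pos (x : W → ℝ) {S : Finset W} {j : ℕ} (hj : j ≤ S.card) : 0 < expSum x S j :=
  sum_pos (fun _ _ => Real.exp_pos _) (powersetCard_nonempty.2 hj)

lemma card_filter_row_eq_sum (r : V → ℕ) (c : W → ℕ) (hc : ∀ w, 1 ≤ c w) (u : V)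
    (P : Finset W → Prop) [DecidablePred P] :
    ((biClass r c).filter fun E => P (univ.filter fun w => E u w = true)).card =
      ∑ T ∈ ((univ : Finset W).powersetCard (r u)).filter P,
        (biClass (fun v : {v : V // v ≠ u} => r v) (residualDeg c T)).card := by
  rw [card_eq_sum_card_fiberwise (f := fun E => univ.filter fun w => E u w = true)
    (t := ((univ : Finset W).powersetCard (r u)).filter P)]
  · refine sum_congr rfl fun T hT => ?_
    rw [mem_filter, mem_powersetCard] at hT
    rw [← card_nbhd_eq r c hc u hT.1.2, filter_filter]
    congr 1
    ext E
    simp only [mem_filter]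
    constructor
    · rintro ⟨h1, -, h2⟩
      exact ⟨h1, h2⟩
    · rintro ⟨h1, h2⟩
      refine ⟨h1, ?_, h2⟩
      rw [h2]
      exact hT.2
  · intro E hE
    rw [mem_coe, mem_filter] at hE
    refine mem_coe.2 (mem_filter.2 ⟨mem_powersetCard.2 ⟨subset_univ _, ?_⟩, hE.2⟩)
    exact (mem_filter.1 hE.1).2.1 u

/-- The distribution of the degree of `u` into `S` is nearly that of an exponentially tilted
random set. -/
lemma prob_row_near {ν : ℝ} {r : V → ℕ} {c : W → ℕ} (u : V) (hc : ∀ w, 1 ≤ c w)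
    (hu : r u ≤ Fintype.card W)
    (hnear : ∀ T : Finset W, T.card = r u →
      Near ν (fun v : {v : V // v ≠ u} => r v) (residualDeg c T))
    {x : W → ℝ} (hx : ∀ w, x w = 4 / (Fintype.card {v : V // v ≠ u} : ℝ) * (c w : ℝ))
    (S : Finset W) {t : ℕ} (ht : t ≤ r u) :
    0 < (biClass r c).card ∧
    (((biClass r c).filter fun E => (S.filter fun w => E u w = true).card = t).card : ℝ) /
        ((biClass r c).card : ℝ) ≤
      Real.exp (16 * (ν ^ 2)⁻¹) *
        (expSum x S t * expSum x Sᶜ (r u - t) / expSum x univ (r u)) ∧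
    Real.exp (-(16 * (ν ^ 2)⁻¹)) *
        (expSum x S t * expSum x Sᶜ (r u - t) / expSum x univ (r u)) ≤
      (((biClass r c).filter fun E => (S.filter fun w => E u w = true).card = t).card : ℝ) /
        ((biClass r c).card : ℝ) := by
  obtain ⟨T₀, -, hT₀⟩ := exists_subset_card_eq (s := (univ : Finset W)) (n := r u) hu
  set η : ℝ := 8 * (ν ^ 2)⁻¹ with hη
  set A : ℝ := Real.exp (Real.log ((biClass (fun v : {v : V // v ≠ u} => r v)
    (residualDeg c T₀)).card : ℝ) - ∑ w ∈ T₀, x w) with hA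
  have hA0 : 0 < A := Real.exp_pos _
  have hT : ∀ T : Finset W, T.card = r u →
      A * Real.exp (-η) * Real.exp (∑ w ∈ T, x w) ≤
        ((biClass (fun v : {v : V // v ≠ u} => r v) (residualDeg c T)).card : ℝ) ∧
      ((biClass (fun v : {v : V // v ≠ u} => r v) (residualDeg c T)).card : ℝ) ≤
        A * Real.exp η * Real.exp (∑ w ∈ T, x w) := by
    intro T hT
    have h1 := abs_le.1 (abs_log_card_residual_sub_le hc hnear hT₀ hT)
    simp only [← hx] at h1
    have h2 : ((biClass (fun v : {v : V // v ≠ u} => r v) (residualDeg c T)).card : ℝ) =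
      Real.exp (Real.log _) := (Real.exp_log (hnear T hT).card_pos).symm
    rw [h2, hA, ← Real.exp_add, ← Real.exp_add, ← Real.exp_add, ← Real.exp_add, Real.exp_le_exp,
      Real.exp_le_exp]
    constructor <;> linarith
  have hsum : ∀ (P : Finset W → Prop) [DecidablePred P],
      A * Real.exp (-η) * ∑ T ∈ ((univ : Finset W).powersetCard (r u)).filter P,
        Real.exp (∑ w ∈ T, x w) ≤
      (((biClass r c).filter fun E => P (univ.filter fun w => E u w = true)).card : ℝ) ∧
      (((biClass r c).filter fun E => P (univ.filter fun w => E u w = true)).card : ℝ) ≤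
      A * Real.exp η * ∑ T ∈ ((univ : Finset W).powersetCard (r u)).filter P,
        Real.exp (∑ w ∈ T, x w) := by
    intro P _
    rw [card_filter_row_eq_sum r c hc u P, mul_sum, mul_sum]
    push_cast
    constructor
    · exact sum_le_sum fun T hT' => (hT T (mem_powersetCard.1 (mem_filter.1 hT').1).2).1
    · exact sum_le_sum fun T hT' => (hT T (mem_powersetCard.1 (mem_filter.1 hT').1).2).2
  have hZ := hsum fun _ => True
  simp only [filter_true] at hZ
  have hQ := hsum fun T => (S ∩ T).card = t
  rw [sum_powersetCard_filter x S ht] at hQ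
  have hcl : ((biClass r c).filter fun E => (S ∩ univ.filter fun w => E u w = true).card = t) =
      (biClass r c).filter fun E => (S.filter fun w => E u w = true).card = t := by
    refine filter_congr fun E _ => ?_
    rw [inter_filter, inter_univ]
  rw [hcl] at hQ
  change A * Real.exp (-η) * expSum x univ (r u) ≤ _ ∧ _ ≤ A * Real.exp η * expSum x univ (r u) at hZ
  set Z := expSum x univ (r u) with hZd
  set Q := expSum x S t * expSum x Sᶜ (r u - t) with hQd
  have hZ0 : 0 < Z := expSum_pos x (by rwa [card_univ])
  have hQ0 : 0 ≤ Q := mul_nonneg (expSum_nonneg _ _ _) (expSum_nonneg _ _ _)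
  have hN : 0 < ((biClass r c).card : ℝ) := lt_of_lt_of_le (by positivity) hZ.1
  have e1 : Real.exp (16 * (ν ^ 2)⁻¹) = Real.exp η * Real.exp η := by
    rw [← Real.exp_add, hη]; congr 1; ring
  have e2 : Real.exp (-(16 * (ν ^ 2)⁻¹)) = Real.exp (-η) * Real.exp (-η) := by
    rw [← Real.exp_add, hη]; congr 1; ring
  have e3 : Real.exp η * Real.exp (-η) = 1 := by rw [← Real.exp_add]; simp
  refine ⟨by exact_mod_cast hN, ?_, ?_⟩
  · rw [div_le_iff₀ hN]
    calc _ ≤ A * Real.exp η * Q := hQ.2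
      _ = Real.exp (16 * (ν ^ 2)⁻¹) * (Q / Z) * (A * Real.exp (-η) * Z) := by
        rw [e1]
        field_simp
        linear_combination (-Q) * e3
      _ ≤ _ := mul_le_mul_of_nonneg_left hZ.1 (by positivity)
  · rw [le_div_iff₀ hN]
    calc _ ≤ Real.exp (-(16 * (ν ^ 2)⁻¹)) * (Q / Z) * (A * Real.exp η * Z) :=
          mul_le_mul_of_nonneg_left hZ.2 (by positivity)
      _ = A * Real.exp (-η) * Q := by
        rw [e2]
        field_simp
        linear_combination Q * e3
      _ ≤ _ := hQ.1

end RowRemoval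

section ExpSum

variable {W : Type*} [Fintype W] [DecidableEq W]

/-- Weighted count of the `j`-subsets of `S` containing `i` but not `k`. -/
noncomputable def sepSum (x : W → ℝ) (S : Finset W) (j : ℕ) (i k : W) : ℝ :=
  ∑ T ∈ (S.powersetCard j).filter (fun T => i ∈ T ∧ k ∉ T), Real.exp (∑ w ∈ T, x w)

lemma sum_map_swap (x : W → ℝ) (T : Finset W) (a b : W) :
    ∑ w ∈ T.map (Equiv.swap a b).toEmbedding, x w = ∑ w ∈ T, x w +
      ((if a ∈ T then x b - x a else 0) + if b ∈ T then x a - x b else 0) := by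
  by_cases hab : a = b
  · subst hab
    simp
  rw [sum_map]
  have h1 : ∀ w ∈ T, x ((Equiv.swap a b).toEmbedding w) =
      x w + ((if w = a then x b - x a else 0) + if w = b then x a - x b else 0) := by
    intro w _
    rw [Equiv.toEmbedding_apply, Equiv.swap_apply_def]
    by_cases h1 : w = a
    · subst h1
      simp [hab]
    · by_cases h2 : w = b
      · subst h2
        simp [h1]
      · simp [h1, h2]
  rw [sum_congr rfl h1, sum_add_distrib, sum_add_distrib, sum_ite_eq', sum_ite_eq']

lemma map_swap_mem {S T : Finset W} {j : ℕ} {a b : W} (ha : a ∈ S) (hb : b ∈ S)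
    (hT : T ∈ S.powersetCard j) : T.map (Equiv.swap a b).toEmbedding ∈ S.powersetCard j := by
  rw [mem_powersetCard] at hT ⊢
  refine ⟨fun w hw => ?_, by rw [card_map, hT.2]⟩
  obtain ⟨v, hv, rfl⟩ := mem_map.1 hw
  rw [Equiv.toEmbedding_apply, Equiv.swap_apply_def]
  split_ifs
  · exact hb
  · exact ha
  · exact hT.1 hv

lemma mem_map_swap {T : Finset W} {a b w : W} :
    w ∈ T.map (Equiv.swap a b).toEmbedding ↔ Equiv.swap a b w ∈ T := by
  rw [mem_map_equiv, Equiv.symm_swap]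

/-- Exchanging the roles of the two marked vertices. -/
lemma sepSum_swap (x : W → ℝ) {S : Finset W} (j : ℕ) {i k : W} (hi : i ∈ S) (hk : k ∈ S) :
    sepSum x S j k i = Real.exp (x k - x i) * sepSum x S j i k := by
  rw [sepSum, sepSum, mul_sum]
  symm
  refine sum_nbij' (fun T => T.map (Equiv.swap i k).toEmbedding)
    (fun T => T.map (Equiv.swap i k).toEmbedding) ?_ ?_ ?_ ?_ ?_
  · intro T hT
    rw [mem_filter] at hT ⊢
    refine ⟨map_swap_mem hi hk hT.1, ?_⟩
    rw [mem_map_swap, mem_map_swap, Equiv.swap_apply_right, Equiv.swap_apply_left]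
    exact hT.2
  · intro T hT
    rw [mem_filter] at hT ⊢
    refine ⟨map_swap_mem hi hk hT.1, ?_⟩
    rw [mem_map_swap, mem_map_swap, Equiv.swap_apply_right, Equiv.swap_apply_left]
    exact hT.2
  · intro T _
    ext w
    rw [mem_map_swap, mem_map_swap, Equiv.swap_apply_self]
  · intro T _
    ext w
    rw [mem_map_swap, mem_map_swap, Equiv.swap_apply_self]
  · intro T hT
    have h := (mem_filter.1 hT).2
    rw [sum_map_swap, if_pos h.1, if_neg h.2, add_zero, ← Real.exp_add]
    congr 1
    ring

lemma sum_le_of_swap {x : W → ℝ} {S : Finset W} {ξ : ℝ} (j : ℕ)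
    (hx : ∀ i ∈ S, ∀ k ∈ S, |x i - x k| ≤ ξ) {a b : W} (ha : a ∈ S) (hb : b ∈ S)
    {P Q : Finset W → Prop} [DecidablePred P] [DecidablePred Q]
    (hPQ : ∀ T, P T → Q (T.map (Equiv.swap a b).toEmbedding)) :
    ∑ T ∈ (S.powersetCard j).filter P, Real.exp (∑ w ∈ T, x w) ≤
      Real.exp ξ * ∑ T ∈ (S.powersetCard j).filter Q, Real.exp (∑ w ∈ T, x w) := by
  have hinj : Function.Injective (fun T : Finset W => T.map (Equiv.swap a b).toEmbedding) :=
    map_injective _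
  have h1 : ∑ T ∈ (S.powersetCard j).filter P, Real.exp (∑ w ∈ T, x w) ≤
      ∑ T ∈ (S.powersetCard j).filter P,
        Real.exp ξ * Real.exp (∑ w ∈ T.map (Equiv.swap a b).toEmbedding, x w) := by
    refine sum_le_sum fun T _ => ?_
    rw [← Real.exp_add, Real.exp_le_exp, sum_map_swap]
    have h := abs_le.1 (hx a ha b hb)
    have h0 : 0 ≤ ξ := (abs_nonneg _).trans (hx a ha b hb)
    split_ifs <;> linarith
  refine h1.trans ?_
  rw [← mul_sum]
  refine mul_le_mul_of_nonneg_left ?_ (Real.exp_pos _).le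
  rw [← sum_image (f := fun T => Real.exp (∑ w ∈ T, x w))
    (g := fun T : Finset W => T.map (Equiv.swap a b).toEmbedding) hinj.injOn]
  refine sum_le_sum_of_subset_of_nonneg ?_ fun _ _ _ => (Real.exp_pos _).le
  intro T hT
  obtain ⟨U, hU, rfl⟩ := mem_image.1 hT
  rw [mem_filter] at hU ⊢
  exact ⟨map_swap_mem ha hb hU.1, hPQ U hU.2⟩

/-- All separated counts are comparable. -/
lemma sepSum_le {x : W → ℝ} {S : Finset W} {ξ : ℝ} (j : ℕ)
    (hx : ∀ i ∈ S, ∀ k ∈ S, |x i - x k| ≤ ξ) {i k i' k' : W} (hi : i ∈ S) (hk : k ∈ S)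
    (hi' : i' ∈ S) (hk' : k' ∈ S) (hik : i ≠ k) (hik' : i' ≠ k') :
    sepSum x S j i k ≤ Real.exp (2 * ξ) * sepSum x S j i' k' := by
  have fst : ∀ i k i' : W, i ∈ S → i' ∈ S → i ≠ k → i' ≠ k →
      sepSum x S j i k ≤ Real.exp ξ * sepSum x S j i' k := by
    intro i k i' hi hi' h1 h2
    refine sum_le_of_swap j hx hi hi' fun T hT => ?_
    rw [mem_map_swap, mem_map_swap, Equiv.swap_apply_right, Equiv.swap_apply_of_ne_of_ne h1.symm h2.symm]
    exact hT
  have snd : ∀ i k k' : W, k ∈ S → k' ∈ S → i ≠ k → i ≠ k' →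
      sepSum x S j i k ≤ Real.exp ξ * sepSum x S j i k' := by
    intro i k k' hk hk' h1 h2
    refine sum_le_of_swap j hx hk hk' fun T hT => ?_
    rw [mem_map_swap, mem_map_swap, Equiv.swap_apply_right, Equiv.swap_apply_of_ne_of_ne h1 h2]
    exact hT
  have e : Real.exp (2 * ξ) = Real.exp ξ * Real.exp ξ := by rw [← Real.exp_add]; ring_nf
  have hξ : 0 ≤ ξ := (abs_nonneg _).trans (hx i hi i hi)
  rw [e, mul_assoc]
  by_cases h1 : i' = k
  · by_cases h2 : k' = i
    · subst h1 h2
      have h3 : sepSum x S j k' i' ≤ Real.exp ξ * sepSum x S j i' k' := by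
        refine sum_le_of_swap j hx hi hk fun T hT => ?_
        rw [mem_map_swap, mem_map_swap, Equiv.swap_apply_right, Equiv.swap_apply_left]
        exact hT
      refine h3.trans (le_mul_of_one_le_left ?_ (Real.one_le_exp hξ))
      exact mul_nonneg (Real.exp_pos _).le (sum_nonneg fun _ _ => (Real.exp_pos _).le)
    · exact (snd i k k' hk hk' hik (Ne.symm h2)).trans
        (mul_le_mul_of_nonneg_left (fst i k' i' hi hi' (Ne.symm h2) hik') (Real.exp_pos _).le)
  · exact (fst i k i' hi hi' hik h1).trans
      (mul_le_mul_of_nonneg_left (snd i' k k' hk hk' h1 hik') (Real.exp_pos _).le)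

lemma sepSum_self (x : W → ℝ) (S : Finset W) (j : ℕ) (i : W) : sepSum x S j i i = 0 := by
  rw [sepSum, filter_false_of_mem, sum_empty]
  tauto

lemma sepSum_nonneg (x : W → ℝ) (S : Finset W) (j : ℕ) (i k : W) : 0 ≤ sepSum x S j i k :=
  sum_nonneg fun _ _ => (Real.exp_pos _).le

/-- Double counting of separated pairs. -/
lemma sum_mul_sepSum (x : W → ℝ) (S : Finset W) (j : ℕ) (f : W → W → ℝ) :
    ∑ i ∈ S, ∑ k ∈ S, f i k * sepSum x S j i k =
      ∑ T ∈ S.powersetCard j, (∑ i ∈ T, ∑ k ∈ S \ T, f i k) * Real.exp (∑ w ∈ T, x w) := by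
  have h1 : ∀ i k, f i k * sepSum x S j i k = ∑ T ∈ S.powersetCard j,
      if i ∈ T ∧ k ∉ T then f i k * Real.exp (∑ w ∈ T, x w) else 0 := by
    intro i k
    rw [sepSum, mul_sum, sum_filter]
  rw [sum_congr rfl fun i _ => sum_congr rfl fun k _ => h1 i k]
  rw [sum_congr rfl fun i _ => sum_comm, sum_comm]
  refine sum_congr rfl fun T hT => ?_
  have hTS := (mem_powersetCard.1 hT).1
  rw [sum_mul, ← sum_subset hTS (f := fun i => ∑ k ∈ S, if i ∈ T ∧ k ∉ T then
    f i k * Real.exp (∑ w ∈ T, x w) else 0)]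
  · refine sum_congr rfl fun i hi => ?_
    rw [sum_mul, ← sum_subset (sdiff_subset (s := S) (t := T))]
    · refine sum_congr rfl fun k hk => ?_
      rw [if_pos ⟨hi, (mem_sdiff.1 hk).2⟩]
    · intro k hkS hk
      rw [if_neg]
      rintro ⟨-, h⟩
      exact hk (mem_sdiff.2 ⟨hkS, h⟩)
  · intro i _ hi
    refine sum_eq_zero fun k _ => ?_
    rw [if_neg]
    exact fun h => hi h.1

lemma sum_sepSum (x : W → ℝ) (S : Finset W) {j : ℕ} (hj : j ≤ S.card) :
    ∑ i ∈ S, ∑ k ∈ S, sepSum x S j i k = (j : ℝ) * ((S.card : ℝ) - j) * expSum x S j := by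
  have := sum_mul_sepSum x S j fun _ _ => 1
  simp only [one_mul] at this
  rw [this, expSum, mul_sum]
  refine sum_congr rfl fun T hT => ?_
  rw [mem_powersetCard] at hT
  congr 1
  rw [sum_const, sum_const, card_sdiff_of_subset hT.1, hT.2, nsmul_eq_mul, nsmul_eq_mul, mul_one,
    Nat.cast_sub hj]

/-- A separated count is nearly its average. -/
lemma sepSum_near {x : W → ℝ} {S : Finset W} {ξ : ℝ} {j : ℕ} (hj : j ≤ S.card)
    (hx : ∀ i ∈ S, ∀ k ∈ S, |x i - x k| ≤ ξ) {i k : W} (hi : i ∈ S) (hk : k ∈ S) (hik : i ≠ k) :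
    (S.card : ℝ) * ((S.card : ℝ) - 1) * sepSum x S j i k ≤
      Real.exp (2 * ξ) * ((j : ℝ) * ((S.card : ℝ) - j) * expSum x S j) ∧
    Real.exp (-(2 * ξ)) * ((j : ℝ) * ((S.card : ℝ) - j) * expSum x S j) ≤
      (S.card : ℝ) * ((S.card : ℝ) - 1) * sepSum x S j i k := by
  rw [← sum_sepSum x S hj]
  have hc : (S.card : ℝ) * ((S.card : ℝ) - 1) * sepSum x S j i k =
      ∑ i' ∈ S, ∑ k' ∈ S, if i' = k' then 0 else sepSum x S j i k := by
    have : ∀ i' ∈ S, (∑ k' ∈ S, if i' = k' then 0 else sepSum x S j i k) =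
        ((S.card : ℝ) - 1) * sepSum x S j i k := by
      intro i' hi'
      rw [← add_sum_erase _ _ hi', if_pos rfl, zero_add, sum_congr rfl (g := fun _ =>
        sepSum x S j i k) fun w hw => if_neg (ne_of_mem_erase hw).symm, sum_const, card_erase_of_mem hi',
        nsmul_eq_mul, Nat.cast_sub (card_pos.2 ⟨i, hi⟩)]
      push_cast
      ring
    rw [sum_congr rfl this, sum_const, nsmul_eq_mul]
    ring
  rw [hc, mul_sum, mul_sum]
  constructor
  · refine sum_le_sum fun i' hi' => ?_
    rw [mul_sum]
    refine sum_le_sum fun k' hk' => ?_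
    split_ifs with h
    · exact mul_nonneg (Real.exp_pos _).le (sepSum_nonneg _ _ _ _ _)
    · exact sepSum_le j hx hi hk hi' hk' hik h
  · refine sum_le_sum fun i' hi' => ?_
    rw [mul_sum]
    refine sum_le_sum fun k' hk' => ?_
    split_ifs with h
    · rw [h, sepSum_self, mul_zero]
    · have := sepSum_le j hx hi' hk' hi hk h hik
      rw [Real.exp_neg, inv_mul_le_iff₀ (Real.exp_pos _)]
      exact this

/-- The centred first moment of the tilted random subset. -/
lemma centred_moment (x : W → ℝ) (S : Finset W) {j : ℕ} (hj : j ≤ S.card) :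
    2 * ∑ T ∈ S.powersetCard j, ((S.card : ℝ) * ∑ w ∈ T, x w - j * ∑ w ∈ S, x w) *
        Real.exp (∑ w ∈ T, x w) =
      ∑ i ∈ S, ∑ k ∈ S, (x i - x k) * (1 - Real.exp (x k - x i)) * sepSum x S j i k := by
  have h1 := sum_mul_sepSum x S j fun i k => x i - x k
  have h2 : ∑ T ∈ S.powersetCard j, (∑ i ∈ T, ∑ k ∈ S \ T, (x i - x k)) * Real.exp (∑ w ∈ T, x w) =
      ∑ T ∈ S.powersetCard j, ((S.card : ℝ) * ∑ w ∈ T, x w - j * ∑ w ∈ S, x w) *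
        Real.exp (∑ w ∈ T, x w) := by
    refine sum_congr rfl fun T hT => ?_
    rw [mem_powersetCard] at hT
    congr 1
    simp only [sum_sub_distrib, sum_const, card_sdiff_of_subset hT.1, hT.2, nsmul_eq_mul,
      Nat.cast_sub hj, ← mul_sum]
    rw [← sum_sdiff hT.1 (f := x)]
    ring
  rw [h2] at h1
  rw [← h1]
  have h3 : ∑ i ∈ S, ∑ k ∈ S, (x i - x k) * sepSum x S j i k =
      -∑ i ∈ S, ∑ k ∈ S, (x i - x k) * (Real.exp (x k - x i) * sepSum x S j i k) := by
    rw [sum_comm, ← sum_neg_distrib]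
    refine sum_congr rfl fun i hi => ?_
    rw [← sum_neg_distrib]
    refine sum_congr rfl fun k hk => ?_
    rw [sepSum_swap x j hi hk]
    ring
  rw [two_mul]
  nth_rewrite 2 [h3]
  rw [← sub_eq_add_neg, ← sum_sub_distrib]
  refine sum_congr rfl fun i _ => ?_
  rw [← sum_sub_distrib]
  refine sum_congr rfl fun k _ => ?_
  ring

/-- The quadratic spread of `x` on `S`. -/
noncomputable def spread (x : W → ℝ) (S : Finset W) : ℝ :=
  ∑ i ∈ S, ∑ k ∈ S, (x i - x k) ^ 2

lemma spread_nonneg (x : W → ℝ) (S : Finset W) : 0 ≤ spread x S :=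
  sum_nonneg fun _ _ => sum_nonneg fun _ _ => sq_nonneg _

lemma abs_mul_one_sub_exp_le {s ξ δ : ℝ} (hs : 0 ≤ s) (hs1 : s ≤ 1) (hξ1 : ξ ≤ 1 / 10)
    (hδ : |δ| ≤ ξ) : |s * δ * (1 - Real.exp (-(s * δ))) - s ^ 2 * δ ^ 2| ≤ ξ * (s ^ 2 * δ ^ 2) := by
  have hy : |s * δ| ≤ ξ := by
    rw [abs_mul, abs_of_nonneg hs]
    exact (mul_le_of_le_one_left (abs_nonneg _) hs1).trans hδ
  have h1 := Real.abs_exp_sub_one_sub_id_le (x := -(s * δ)) (by rw [abs_neg]; linarith)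
  have e : s * δ * (1 - Real.exp (-(s * δ))) - s ^ 2 * δ ^ 2 =
      -(s * δ) * (Real.exp (-(s * δ)) - 1 - -(s * δ)) := by ring
  rw [e, abs_mul, abs_neg]
  calc |s * δ| * |Real.exp (-(s * δ)) - 1 - -(s * δ)| ≤ ξ * (-(s * δ)) ^ 2 :=
        mul_le_mul hy h1 (abs_nonneg _) ((abs_nonneg _).trans hy)
    _ = _ := by ring

lemma moment_factor {h : ℝ} (h0 : h ≠ 0) (h1 : h - 1 ≠ 0) (s q d c f : ℝ) :
    s ^ 2 * (2 * (q / (4 * h ^ 2 * (h - 1)) * d) * c) * f =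
      (2 * h)⁻¹ * ((h * (h - 1))⁻¹ * (s ^ 2 * d * (c * (q * f)))) := by
  field_simp
  ring

/-- Bounds on the centred first moment at tilt `s`. -/
lemma centred_moment_bounds {x : W → ℝ} {S : Finset W} {ξ s : ℝ} {j : ℕ} (hj : j ≤ S.card)
    (hS : 2 ≤ S.card) (hx : ∀ i ∈ S, ∀ k ∈ S, |x i - x k| ≤ ξ) (hξ : ξ ≤ 1 / 10)
    (hs : 0 ≤ s) (hs1 : s ≤ 1) :
    s * ∑ T ∈ S.powersetCard j, (∑ w ∈ T, x w - j / (S.card : ℝ) * ∑ w ∈ S, x w) *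
        Real.exp (s * ∑ w ∈ T, x w) ≤
      s ^ 2 * (2 * ((j : ℝ) * ((S.card : ℝ) - j) / (4 * (S.card : ℝ) ^ 2 * ((S.card : ℝ) - 1)) *
        spread x S) * (1 + 6 * ξ)) * expSum (fun w => s * x w) S j ∧
    s ^ 2 * (2 * ((j : ℝ) * ((S.card : ℝ) - j) / (4 * (S.card : ℝ) ^ 2 * ((S.card : ℝ) - 1)) *
        spread x S) * (1 - 6 * ξ)) * expSum (fun w => s * x w) S j ≤
      s * ∑ T ∈ S.powersetCard j, (∑ w ∈ T, x w - j / (S.card : ℝ) * ∑ w ∈ S, x w) *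
        Real.exp (s * ∑ w ∈ T, x w) := by
  obtain ⟨i₀, hi₀⟩ : S.Nonempty := card_pos.1 (by omega)
  have hξ0 : 0 ≤ ξ := (abs_nonneg _).trans (hx i₀ hi₀ i₀ hi₀)
  have hsx : ∀ i ∈ S, ∀ k ∈ S, |s * x i - s * x k| ≤ ξ := by
    intro i hi k hk
    rw [← mul_sub, abs_mul, abs_of_nonneg hs]
    exact (mul_le_of_le_one_left (abs_nonneg _) hs1).trans (hx i hi k hk)
  have key := centred_moment (fun w => s * x w) S hj
  simp only [← mul_sum] at key
  set h : ℝ := (S.card : ℝ) with hh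
  have hh2 : 2 ≤ h := by rw [hh]; exact_mod_cast hS
  have hh1 : 0 < h - 1 := by linarith
  have hh0 : 0 < h := by linarith
  set F : ℝ := expSum (fun w => s * x w) S j with hF
  have hF0 : 0 ≤ F := expSum_nonneg _ _ _
  have hjh : (j : ℝ) ≤ h := Nat.cast_le.2 hj
  set q : ℝ := (j : ℝ) * (h - j) with hq
  have hq0 : 0 ≤ q := mul_nonneg (Nat.cast_nonneg _) (by linarith)
  have hlhs : s * ∑ T ∈ S.powersetCard j, (∑ w ∈ T, x w - j / h * ∑ w ∈ S, x w) *
        Real.exp (s * ∑ w ∈ T, x w) = (2 * h)⁻¹ * ∑ i ∈ S, ∑ k ∈ S,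
        (s * x i - s * x k) * (1 - Real.exp (s * x k - s * x i)) *
          sepSum (fun w => s * x w) S j i k := by
    rw [← key, ← mul_assoc]
    generalize ∑ w ∈ S, x w = σ
    rw [mul_sum, mul_sum]
    refine sum_congr rfl fun T _ => ?_
    field_simp
  have hexp2 : Real.exp (2 * ξ) ≤ 1 + 4 * ξ := by
    have := Real.abs_exp_sub_one_sub_id_le (x := 2 * ξ) (by rw [abs_of_nonneg] <;> linarith)
    have := (abs_le.1 this).2
    nlinarith
  have hexp2' : 1 - 2 * ξ ≤ Real.exp (-(2 * ξ)) := by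
    have := Real.add_one_le_exp (-(2 * ξ))
    linarith
  have hterm : ∀ i ∈ S, ∀ k ∈ S, h * (h - 1) * ((s * x i - s * x k) *
      (1 - Real.exp (s * x k - s * x i)) * sepSum (fun w => s * x w) S j i k) ≤
      s ^ 2 * (x i - x k) ^ 2 * ((1 + 6 * ξ) * (q * F)) ∧
      s ^ 2 * (x i - x k) ^ 2 * ((1 - 6 * ξ) * (q * F)) ≤ h * (h - 1) * ((s * x i - s * x k) *
      (1 - Real.exp (s * x k - s * x i)) * sepSum (fun w => s * x w) S j i k) := by
    intro i hi k hk
    by_cases hik : i = k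
    · subst hik
      simp
    have h1 := sepSum_near hj hsx hi hk hik
    have h2 := abs_le.1 (abs_mul_one_sub_exp_le hs hs1 hξ (hx i hi k hk))
    rw [← hh, ← hq, ← hF] at h1
    set p := sepSum (fun w => s * x w) S j i k with hp
    have hp0 : 0 ≤ h * (h - 1) * p := mul_nonneg (mul_nonneg hh0.le hh1.le) (sepSum_nonneg _ _ _ _ _)
    have e1 : (s * x i - s * x k) * (1 - Real.exp (s * x k - s * x i)) =
        s * (x i - x k) * (1 - Real.exp (-(s * (x i - x k)))) := by
      rw [← mul_sub]; congr 3; ring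
    rw [e1]
    set D := s * (x i - x k) * (1 - Real.exp (-(s * (x i - x k)))) with hD
    set z := s ^ 2 * (x i - x k) ^ 2 with hz
    have hz0 : 0 ≤ z := by positivity
    have hqF : 0 ≤ q * F := mul_nonneg hq0 hF0
    have hDl : (1 - ξ) * z ≤ D := by linarith
    have hDu : D ≤ (1 + ξ) * z := by linarith
    have hpu : h * (h - 1) * p ≤ (1 + 4 * ξ) * (q * F) :=
      h1.1.trans (mul_le_mul_of_nonneg_right hexp2 hqF)
    have hpl : (1 - 2 * ξ) * (q * F) ≤ h * (h - 1) * p :=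
      (mul_le_mul_of_nonneg_right hexp2' hqF).trans h1.2
    have e2 : h * (h - 1) * (D * p) = D * (h * (h - 1) * p) := by ring
    rw [e2]
    have hzqF : 0 ≤ z * (q * F) := mul_nonneg hz0 hqF
    constructor
    · calc D * (h * (h - 1) * p) ≤ ((1 + ξ) * z) * ((1 + 4 * ξ) * (q * F)) :=
            mul_le_mul hDu hpu hp0 (by positivity)
        _ = (1 + ξ) * (1 + 4 * ξ) * (z * (q * F)) := by ring
        _ ≤ (1 + 6 * ξ) * (z * (q * F)) := by
          refine mul_le_mul_of_nonneg_right ?_ hzqF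
          nlinarith
        _ = _ := by ring
    · calc z * ((1 - 6 * ξ) * (q * F)) = (1 - 6 * ξ) * (z * (q * F)) := by ring
        _ ≤ (1 - ξ) * (1 - 2 * ξ) * (z * (q * F)) := by
          refine mul_le_mul_of_nonneg_right ?_ hzqF
          nlinarith
        _ = ((1 - ξ) * z) * ((1 - 2 * ξ) * (q * F)) := by ring
        _ ≤ D * (h * (h - 1) * p) := by
          refine mul_le_mul hDl hpl (mul_nonneg (by linarith) hqF) ?_
          exact (mul_nonneg (by linarith) hz0).trans hDl
  have hhh : 0 < h * (h - 1) := by positivity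
  rw [hlhs]
  have hspread : ∀ C : ℝ, ∑ i ∈ S, ∑ k ∈ S, s ^ 2 * (x i - x k) ^ 2 * C = s ^ 2 * spread x S * C := by
    intro C
    simp only [← sum_mul, ← mul_sum, spread]
  have hU := sum_le_sum fun i hi => sum_le_sum fun k hk => (hterm i hi k hk).1
  have hL := sum_le_sum fun i hi => sum_le_sum fun k hk => (hterm i hi k hk).2
  simp only [hspread] at hU hL
  simp only [← mul_sum] at hU hL
  set tot := ∑ i ∈ S, ∑ k ∈ S, (s * x i - s * x k) * (1 - Real.exp (s * x k - s * x i)) *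
          sepSum (fun w => s * x w) S j i k with htot
  constructor
  · have e : s ^ 2 * (2 * (q / (4 * h ^ 2 * (h - 1)) * spread x S) * (1 + 6 * ξ)) * F =
        (2 * h)⁻¹ * ((h * (h - 1))⁻¹ * (s ^ 2 * spread x S * ((1 + 6 * ξ) * (q * F)))) :=
      moment_factor hh0.ne' hh1.ne' _ _ _ _ _
    rw [e]
    refine mul_le_mul_of_nonneg_left ?_ (by positivity)
    rw [le_inv_mul_iff₀ hhh]
    exact hU
  · have e : s ^ 2 * (2 * (q / (4 * h ^ 2 * (h - 1)) * spread x S) * (1 - 6 * ξ)) * F =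
        (2 * h)⁻¹ * ((h * (h - 1))⁻¹ * (s ^ 2 * spread x S * ((1 - 6 * ξ) * (q * F)))) :=
      moment_factor hh0.ne' hh1.ne' _ _ _ _ _
    rw [e]
    refine mul_le_mul_of_nonneg_left ?_ (by positivity)
    rw [inv_mul_le_iff₀ hhh]
    exact hL

/-- Second order expansion of the exponential sum over `j`-subsets. -/
lemma expSum_expansion {x : W → ℝ} {S : Finset W} {ξ : ℝ} {j : ℕ} (hj : j ≤ S.card)
    (hS : 2 ≤ S.card) (hx : ∀ i ∈ S, ∀ k ∈ S, |x i - x k| ≤ ξ) (hξ : ξ ≤ 1 / 10) :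
    ∃ φ : ℝ, |φ - (j : ℝ) * ((S.card : ℝ) - j) / (4 * (S.card : ℝ) ^ 2 * ((S.card : ℝ) - 1)) *
        spread x S| ≤ 6 * ξ * ((j : ℝ) * ((S.card : ℝ) - j) /
          (4 * (S.card : ℝ) ^ 2 * ((S.card : ℝ) - 1)) * spread x S) ∧
      expSum x S j = (S.card.choose j : ℝ) * Real.exp (j / (S.card : ℝ) * ∑ w ∈ S, x w + φ) := by
  set A : ℝ := (j : ℝ) * ((S.card : ℝ) - j) / (4 * (S.card : ℝ) ^ 2 * ((S.card : ℝ) - 1)) *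
        spread x S with hA
  set μ : ℝ := j / (S.card : ℝ) * ∑ w ∈ S, x w with hμ
  have hcp : 0 < (S.card.choose j : ℝ) := Nat.cast_pos.2 (Nat.choose_pos hj)
  set G : ℝ → ℝ → ℝ := fun B s => ∑ T ∈ S.powersetCard j,
    Real.exp (s * (∑ w ∈ T, x w - μ) - B * s ^ 2) with hG
  have hG0 : ∀ B, G B 0 = S.card.choose j := by
    intro B
    simp [hG]
  have hG1 : ∀ B, G B 1 = expSum x S j * Real.exp (-μ - B) := by
    intro B
    rw [hG, expSum, sum_mul]
    refine sum_congr rfl fun T _ => ?_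
    rw [← Real.exp_add]
    congr 1
    ring
  have hder : ∀ B s, HasDerivAt (G B) (∑ T ∈ S.powersetCard j,
      Real.exp (s * (∑ w ∈ T, x w - μ) - B * s ^ 2) * ((∑ w ∈ T, x w - μ) - B * (2 * s))) s := by
    intro B s
    refine HasDerivAt.fun_sum fun T _ => ?_
    refine HasDerivAt.exp ?_
    refine HasDerivAt.sub ?_ ?_
    · simpa using (hasDerivAt_id s).mul_const (∑ w ∈ T, x w - μ)
    · simpa using (hasDerivAt_pow 2 s).const_mul B
  have hrew : ∀ B s, ∑ T ∈ S.powersetCard j,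
      Real.exp (s * (∑ w ∈ T, x w - μ) - B * s ^ 2) * ((∑ w ∈ T, x w - μ) - B * (2 * s)) =
      Real.exp (-s * μ - B * s ^ 2) * (∑ T ∈ S.powersetCard j, (∑ w ∈ T, x w - μ) *
        Real.exp (s * ∑ w ∈ T, x w) - s * (2 * B) * expSum (fun w => s * x w) S j) := by
    intro B s
    rw [expSum, mul_sum, ← sum_sub_distrib, mul_sum]
    refine sum_congr rfl fun T _ => ?_
    have : Real.exp (s * (∑ w ∈ T, x w - μ) - B * s ^ 2) =
        Real.exp (-s * μ - B * s ^ 2) * Real.exp (s * ∑ w ∈ T, x w) := by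
      rw [← Real.exp_add]; congr 1; ring
    rw [this, ← mul_sum]
    ring
  have hcont : ∀ B, ContinuousOn (G B) (Set.Icc 0 1) := fun B s _ =>
    (hder B s).continuousAt.continuousWithinAt
  have hbd : ∀ s ∈ Set.Ioo (0 : ℝ) 1,
      ∑ T ∈ S.powersetCard j, (∑ w ∈ T, x w - μ) * Real.exp (s * ∑ w ∈ T, x w) ≤
        s * (2 * (A * (1 + 6 * ξ))) * expSum (fun w => s * x w) S j ∧
      s * (2 * (A * (1 - 6 * ξ))) * expSum (fun w => s * x w) S j ≤
        ∑ T ∈ S.powersetCard j, (∑ w ∈ T, x w - μ) * Real.exp (s * ∑ w ∈ T, x w) := by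
    intro s hs
    have h1 := centred_moment_bounds hj hS hx hξ hs.1.le hs.2.le
    rw [← hA, ← hμ] at h1
    constructor
    · refine le_of_mul_le_mul_left (h1.1.trans (le_of_eq ?_)) hs.1
      ring
    · refine le_of_mul_le_mul_left (le_trans (le_of_eq ?_) h1.2) hs.1
      ring
  have hup : G (A * (1 + 6 * ξ)) 1 ≤ G (A * (1 + 6 * ξ)) 0 := by
    refine antitoneOn_of_deriv_nonpos (convex_Icc 0 1) (hcont _) ?_ ?_ (Set.left_mem_Icc.2 zero_le_one)
      (Set.right_mem_Icc.2 zero_le_one) zero_le_one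
    · exact fun s _ => (hder _ s).differentiableAt.differentiableWithinAt
    · intro s hs
      rw [interior_Icc] at hs
      rw [(hder _ s).deriv, hrew]
      refine mul_nonpos_of_nonneg_of_nonpos (Real.exp_pos _).le ?_
      linarith [(hbd s hs).1]
  have hlo : G (A * (1 - 6 * ξ)) 0 ≤ G (A * (1 - 6 * ξ)) 1 := by
    refine monotoneOn_of_deriv_nonneg (convex_Icc 0 1) (hcont _) ?_ ?_ (Set.left_mem_Icc.2 zero_le_one)
      (Set.right_mem_Icc.2 zero_le_one) zero_le_one
    · exact fun s _ => (hder _ s).differentiableAt.differentiableWithinAt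
    · intro s hs
      rw [interior_Icc] at hs
      rw [(hder _ s).deriv, hrew]
      refine mul_nonneg (Real.exp_pos _).le ?_
      linarith [(hbd s hs).2]
  rw [hG0, hG1] at hup hlo
  have hE : 0 < expSum x S j := expSum_pos x hj
  have hlog : ∀ B, expSum x S j * Real.exp (-μ - B) = (S.card.choose j : ℝ) *
      Real.exp (Real.log (expSum x S j / S.card.choose j) - μ - B) := by
    intro B
    have e : Real.log (expSum x S j / S.card.choose j) - μ - B =
        Real.log (expSum x S j / S.card.choose j) + (-μ - B) := by ring
    rw [e, Real.exp_add, Real.exp_log (div_pos hE hcp)]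
    field_simp
  rw [hlog] at hup hlo
  have hup' := (mul_le_iff_le_one_right hcp).1 hup
  have hlo' := (le_mul_iff_one_le_right hcp).1 hlo
  rw [Real.exp_le_one_iff] at hup'
  rw [Real.one_le_exp_iff] at hlo'
  refine ⟨Real.log (expSum x S j / S.card.choose j) - μ, ?_, ?_⟩
  · rw [abs_le]
    constructor <;> linarith
  · rw [add_sub_cancel, Real.exp_log (div_pos hE hcp)]
    field_simp

end ExpSum

lemma tilt_aux {ν m n : ℝ} (hν : 10 ^ 6 ≤ ν) (hn : n = ν ^ 20) (hm : |m - n| ≤ ν ^ 11) :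
    10 ^ 54 ≤ ν ^ 9 ∧ 10 ^ 54 ≤ n ∧ 99 / 100 * n ≤ m - 1 ∧ m ≤ 101 / 100 * n := by
  have h1 := mul_pow_le_pow_of_lt hν (show 11 < 20 by norm_num)
  have h2 : (10 : ℝ) ^ 54 ≤ ν ^ 9 := by
    calc (10 : ℝ) ^ 54 = ((10 : ℝ) ^ 6) ^ 9 := by norm_num
      _ ≤ ν ^ 9 := by gcongr
  have h3 : (10 : ℝ) ^ 120 ≤ ν ^ 20 := by
    calc (10 : ℝ) ^ 120 = ((10 : ℝ) ^ 6) ^ 20 := by norm_num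
      _ ≤ ν ^ 20 := by gcongr
  have h4 := abs_le.1 hm
  rw [← hn] at h1 h3
  norm_num at h2 h3 ⊢
  refine ⟨h2, by linarith, by linarith, by linarith⟩

/-- The coefficient of the normalised deviation in `4 * c w / (m - 1)`. -/
noncomputable def tilt (m n : ℝ) : ℝ := 2 * Real.sqrt (n - 1) / (m - 1)

lemma tilt_sq_near {ν m n : ℝ} (hν : 10 ^ 6 ≤ ν) (hn : n = ν ^ 20) (hm : |m - n| ≤ ν ^ 11) :
    |tilt m n ^ 2 * m / 4 - 1| ≤ 3 / ν ^ 9 := by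
  obtain ⟨h1, h2, h3, h4⟩ := tilt_aux hν hn hm
  norm_num at h1 h2
  have hν0 : 0 < ν := by linarith
  have hm1 : 0 < m - 1 := by linarith
  have e : tilt m n ^ 2 * m / 4 - 1 = (m * (n - m) + m - 1) / (m - 1) ^ 2 := by
    rw [tilt, div_pow, mul_pow, Real.sq_sqrt (by linarith)]
    field_simp
    ring
  rw [e, abs_div, abs_of_pos (pow_pos hm1 2), div_le_div_iff₀ (pow_pos hm1 2) (pow_pos hν0 9)]
  have h5 : |m * (n - m) + m - 1| ≤ m * (ν ^ 11 + 1) := by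
    have h6 := abs_le.1 hm
    rw [abs_le]
    constructor <;> nlinarith
  have h7 : ν ^ 11 * ν ^ 9 = n := by rw [hn]; ring
  have h8 := mul_pow_le_pow_of_lt hν (show 9 < 20 by norm_num)
  rw [← hn] at h8
  calc |m * (n - m) + m - 1| * ν ^ 9 ≤ m * (ν ^ 11 + 1) * ν ^ 9 := by gcongr
    _ = m * (n + ν ^ 9) := by rw [← h7]; ring
    _ ≤ (101 / 100 * n) * (2 * n) := by
      apply mul_le_mul <;> first | positivity | linarith
    _ ≤ 3 * ((99 / 100 * n) * (99 / 100 * n)) := by nlinarith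
    _ ≤ 3 * (m - 1) ^ 2 := by rw [sq]; gcongr

lemma tilt_nonneg {ν m n : ℝ} (hν : 10 ^ 6 ≤ ν) (hn : n = ν ^ 20) (hm : |m - n| ≤ ν ^ 11) :
    0 ≤ tilt m n := by
  obtain ⟨h1, h2, h3, h4⟩ := tilt_aux hν hn hm
  norm_num at h1 h2
  exact div_nonneg (by positivity) (by linarith)

lemma sqrt_scale {ν n : ℝ} (hν : 10 ^ 6 ≤ ν) (hn : n = ν ^ 20) : Real.sqrt n = ν ^ 10 := by
  rw [hn, show ν ^ 20 = (ν ^ 10) ^ 2 by ring, Real.sqrt_sq (by positivity)]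

lemma tilt_mul_le {ν m n : ℝ} (hν : 10 ^ 6 ≤ ν) (hn : n = ν ^ 20) (hm : |m - n| ≤ ν ^ 11) :
    tilt m n * (2 * ν) ≤ 5 / ν ^ 9 := by
  obtain ⟨h1, h2, h3, h4⟩ := tilt_aux hν hn hm
  norm_num at h1 h2
  have hν0 : 0 < ν := by linarith
  have hs : Real.sqrt (n - 1) ≤ ν ^ 10 := by
    rw [← sqrt_scale hν hn]; exact Real.sqrt_le_sqrt (by linarith)
  rw [tilt, div_mul_eq_mul_div, div_le_div_iff₀ (by linarith) (by positivity)]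
  calc 2 * Real.sqrt (n - 1) * (2 * ν) * ν ^ 9 ≤ 2 * ν ^ 10 * (2 * ν) * ν ^ 9 := by gcongr
    _ = 4 * n := by rw [hn]; ring
    _ ≤ 5 * (m - 1) := by linarith

lemma tilt_sqrt_near {ν m n : ℝ} (hν : 10 ^ 6 ≤ ν) (hn : n = ν ^ 20) (hm : |m - n| ≤ ν ^ 11) :
    |tilt m n * Real.sqrt m / 2 - 1| ≤ 3 / ν ^ 9 := by
  have h1 := tilt_sq_near hν hn hm
  obtain ⟨-, h2, h3, -⟩ := tilt_aux hν hn hm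
  norm_num at h2
  have hm0 : 0 ≤ m := by linarith
  set κ := tilt m n * Real.sqrt m / 2 with hκ
  have hκ0 : 0 ≤ κ := by
    have := tilt_nonneg hν hn hm
    positivity
  have e : tilt m n ^ 2 * m / 4 - 1 = (κ - 1) * (κ + 1) := by
    rw [hκ]
    linear_combination (-(tilt m n) ^ 2 / 4) * Real.sq_sqrt hm0
  rw [e, abs_mul, abs_of_nonneg (by linarith : 0 ≤ κ + 1)] at h1
  nlinarith [abs_nonneg (κ - 1)]

section Approx

variable {W : Type*} [Fintype W] [DecidableEq W]

lemma spread_affine (β : W → ℝ) (S : Finset W) (a b : ℝ) :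
    spread (fun w => a + b * β w) S = b ^ 2 * spread β S := by
  simp only [spread, mul_sum]
  refine sum_congr rfl fun i _ => sum_congr rfl fun k _ => ?_
  ring

lemma spread_le {β : W → ℝ} {ν : ℝ} (hβ : ∀ w, |β w| ≤ ν) (S : Finset W) :
    spread β S ≤ (S.card : ℝ) ^ 2 * (2 * ν) ^ 2 := by
  calc spread β S ≤ ∑ i ∈ S, ∑ k ∈ S, (2 * ν) ^ 2 := by
        refine sum_le_sum fun i _ => sum_le_sum fun k _ => ?_
        have h1 := abs_le.1 (hβ i)
        have h2 := abs_le.1 (hβ k)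
        apply sq_le_sq'  <;> linarith
    _ = _ := by simp; ring

lemma spread_coeff_eq {h m : ℝ} (h0 : h ≠ 0) (h1 : h - 1 ≠ 0) (hm : m ≠ 0) (j b σ : ℝ) :
    j * (h - j) / (4 * h ^ 2 * (h - 1)) * (b ^ 2 * σ) =
      (1 - (1 - 2 * j / h) ^ 2) * (h / (h - 1)) * (b ^ 2 * m / 4) * (1 / (4 * m * h) * σ) := by
  field_simp
  ring

lemma approx_finish {ν e R T φ : ℝ} (hν : 10 ^ 6 ≤ ν) (he : e = 1 / ν ^ 9) (he0 : 0 < e)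
    (he1 : e ≤ 1 / 1000) (hRl : 1 - 5 * e ≤ R) (hR1 : R ≤ 1 + 5 * e) (hT0 : 0 ≤ T)
    (hT1 : T ≤ 2 * ν ^ 2)
    (hφ : |φ - R * T| ≤ 6 * (5 * e) * (R * T)) : |φ - T| ≤ 1 / ν ^ 3 := by
  have hν0 : 0 < ν := by linarith
  have hd : |R * T - T| ≤ 5 * e * T := by
    have h6 := mul_le_mul_of_nonneg_right hRl hT0
    have h7 := mul_le_mul_of_nonneg_right hR1 hT0
    rw [abs_le]
    constructor <;> linarith
  have hRT1 : R * T ≤ (1 + 5 * e) * (2 * ν ^ 2) := by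
    apply mul_le_mul <;> linarith
  have h30 : 6 * (5 * e) * (R * T) ≤ 60 * e * (2 * ν ^ 2) := by
    have h6 : (1 + 5 * e) * (2 * ν ^ 2) ≤ 2 * (2 * ν ^ 2) :=
      mul_le_mul_of_nonneg_right (by linarith) (by positivity)
    calc 6 * (5 * e) * (R * T) ≤ 6 * (5 * e) * (2 * (2 * ν ^ 2)) := by
          gcongr
          linarith
      _ = 60 * e * (2 * ν ^ 2) := by ring
  have hfin : 70 * e * (2 * ν ^ 2) ≤ 1 / ν ^ 3 := by
    rw [he]
    rw [le_div_iff₀ (by positivity)]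
    have := mul_pow_le_pow_of_lt hν (show 5 < 9 by norm_num)
    calc 70 * (1 / ν ^ 9) * (2 * ν ^ 2) * ν ^ 3 = 140 * ν ^ 5 / ν ^ 9 := by field_simp; ring
      _ ≤ 1 := by
        rw [div_le_one (by positivity)]
        linarith [pow_pos hν0 5]
  have heν : 0 ≤ e * (2 * ν ^ 2) := by positivity
  have heT : e * T ≤ e * (2 * ν ^ 2) := by gcongr
  calc |φ - T| ≤ |φ - R * T| + |R * T - T| := abs_sub_le _ _ _
    _ ≤ 60 * e * (2 * ν ^ 2) + 5 * e * T := by linarith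
    _ ≤ 1 / ν ^ 3 := by linarith

lemma factor_bounds {ν m h j b σ e φ : ℝ} (hν : 10 ^ 6 ≤ ν) (he : e = 1 / ν ^ 9)
    (hh : ν ^ 19 ≤ h) (hm : h ≤ 2 * m) (hj0 : 0 ≤ j) (hjh : j ≤ h) (hσ0 : 0 ≤ σ)
    (hσ1 : σ ≤ h ^ 2 * (2 * ν) ^ 2) (hb : |b ^ 2 * m / 4 - 1| ≤ 3 * e)
    (hφ : |φ - j * (h - j) / (4 * h ^ 2 * (h - 1)) * (b ^ 2 * σ)| ≤
      6 * (5 * e) * (j * (h - j) / (4 * h ^ 2 * (h - 1)) * (b ^ 2 * σ))) :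
    |φ| ≤ 5 * ν ^ 2 ∧
      (|j - h / 2| ≤ 2 * ν ^ 12 → |φ - 1 / (4 * m * h) * σ| ≤ 1 / ν ^ 3) := by
  have hν0 : 0 < ν := by linarith
  have hh0 : 0 < h := by linarith [pow_pos hν0 19]
  have hm0 : 0 < m := by linarith
  have h19 : 10 ^ 6 * ν ^ 9 ≤ ν ^ 19 := mul_pow_le_pow_of_lt hν (by norm_num)
  have h9 : 10 ^ 6 * ν ^ 0 ≤ ν ^ 9 := mul_pow_le_pow_of_lt hν (by norm_num)
  rw [pow_zero] at h9
  have hh1 : 0 < h - 1 := by linarith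
  have he0 : 0 < e := by rw [he]; positivity
  have he1 : e ≤ 1 / 1000 := by
    rw [he]; exact one_div_le_one_div_of_le (by norm_num) (by linarith)
  have hb2 := abs_le.1 hb
  set T := 1 / (4 * m * h) * σ with hT
  have hT0 : 0 ≤ T := by positivity
  have hT1 : T ≤ 2 * ν ^ 2 := by
    rw [hT, one_div, inv_mul_le_iff₀ (by positivity)]
    calc σ ≤ h ^ 2 * (2 * ν) ^ 2 := hσ1
      _ = 4 * h * ν ^ 2 * h := by ring
      _ ≤ 4 * h * ν ^ 2 * (2 * m) := by gcongr
      _ = _ := by ring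
  set z := 1 - 2 * j / h with hz
  set g := h / (h - 1) with hg
  have hg1 : 1 ≤ g := by rw [hg, le_div_iff₀ hh1]; linarith
  have hg2 : g ≤ 1 + e := by
    rw [hg, div_le_iff₀ hh1]
    have : 1 ≤ e * (h - 1) := by
      rw [he, one_div, le_inv_mul_iff₀ (by positivity)]
      norm_num at h19
      linarith
    linarith
  set K := b ^ 2 * m / 4 with hK
  have hA : j * (h - j) / (4 * h ^ 2 * (h - 1)) * (b ^ 2 * σ) = (1 - z ^ 2) * g * K * T := by
    rw [hz, hg, hK, hT]
    exact spread_coeff_eq hh0.ne' hh1.ne' hm0.ne' _ _ _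
  rw [hA] at hφ
  have hz1 : z ^ 2 ≤ 1 := by
    have h1 : j / h ≤ 1 := (div_le_one hh0).2 hjh
    have h2 : 0 ≤ j / h := by positivity
    have h3 : z = 1 - 2 * (j / h) := by rw [hz]; ring
    rw [h3]
    nlinarith
  have hgK1 : g * K ≤ 1 + 5 * e := by
    calc g * K ≤ (1 + e) * (1 + 3 * e) := by
          apply mul_le_mul <;> linarith
      _ ≤ 1 + 5 * e := by nlinarith
  have hgK0 : 1 - 3 * e ≤ g * K := by
    calc 1 - 3 * e = 1 * (1 - 3 * e) := by ring
      _ ≤ g * K := by apply mul_le_mul <;> linarith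
  set R := (1 - z ^ 2) * g * K with hR
  have hR' : R = (1 - z ^ 2) * (g * K) := by rw [hR]; ring
  have hR0 : 0 ≤ R := by
    rw [hR']; exact mul_nonneg (by linarith) (by linarith)
  have hR1 : R ≤ 1 + 5 * e := by
    rw [hR']
    exact (mul_le_of_le_one_left (by linarith) (by linarith [sq_nonneg z])).trans hgK1
  have hRT0 : 0 ≤ R * T := mul_nonneg hR0 hT0
  have hRT1 : R * T ≤ (1 + 5 * e) * (2 * ν ^ 2) := by
    apply mul_le_mul <;> linarith
  have hν2 : 0 < ν ^ 2 := by positivity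
  have hφ' := abs_le.1 hφ
  refine ⟨?_, ?_⟩
  · have h6 : 6 * (5 * e) * (R * T) ≤ 1 * (R * T) := mul_le_mul_of_nonneg_right (by linarith) hRT0
    have h7 : (1 + 5 * e) * (2 * ν ^ 2) ≤ 5 / 4 * (2 * ν ^ 2) :=
      mul_le_mul_of_nonneg_right (by linarith) (by positivity)
    rw [abs_le]
    constructor <;> linarith
  · intro hjj
    have hz2 : |z| ≤ 4 * ν ^ 12 / ν ^ 19 := by
      have e1 : z = -(2 * (j - h / 2)) / h := by
        rw [hz]; field_simp; ring
      rw [e1, abs_div, abs_neg, abs_mul, abs_of_pos hh0, abs_two]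
      apply div_le_div₀ <;> first | positivity | linarith
    have hz3 : z ^ 2 ≤ e := by
      rw [← sq_abs]
      calc |z| ^ 2 ≤ (4 * ν ^ 12 / ν ^ 19) ^ 2 := by gcongr
        _ = 16 / ν ^ 14 := by field_simp; ring
        _ ≤ 1 / ν ^ 9 := by
          rw [div_le_div_iff₀ (by positivity) (by positivity)]
          have := mul_pow_le_pow_of_lt hν (show 9 < 14 by norm_num)
          linarith [pow_pos hν0 9]
        _ = e := he.symm
    have hRl : 1 - 5 * e ≤ R := by
      rw [hR']
      calc 1 - 5 * e ≤ (1 - e) * (1 - 3 * e) := by nlinarith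
        _ ≤ _ := by apply mul_le_mul <;> linarith
    exact approx_finish hν he he0 he1 hRl hR1 hT0 hT1 hφ

/-- Both the crude and the sharp evaluation of the exponential sums. -/
lemma expSum_tilt {ν m n a : ℝ} (hν : 10 ^ 6 ≤ ν) (hn : n = ν ^ 20) (hm : |m - n| ≤ ν ^ 11)
    {β : W → ℝ} (hβ : ∀ w, |β w| ≤ ν) {S : Finset W} (hS : ν ^ 19 ≤ (S.card : ℝ))
    (hSn : (S.card : ℝ) ≤ n) {j : ℕ} (hj : j ≤ S.card) :
    ∃ φ : ℝ, |φ| ≤ 5 * ν ^ 2 ∧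
      (|(j : ℝ) - (S.card : ℝ) / 2| ≤ 2 * ν ^ 12 →
        |φ - 1 / (4 * m * (S.card : ℝ)) * spread β S| ≤ 1 / ν ^ 3) ∧
      expSum (fun w => a + tilt m n * β w) S j = (S.card.choose j : ℝ) *
        Real.exp (j / (S.card : ℝ) * ∑ w ∈ S, (a + tilt m n * β w) + φ) := by
  obtain ⟨h1, h2, h3, h4⟩ := tilt_aux hν hn hm
  norm_num at h1 h2
  have hν0 : 0 < ν := by linarith
  have hb0 := tilt_nonneg hν hn hm
  have hb1 := tilt_mul_le hν hn hm
  have hb2 := tilt_sq_near hν hn hm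
  set b := tilt m n with hb
  set e : ℝ := 1 / ν ^ 9 with he
  have he0 : 0 < e := by positivity
  have he1 : e ≤ 1 / 1000 := by
    rw [he]; exact one_div_le_one_div_of_le (by norm_num) (by linarith)
  have h5e : 5 / ν ^ 9 = 5 * e := by rw [he]; ring
  have h3e : 3 / ν ^ 9 = 3 * e := by rw [he]; ring
  rw [h5e] at hb1
  rw [h3e] at hb2
  have h19 : 10 ^ 6 * ν ^ 9 ≤ ν ^ 19 := mul_pow_le_pow_of_lt hν (by norm_num)
  have hS2 : 2 ≤ S.card := by
    have : (2 : ℝ) ≤ (S.card : ℝ) := by norm_num at h19; linarith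
    exact_mod_cast this
  have hx : ∀ i ∈ S, ∀ k ∈ S, |(a + b * β i) - (a + b * β k)| ≤ 5 * e := by
    intro i _ k _
    have e1 : (a + b * β i) - (a + b * β k) = b * (β i - β k) := by ring
    rw [e1, abs_mul, abs_of_nonneg hb0]
    refine le_trans (mul_le_mul_of_nonneg_left ?_ hb0) hb1
    have h1 := abs_le.1 (hβ i)
    have h2 := abs_le.1 (hβ k)
    rw [abs_le]
    constructor <;> linarith
  obtain ⟨φ, hφ, hE⟩ := expSum_expansion (x := fun w => a + b * β w) hj hS2 hx (by linarith)
  set h : ℝ := (S.card : ℝ) with hh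
  have hh0 : 0 < h := by linarith [pow_pos hν0 19]
  have hh1 : 0 < h - 1 := by norm_num at h19; linarith
  have hm0 : 0 < m := by linarith
  have hjh : (j : ℝ) ≤ h := Nat.cast_le.2 hj
  have hj0 : (0 : ℝ) ≤ j := Nat.cast_nonneg j
  rw [spread_affine] at hφ
  obtain ⟨h5, h6⟩ := factor_bounds hν he hS (by linarith) hj0 hjh (spread_nonneg β S)
    (spread_le hβ S) hb2 hφ
  exact ⟨φ, h5, h6, hE⟩

end Approx

/-- Chernoff-type upper bound for binomial coefficients. -/
lemma choose_upper {h : ℕ} (h0 : 0 < h) (t : ℕ) :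
    (h.choose t : ℝ) ≤ 2 ^ h * Real.exp (-(2 * ((t : ℝ) - h / 2) ^ 2 / h)) := by
  rcases lt_or_ge h t with hlt | hle
  · rw [Nat.choose_eq_zero_of_lt hlt]
    push_cast
    positivity
  have hh : (0 : ℝ) < h := Nat.cast_pos.2 h0
  set l : ℝ := 4 * ((t : ℝ) - h / 2) / h with hl
  have h1 : (h.choose t : ℝ) * Real.exp (l * t) ≤ (Real.exp l + 1) ^ h := by
    rw [add_pow]
    refine le_trans (le_of_eq ?_) (single_le_sum (f := fun k => Real.exp l ^ k * 1 ^ (h - k) *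
      (h.choose k : ℝ)) (fun k _ => by positivity) (mem_range.2 (Nat.lt_succ_of_le hle)))
    simp only [one_pow, mul_one]
    rw [← Real.exp_nat_mul, mul_comm, mul_comm l]
  have h2 : Real.exp l + 1 = Real.exp (l / 2) * (2 * Real.cosh (l / 2)) := by
    have e1 : Real.exp l = Real.exp (l / 2) * Real.exp (l / 2) := by
      rw [← Real.exp_add]; congr 1; ring
    have e2 : Real.exp (l / 2) * Real.exp (-(l / 2)) = 1 := by
      rw [← Real.exp_add]; simp
    rw [Real.cosh_eq, e1, ← e2]
    ring
  have h3 : (Real.exp l + 1) ^ h ≤ 2 ^ h * Real.exp (h * (l / 2 + (l / 2) ^ 2 / 2)) := by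
    rw [Real.exp_nat_mul, ← mul_pow, h2]
    refine pow_le_pow_left₀ (by positivity) ?_ _
    rw [Real.exp_add]
    have := mul_le_mul_of_nonneg_left (Real.cosh_le_exp_half_sq (l / 2)) (Real.exp_pos (l / 2)).le
    linarith
  have h4 : (h.choose t : ℝ) = (h.choose t : ℝ) * Real.exp (l * t) * Real.exp (-(l * t)) := by
    rw [mul_assoc, ← Real.exp_add]; simp
  calc (h.choose t : ℝ) = (h.choose t : ℝ) * Real.exp (l * t) * Real.exp (-(l * t)) := h4
    _ ≤ 2 ^ h * Real.exp (h * (l / 2 + (l / 2) ^ 2 / 2)) * Real.exp (-(l * t)) := by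
      exact mul_le_mul_of_nonneg_right (h1.trans h3) (Real.exp_pos _).le
    _ = _ := by
      rw [mul_assoc, ← Real.exp_add]
      congr 2
      rw [hl]
      field_simp
      ring

lemma linear_algebra {q r n s b κ z y BS BC α : ℝ} (hq : q ≠ 0) (hr : r ≠ 0) (hn : n = r ^ 2)
    (hb : b = 2 * κ / q) :
    b * ((1 - z) / 2 * BS + (1 - y) / 2 * BC - (1 - 1 / n + α * s / n) / 2 * (BS + BC)) -
      (-(α * (BS + BC) / (q * r)) - (z * BS + y * BC) / q) =
    (1 - κ) * ((z * BS + y * BC) / q) + κ * (BS + BC) / n / q +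
      α * (BS + BC) / (q * r) * (1 - κ * (s / r)) := by
  rw [hb, hn]
  field_simp
  ring

lemma linear_bound {ν e κ P X Y g : ℝ} (hν : 10 ^ 6 ≤ ν) (he : e = 1 / ν ^ 9)
    (hκ : |κ - 1| ≤ 3 * e) (hP : |P| ≤ 16 * ν ^ 3) (hX : |X| ≤ 4 * e) (hY : |Y| ≤ 2 * ν ^ 2)
    (hg : |1 - g| ≤ 5 * e) : |(1 - κ) * P + X + Y * (1 - g)| ≤ 1 / ν ^ 3 := by
  have hν0 : 0 < ν := by linarith
  have he0 : 0 < e := by rw [he]; positivity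
  have h1 : 1 ≤ ν ^ 3 := one_le_pow₀ (by linarith)
  have h2 : ν ^ 2 ≤ ν ^ 3 := pow_le_pow_right₀ (by linarith) (by norm_num)
  have h3 := mul_pow_le_pow_of_lt hν (show 3 < 6 by norm_num)
  rw [abs_sub_comm] at hκ
  calc |(1 - κ) * P + X + Y * (1 - g)| ≤ |(1 - κ) * P| + |X| + |Y * (1 - g)| := abs_add_three _ _ _
    _ ≤ 3 * e * (16 * ν ^ 3) + 4 * e + 2 * ν ^ 2 * (5 * e) := by
      rw [abs_mul, abs_mul]
      gcongr
    _ ≤ 62 * (e * ν ^ 3) := by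
      have h4 : e * 1 ≤ e * ν ^ 3 := by gcongr
      have h5 : e * ν ^ 2 ≤ e * ν ^ 3 := by gcongr
      linarith
    _ = 62 / ν ^ 6 := by rw [he]; field_simp
    _ ≤ 1 / ν ^ 3 := by
      rw [div_le_div_iff₀ (by positivity) (by positivity)]
      linarith [pow_pos hν0 3]

lemma abs_dev_mul_le {ν h t B : ℝ} (hh : 0 < h) (ht : |t - h / 2| ≤ 2 * ν ^ 12)
    (hB : |B| ≤ h * ν) : |(1 - 2 * t / h) * B| ≤ 4 * ν ^ 13 := by
  have e : (1 - 2 * t / h) = -(2 * (t - h / 2)) / h := by field_simp; ring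
  rw [e, abs_mul, abs_div, abs_neg, abs_mul, abs_two, abs_of_pos hh]
  calc 2 * |t - h / 2| / h * |B| ≤ 2 * (2 * ν ^ 12) / h * (h * ν) := by gcongr
    _ = 4 * ν ^ 13 := by field_simp; ring

lemma abs_one_sub_mul_le {e κ g : ℝ} (he1 : e ≤ 1 / 1000) (hκ : |κ - 1| ≤ 3 * e)
    (hg0 : 1 - e ≤ g) (hg1 : g ≤ 1) : |1 - κ * g| ≤ 5 * e := by
  have h1 := abs_le.1 hκ
  rw [abs_le]
  constructor <;> nlinarith

lemma linear_near {ν m n h t d α BS BC : ℝ} (hν : 10 ^ 6 ≤ ν) (hn : n = ν ^ 20)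
    (hm : |m - n| ≤ ν ^ 11) (hα : |α| ≤ ν) (hh : 0 < h) (hnh : 0 < n - h)
    (hBS : |BS| ≤ h * ν) (hBC : |BC| ≤ (n - h) * ν) (ht : |t - h / 2| ≤ 2 * ν ^ 12)
    (hdt : |(d - t) - (n - h) / 2| ≤ 2 * ν ^ 12)
    (hd : d = (n - 1) / 2 + α * Real.sqrt (n - 1) / 2) :
    |tilt m n * (t / h * BS + (d - t) / (n - h) * BC - d / n * (BS + BC)) -
      (-(α * (BS + BC) / Real.sqrt (m * n)) -
        ((1 - 2 * t / h) * BS + (1 - 2 * (d - t) / (n - h)) * BC) / Real.sqrt m)| ≤ 1 / ν ^ 3 := by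
  have hν0 : 0 < ν := by linarith
  obtain ⟨h1, h2, h3, h4⟩ := tilt_aux hν hn hm
  norm_num at h1 h2
  have hm0 : 0 < m := by linarith
  have hn0 : 0 < n := by linarith
  have hκ := tilt_sqrt_near hν hn hm
  set e : ℝ := 1 / ν ^ 9 with he
  have h3e : 3 / ν ^ 9 = 3 * e := by rw [he]; ring
  rw [h3e] at hκ
  have he0 : 0 < e := by positivity
  have he1 : e ≤ 1 / 1000 := by
    rw [he]; exact one_div_le_one_div_of_le (by norm_num) (by linarith)
  have hr := sqrt_scale hν hn
  have hr0 : 0 < Real.sqrt n := Real.sqrt_pos.2 hn0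
  have hq0 : 0 < Real.sqrt m := Real.sqrt_pos.2 hm0
  have hq : ν ^ 10 / 2 ≤ Real.sqrt m := by
    rw [← hr]
    apply Real.le_sqrt_of_sq_le
    rw [div_pow, Real.sq_sqrt hn0.le]
    linarith
  rw [Real.sqrt_mul hm0.le]
  set q := Real.sqrt m with hq'
  set r := Real.sqrt n with hr'
  set s := Real.sqrt (n - 1) with hs'
  set κ := tilt m n * q / 2 with hκ'
  have hrn : n = r ^ 2 := (Real.sq_sqrt hn0.le).symm
  have hb : tilt m n = 2 * κ / q := by rw [hκ']; field_simp
  have e1 : t / h = (1 - (1 - 2 * t / h)) / 2 := by ring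
  have e2 : (d - t) / (n - h) = (1 - (1 - 2 * (d - t) / (n - h))) / 2 := by ring
  have e3 : d / n = (1 - 1 / n + α * s / n) / 2 := by rw [hd]; field_simp
  have hz := abs_dev_mul_le hh ht hBS
  have hy := abs_dev_mul_le hnh hdt hBC
  rw [e3]
  nth_rewrite 1 [e1]
  nth_rewrite 1 [e2]
  rw [linear_algebra hq0.ne' hr0.ne' hrn hb]
  have hκ1 := abs_le.1 hκ
  have hB : |BS + BC| ≤ n * ν := by
    refine (abs_add_le _ _).trans ?_
    linarith
  refine linear_bound hν he hκ ?_ ?_ ?_ ?_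
  · rw [abs_div, abs_of_pos hq0, div_le_iff₀ hq0]
    calc |(1 - 2 * t / h) * BS + (1 - 2 * (d - t) / (n - h)) * BC| ≤ 4 * ν ^ 13 + 4 * ν ^ 13 :=
          (abs_add_le _ _).trans (add_le_add hz hy)
      _ = 16 * ν ^ 3 * (ν ^ 10 / 2) := by ring
      _ ≤ 16 * ν ^ 3 * q := by gcongr
  · rw [abs_div, abs_div, abs_mul, abs_of_pos hq0, abs_of_pos hn0,
      abs_of_nonneg (by linarith : 0 ≤ κ), div_div, div_le_iff₀ (by positivity)]
    calc κ * |BS + BC| ≤ 2 * (n * ν) := by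
          gcongr
          linarith
      _ = 4 * (1 / ν ^ 9) * (n * (ν ^ 10 / 2)) := by field_simp; norm_num
      _ ≤ 4 * e * (n * q) := by rw [he]; gcongr
  · rw [abs_div, abs_mul, abs_of_pos (mul_pos hq0 hr0), div_le_iff₀ (by positivity)]
    calc |α| * |BS + BC| ≤ ν * (n * ν) := by gcongr
      _ = 2 * ν ^ 2 * (r / 2 * r) := by rw [hrn]; ring
      _ ≤ 2 * ν ^ 2 * (q * r) := by
        gcongr
        rw [hr]
        exact hq
  · have hsr1 : s / r ≤ 1 := by
      rw [div_le_one hr0]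
      exact Real.sqrt_le_sqrt (by linarith)
    have hsr0 : 0 ≤ s / r := by positivity
    have hsr2 : 1 - e ≤ s / r := by
      have h5 : (s / r) ^ 2 = 1 - 1 / n := by
        rw [div_pow, ← hrn, Real.sq_sqrt (by linarith)]
        field_simp
      have h6 : 1 / n ≤ e := by
        rw [he, hn]
        exact one_div_le_one_div_of_le (by positivity)
          (pow_le_pow_right₀ (by linarith) (by norm_num))
      have h7 : (s / r) ^ 2 ≤ s / r := by
        rw [sq]; exact mul_le_of_le_one_left hsr0 hsr1
      linarith
    exact abs_one_sub_mul_le he1 hκ hsr2 hsr1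

lemma crude_linear {ν b n h t d BS BC : ℝ} (hν : 10 ^ 6 ≤ ν) (hb : b * (2 * ν) ≤ 5 / ν ^ 9)
    (hb0 : 0 ≤ b) (hh : 0 < h) (hnh : 0 < n - h)
    (hBS : |BS| ≤ h * ν) (hBC : |BC| ≤ (n - h) * ν) (ht : ν ^ 12 ≤ |t - h / 2|)
    (hd : |d - n / 2| ≤ ν ^ 11) :
    |b * (t / h * BS + (d - t) / (n - h) * BC - d / n * (BS + BC))| ≤
      10 / ν ^ 9 * |t - h / 2| := by
  have hn : 0 < n := by linarith
  have hν0 : 0 < ν := by linarith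
  set D := |t - d * h / n| with hD
  have hD1 : D ≤ 2 * |t - h / 2| := by
    have e : t - d * h / n = (t - h / 2) - (d - n / 2) * (h / n) := by field_simp; ring
    have h1 : |(d - n / 2) * (h / n)| ≤ ν ^ 11 := by
      rw [abs_mul, abs_of_pos (div_pos hh hn)]
      have : h / n ≤ 1 := (div_le_one hn).2 (by linarith)
      exact (mul_le_of_le_one_right (abs_nonneg _) this).trans hd
    have h2 := mul_pow_le_pow_of_lt hν (show 11 < 12 by norm_num)
    rw [hD, e]
    refine (abs_sub _ _).trans ?_
    linarith [pow_pos hν0 11]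
  have e1 : t / h * BS + (d - t) / (n - h) * BC - d / n * (BS + BC) =
      (t - d * h / n) / h * BS - (t - d * h / n) / (n - h) * BC := by
    field_simp
    ring
  have h1 : |(t - d * h / n) / h * BS| ≤ D * ν := by
    rw [abs_mul, abs_div, abs_of_pos hh]
    calc D / h * |BS| ≤ D / h * (h * ν) := by gcongr
      _ = D * ν := by field_simp
  have h2 : |(t - d * h / n) / (n - h) * BC| ≤ D * ν := by
    rw [abs_mul, abs_div, abs_of_pos hnh]
    calc D / (n - h) * |BC| ≤ D / (n - h) * ((n - h) * ν) := by gcongr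
      _ = D * ν := by field_simp
  rw [e1, abs_mul, abs_of_nonneg hb0]
  calc b * |(t - d * h / n) / h * BS - (t - d * h / n) / (n - h) * BC|
      ≤ b * (D * ν + D * ν) := by
        gcongr
        exact (abs_sub _ _).trans (add_le_add h1 h2)
    _ = b * (2 * ν) * D := by ring
    _ ≤ 5 / ν ^ 9 * (2 * |t - h / 2|) := by gcongr
    _ = _ := by ring

lemma crude_exponent {ν n τ X : ℝ} (hν : 10 ^ 6 ≤ ν) (hn : n = ν ^ 20) (hτ : ν ^ 12 ≤ τ)
    (hX : X ≤ 40 * ν ^ 2 + 10 / ν ^ 9 * τ) : X - 2 * τ ^ 2 / n ≤ -τ ^ 2 / n := by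
  have hν0 : 0 < ν := by linarith
  have hτ0 : 0 < τ := (pow_pos hν0 12).trans_le hτ
  have h1 : 10 / ν ^ 9 * τ ≤ 1 / 2 * (τ ^ 2 / n) := by
    rw [hn, div_mul_eq_mul_div, ← mul_div_assoc, div_le_div_iff₀ (by positivity) (by positivity)]
    have h2 := mul_pow_le_pow_of_lt hν (show 11 < 12 by norm_num)
    calc 10 * τ * ν ^ 20 = (10 * ν ^ 11) * (τ * ν ^ 9) := by ring
      _ ≤ (1 / 2 * τ) * (τ * ν ^ 9) :=
        mul_le_mul_of_nonneg_right (by linarith [pow_pos hν0 11]) (by positivity)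
      _ = _ := by ring
  have h2 : 40 * ν ^ 2 ≤ 1 / 2 * (τ ^ 2 / n) := by
    rw [← mul_div_assoc, hn, le_div_iff₀ (by positivity)]
    have h3 := mul_pow_le_pow_of_lt hν (show 22 < 24 by norm_num)
    calc 40 * ν ^ 2 * ν ^ 20 = 40 * ν ^ 22 := by ring
      _ ≤ 1 / 2 * ν ^ 24 := by linarith [pow_pos hν0 22]
      _ = 1 / 2 * (ν ^ 12) ^ 2 := by ring
      _ ≤ 1 / 2 * τ ^ 2 := by gcongr
  have e1 : 2 * τ ^ 2 / n = 2 * (τ ^ 2 / n) := by ring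
  have e2 : -τ ^ 2 / n = -(τ ^ 2 / n) := by ring
  rw [e1, e2]
  linarith

lemma abs_degree_sub_half_le {ν n d α : ℝ} (hν : 10 ^ 6 ≤ ν) (hn : n = ν ^ 20) (hα : |α| ≤ ν)
    (hd : d = (n - 1) / 2 + α * Real.sqrt (n - 1) / 2) : |d - n / 2| ≤ ν ^ 11 - 1 := by
  have hν0 : 0 < ν := by linarith
  have h1 : |α * Real.sqrt (n - 1)| ≤ ν * ν ^ 10 := by
    rw [abs_mul, abs_of_nonneg (Real.sqrt_nonneg _), ← sqrt_scale hν hn]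
    gcongr
    linarith
  have h2 := abs_le.1 h1
  have h3 := mul_pow_le_pow_of_lt hν (show 0 < 11 by norm_num)
  rw [pow_zero] at h3
  have e : ν * ν ^ 10 = ν ^ 11 := by ring
  rw [e] at h2
  rw [hd, abs_le]
  constructor <;> linarith

section Ratio

variable {W : Type*} [Fintype W] [DecidableEq W]

lemma sum_affine (β : W → ℝ) (S : Finset W) (a b : ℝ) :
    ∑ w ∈ S, (a + b * β w) = S.card * a + b * ∑ w ∈ S, β w := by
  rw [sum_add_distrib, mul_sum]
  simp

lemma abs_sum_le_card_mul {β : W → ℝ} {ν : ℝ} (hβ : ∀ w, |β w| ≤ ν) (S : Finset W) :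
    |∑ w ∈ S, β w| ≤ (S.card : ℝ) * ν := by
  refine (abs_sum_le_sum_abs _ _).trans ?_
  rw [← nsmul_eq_mul]
  exact sum_le_card_nsmul _ _ _ fun w _ => hβ w

lemma exponent_eq {n h t d a b BS BC : ℝ} (hh : h ≠ 0) (hnh : n - h ≠ 0) (hn : n ≠ 0) :
    t / h * (h * a + b * BS) + (d - t) / (n - h) * ((n - h) * a + b * BC) -
      d / n * (n * a + b * (BS + BC)) =
    b * (t / h * BS + (d - t) / (n - h) * BC - d / n * (BS + BC)) := by
  field_simp
  ring

lemma mul_exp_ratio {c₁ c₂ c₃ x₁ x₂ x₃ : ℝ} :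
    c₁ * Real.exp x₁ * (c₂ * Real.exp x₂) / (c₃ * Real.exp x₃) =
      c₁ * c₂ / c₃ * Real.exp (x₁ + x₂ - x₃) := by
  rw [Real.exp_sub, Real.exp_add, mul_mul_mul_comm, mul_div_mul_comm]

/-- The product formula for a row, in a sharp and in a crude form. -/
lemma expSum_ratio {ν m n a α : ℝ} (hν : 10 ^ 6 ≤ ν) (hn : n = ν ^ 20)
    (hcard : (Fintype.card W : ℝ) = n) (hm : |m - n| ≤ ν ^ 11) {β : W → ℝ} (hβ : ∀ w, |β w| ≤ ν)
    (hα : |α| ≤ ν) {S : Finset W} (hS : ν ^ 19 ≤ (S.card : ℝ)) (hSc : ν ^ 19 ≤ n - (S.card : ℝ))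
    {t d : ℕ} (htd : t ≤ d) (htS : t ≤ S.card) (hdS : d - t ≤ Sᶜ.card)
    (hd : (d : ℝ) = (n - 1) / 2 + α * Real.sqrt (n - 1) / 2) {x : W → ℝ}
    (hx : x = fun w => a + tilt m n * β w) :
    ∃ ψ : ℝ, expSum x S t * expSum x Sᶜ (d - t) / expSum x univ d =
        (S.card.choose t : ℝ) * (Sᶜ.card.choose (d - t) : ℝ) / ((Fintype.card W).choose d : ℝ) *
          Real.exp ψ ∧
      (|(t : ℝ) - (S.card : ℝ) / 2| ≤ ν ^ 12 →
        |ψ - (-(α * (∑ w, β w) / Real.sqrt (m * n)) - ((1 - 2 * t / (S.card : ℝ)) * ∑ w ∈ S, β w +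
          (1 - 2 * ((d : ℝ) - t) / (n - (S.card : ℝ))) * ∑ w ∈ Sᶜ, β w) / Real.sqrt m +
          1 / (4 * m * (S.card : ℝ)) * spread β S +
          1 / (4 * m * (n - (S.card : ℝ))) * spread β Sᶜ -
          1 / (4 * m * n) * spread β univ)| ≤ 4 / ν ^ 3) ∧
      (ν ^ 12 ≤ |(t : ℝ) - (S.card : ℝ) / 2| →
        ψ ≤ 15 * ν ^ 2 + 10 / ν ^ 9 * |(t : ℝ) - (S.card : ℝ) / 2|) := by
  have hν0 : 0 < ν := by linarith
  have h19 : 0 < ν ^ 19 := by positivity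
  have hsc : ((Sᶜ : Finset W).card : ℝ) = n - (S.card : ℝ) := by
    rw [card_compl, Nat.cast_sub (card_le_univ S), hcard]
  have hdn : d ≤ (univ : Finset W).card := by
    rw [card_univ, ← card_add_card_compl S]
    omega
  have hn0 : 0 < n := by linarith
  have h1920 : ν ^ 19 ≤ n := by linarith
  have hcu : ((univ : Finset W).card : ℝ) = n := by rw [card_univ, hcard]
  obtain ⟨φ₁, hφ₁, hs₁, hE₁⟩ := expSum_tilt (a := a) hν hn hm hβ hS (by linarith) htS
  obtain ⟨φ₂, hφ₂, hs₂, hE₂⟩ := expSum_tilt (a := a) hν hn hm hβ (S := Sᶜ) (by rw [hsc]; exact hSc)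
    (by rw [hsc]; linarith) hdS
  obtain ⟨φ₃, hφ₃, hs₃, hE₃⟩ := expSum_tilt (a := a) hν hn hm hβ (S := univ) (by rw [hcu]; exact h1920)
    hcu.le hdn
  have hdt : ((d - t : ℕ) : ℝ) = (d : ℝ) - t := Nat.cast_sub htd
  have hsum : ∑ w, β w = ∑ w ∈ S, β w + ∑ w ∈ Sᶜ, β w := (sum_add_sum_compl S β).symm
  have hBS := abs_sum_le_card_mul hβ S
  have hBC := abs_sum_le_card_mul hβ Sᶜ
  rw [sum_affine] at hE₁ hE₂ hE₃
  rw [hsc, hdt] at hE₂ hs₂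
  rw [hcu, hsum] at hE₃
  rw [hcu] at hs₃
  rw [hsc] at hBC
  rw [card_univ] at hE₃
  rw [hsum]
  set h : ℝ := (S.card : ℝ) with hh
  set BS := ∑ w ∈ S, β w with hBS'
  set BC := ∑ w ∈ Sᶜ, β w with hBC'
  have hh0 : 0 < h := by linarith
  have hnh0 : 0 < n - h := by linarith
  have hd' := abs_degree_sub_half_le hν hn hα hd
  have hd1 := abs_le.1 hd'
  have hexp := exponent_eq (t := (t : ℝ)) (d := (d : ℝ)) (a := a) (b := tilt m n) (BS := BS)
    (BC := BC) hh0.ne' hnh0.ne' hn0.ne'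
  have h1112 := mul_pow_le_pow_of_lt hν (show 11 < 12 by norm_num)
  have h11 : 0 < ν ^ 11 := by positivity
  refine ⟨t / h * (h * a + tilt m n * BS) + φ₁ + (((d : ℝ) - t) / (n - h) *
    ((n - h) * a + tilt m n * BC) + φ₂) - (d / n * (n * a + tilt m n * (BS + BC)) + φ₃), ?_, ?_, ?_⟩
  · rw [hx, hE₁, hE₂, hE₃, mul_exp_ratio]
  · intro ht
    have ht' := abs_le.1 ht
    have g1 := abs_le.1 (hs₁ (by linarith))
    have g2 := abs_le.1 (hs₂ (by rw [abs_le]; constructor <;> linarith))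
    have g3 := abs_le.1 (hs₃ (by linarith))
    have g4 := abs_le.1 (linear_near hν hn hm hα hh0 hnh0 hBS hBC (by linarith)
      (by rw [abs_le]; constructor <;> linarith) hd)
    rw [← hexp] at g4
    have e4 : 4 / ν ^ 3 = 4 * (1 / ν ^ 3) := by ring
    rw [abs_le, e4]
    constructor <;> linarith
  · intro ht
    have g4 := abs_le.1 (crude_linear hν (tilt_mul_le hν hn hm) (tilt_nonneg hν hn hm) hh0 hnh0 hBS
      hBC ht (by linarith))
    rw [← hexp] at g4
    have g1 := abs_le.1 hφ₁
    have g2 := abs_le.1 hφ₂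
    have g3 := abs_le.1 hφ₃
    linarith

end Ratio

lemma tail_bound {ν n ψ : ℝ} {N h k d t s : ℕ} (hν : 10 ^ 6 ≤ ν) (hn : n = ν ^ 20)
    (hN : (N : ℝ) = n) (hhk : h + k = N) (h0 : 0 < h) (hd : |(d : ℝ) - n / 2| ≤ ν ^ 11)
    (ht : ν ^ 12 ≤ |(t : ℝ) - h / 2|) (hψ : ψ ≤ 15 * ν ^ 2 + 10 / ν ^ 9 * |(t : ℝ) - h / 2|) :
    Real.exp (16 * (ν ^ 2)⁻¹) *
      ((h.choose t : ℝ) * (k.choose s : ℝ) / (N.choose d : ℝ) * Real.exp ψ) ≤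
      Real.exp (-((t : ℝ) - h / 2) ^ 2 / n) := by
  have hν0 : 0 < ν := by linarith
  have hn0 : 0 < n := by rw [hn]; positivity
  have hh0 : (0 : ℝ) < h := Nat.cast_pos.2 h0
  have hhn : (h : ℝ) ≤ n := by
    rw [← hN, ← hhk]; push_cast; linarith [Nat.cast_nonneg (α := ℝ) k]
  set τ := |(t : ℝ) - h / 2| with hτ
  have hτ2 : ((t : ℝ) - h / 2) ^ 2 = τ ^ 2 := (sq_abs _).symm
  have c1 : (h.choose t : ℝ) ≤ 2 ^ h * Real.exp (-(2 * τ ^ 2 / n)) := by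
    refine (choose_upper h0 t).trans ?_
    rw [hτ2]
    gcongr
  have c2 : (k.choose s : ℝ) ≤ 2 ^ k := by exact_mod_cast Nat.choose_le_two_pow k s
  have p11 : 1 ≤ ν ^ 11 := one_le_pow₀ (by linarith)
  have p1 := mul_pow_le_pow_of_lt hν (show 11 < 20 by norm_num)
  have p2 := mul_pow_le_pow_of_lt hν (show 20 < 21 by norm_num)
  rw [← hn] at p1 p2
  have c3 : (2 : ℝ) ^ N * Real.exp (-(17 * ν ^ 2)) ≤ (N.choose d : ℝ) := by
    refine le_trans ?_ (choose_lower (n := N) (D := ν ^ 11) p11 (by rw [hN]; linarith)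
      (by rw [hN]; exact hd))
    rw [le_div_iff₀ (by positivity), hN]
    have e1 : 16 * (ν ^ 11) ^ 2 / n = 16 * ν ^ 2 := by rw [hn]; field_simp
    have e2 : n + 1 ≤ Real.exp (ν ^ 2) :=
      le_trans (by linarith) (pow_le_exp_sq hν (show 21 ≤ 10 ^ 6 by norm_num))
    have e3 : Real.exp (-(16 * ν ^ 2)) = Real.exp (-(17 * ν ^ 2)) * Real.exp (ν ^ 2) := by
      rw [← Real.exp_add]; congr 1; ring
    rw [e1, e3, mul_assoc]
    gcongr
  have c4 : (h.choose t : ℝ) * (k.choose s : ℝ) / (N.choose d : ℝ) ≤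
      Real.exp (17 * ν ^ 2 - 2 * τ ^ 2 / n) := by
    rw [div_le_iff₀ (lt_of_lt_of_le (by positivity) c3)]
    calc (h.choose t : ℝ) * (k.choose s : ℝ) ≤ 2 ^ h * Real.exp (-(2 * τ ^ 2 / n)) * 2 ^ k := by
          gcongr
      _ = Real.exp (17 * ν ^ 2 - 2 * τ ^ 2 / n) * (2 ^ N * Real.exp (-(17 * ν ^ 2))) := by
          rw [← hhk, pow_add, sub_eq_add_neg, Real.exp_add, Real.exp_neg (17 * ν ^ 2)]
          field_simp
      _ ≤ _ := by gcongr
  have e5 : 16 * (ν ^ 2)⁻¹ ≤ ν ^ 2 := by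
    have p3 : 10 ^ 6 * ν ^ 0 ≤ ν ^ 2 := mul_pow_le_pow_of_lt hν (by norm_num)
    have p4 : (ν ^ 2)⁻¹ ≤ 1 := inv_le_one_of_one_le₀ (by linarith)
    linarith
  calc Real.exp (16 * (ν ^ 2)⁻¹) *
      ((h.choose t : ℝ) * (k.choose s : ℝ) / (N.choose d : ℝ) * Real.exp ψ)
      ≤ Real.exp (16 * (ν ^ 2)⁻¹) * (Real.exp (17 * ν ^ 2 - 2 * τ ^ 2 / n) * Real.exp ψ) := by
        gcongr
    _ = Real.exp ((16 * (ν ^ 2)⁻¹ + 17 * ν ^ 2 + ψ) - 2 * τ ^ 2 / n) := by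
        rw [← Real.exp_add, ← Real.exp_add]; congr 1; ring
    _ ≤ Real.exp (-τ ^ 2 / n) := by
        refine Real.exp_le_exp.2 (crude_exponent hν hn ht ?_)
        linarith [sq_nonneg ν]
    _ = _ := by rw [neg_div, neg_div, hτ2]

lemma spread_univ {W : Type*} [Fintype W] (β : W → ℝ) :
    spread β univ = 2 * (Fintype.card W : ℝ) * ∑ w, β w ^ 2 - 2 * (∑ w, β w) ^ 2 := by
  have e : ∀ i k : W, (β i - β k) ^ 2 = β i ^ 2 + β k ^ 2 - 2 * (β i * β k) := fun i k => by ring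
  simp only [spread, e, sum_sub_distrib, sum_add_distrib, ← mul_sum, ← sum_mul]
  simp only [sum_const, card_univ, nsmul_eq_mul, ← mul_sum]
  ring

lemma lam_eq {m n : ℕ} (hm : 0 < m) (hn : 0 < n) (dV : Fin m → ℕ) (dW : Fin n → ℕ) (u : Fin m)
    (S : Finset (Fin n)) (t : ℕ) :
    bLam1 m n dV dW u - bLam2 m n dV dW u S t - bLam3 m n dW + bLam4 m n dW S =
      -(normDev n (dV u) * (∑ w, normDev n (dW w)) / Real.sqrt (m * n)) -
        ((1 - 2 * t / (S.card : ℝ)) * ∑ w ∈ S, normDev n (dW w) +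
          (1 - 2 * ((dV u : ℝ) - t) / (n - (S.card : ℝ))) * ∑ w ∈ Sᶜ, normDev n (dW w)) /
          Real.sqrt m +
        1 / (4 * m * (S.card : ℝ)) * spread (fun w => normDev n (dW w)) S +
        1 / (4 * m * (n - (S.card : ℝ))) * spread (fun w => normDev n (dW w)) Sᶜ -
        1 / (4 * m * n) * spread (fun w => normDev n (dW w)) univ := by
  rw [spread_univ, Fintype.card_fin]
  have hm0 : (0 : ℝ) < m := Nat.cast_pos.2 hm
  have hn0 : (0 : ℝ) < n := Nat.cast_pos.2 hn
  have h1 : bLam1 m n dV dW u = (∑ w, normDev n (dW w)) ^ 2 / (2 * m * n) -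
      normDev n (dV u) * (∑ w, normDev n (dW w)) / Real.sqrt (m * n) := by
    have hr : 0 < Real.sqrt ((m : ℝ) * n) := Real.sqrt_pos.2 (mul_pos hm0 hn0)
    have hr2 := Real.sq_sqrt (mul_pos hm0 hn0).le
    rw [bLam1]
    set r := Real.sqrt ((m : ℝ) * n) with hr'
    rw [mul_assoc 2 (m : ℝ), ← hr2]
    field_simp
  have h2 : bLam2 m n dV dW u S t = ((1 - 2 * t / (S.card : ℝ)) * ∑ w ∈ S, normDev n (dW w) +
      (1 - 2 * ((dV u : ℝ) - t) / (n - (S.card : ℝ))) * ∑ w ∈ Sᶜ, normDev n (dW w)) /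
        Real.sqrt m := by
    rw [bLam2, add_div, ← sum_div, ← sum_div, mul_sum, mul_sum]
  have h3 : bLam3 m n dW = 1 / (4 * m * n) * (2 * n * ∑ w, normDev n (dW w) ^ 2) := by
    rw [bLam3, ← sum_div]
    field_simp
    ring
  rw [h1, h2, h3, bLam4, spread, spread]
  field_simp
  ring

section Bridge

variable {m n : ℕ} {dV : Fin m → ℕ} {dW : Fin n → ℕ}

lemma bipGraphs_eq : bipGraphs m n dV dW = biClass dV dW := by
  ext E
  simp only [bipGraphs, biClass, mem_filter]
  rfl

lemma bipProb_eq (u : Fin m) (S : Finset (Fin n)) (t : ℕ) :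
    bipProb m n dV dW u S t = (((biClass dV dW).filter fun E =>
      (S.filter fun w => E u w = true).card = t).card : ℝ) / ((biClass dV dW).card : ℝ) := by
  rw [bipProb, bipGraphs_eq]

lemma eq_normDev {n : ℕ} (hn : 1 < n) (x : ℕ) :
    (x : ℝ) = ((n : ℝ) - 1) / 2 + normDev n x * Real.sqrt ((n : ℝ) - 1) / 2 := by
  have h : 0 < (n : ℝ) - 1 := by
    have : (1 : ℝ) < n := Nat.one_lt_cast.2 hn
    linarith
  rw [normDev, div_mul_cancel₀ _ (Real.sqrt_pos.2 h).ne']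
  ring

lemma near_reduced {ν : ℝ} (hν : 10 ^ 6 ≤ ν) (hn : (n : ℝ) = ν ^ 20)
    (hm : |(m : ℝ) - n| ≤ ν ^ 11 - 1) (hsum : ∑ v, dV v = ∑ w, dW w)
    (hα : ∀ v, |normDev n (dV v)| ≤ ν) (hβ : ∀ w, |normDev n (dW w)| ≤ ν) (u : Fin m)
    (hc : ∀ w, 1 ≤ dW w) (T : Finset (Fin n)) (hT : T.card = dV u) :
    Near ν (fun v : {v : Fin m // v ≠ u} => dV v) (residualDeg dW T) := by
  have hn1 : 1 < n := by
    have h1 : (1 : ℝ) < n := by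
      rw [hn]; exact one_lt_pow₀ (by linarith) (by norm_num)
    exact_mod_cast h1
  have hres : ∀ w, (residualDeg dW T w : ℝ) = dW w - if w ∈ T then 1 else 0 := by
    intro w
    have hw := hc w
    rw [residualDeg]
    split_ifs
    · rw [Nat.cast_sub hw]; simp
    · simp
  have hm' := abs_le.1 hm
  have hcard : Fintype.card {v : Fin m // v ≠ u} = m - 1 := by
    rw [Fintype.card_subtype_compl, Fintype.card_fin]
    simp
  have hm1 : 1 ≤ m := Nat.one_le_of_lt u.2
  refine ⟨hν, by rw [Fintype.card_fin, hn], ?_, ?_, ?_, ?_⟩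
  · rw [hcard, Nat.cast_sub hm1, ← hn, abs_le]
    push_cast
    constructor <;> linarith
  · intro v
    have := abs_degree_sub_half_le hν hn (hα v) (eq_normDev hn1 _)
    rw [hn] at this
    exact this.trans (by linarith)
  · intro w
    have := abs_degree_sub_half_le hν hn (hβ w) (eq_normDev hn1 _)
    rw [hn] at this
    have := abs_le.1 this
    rw [hres, abs_le]
    split_ifs <;> constructor <;> linarith
  · have h1 : ∑ v, dV v = dV u + ∑ v : {v : Fin m // v ≠ u}, dV v :=
      Fintype.sum_eq_add_sum_subtype_ne dV u
    have h2 : (∑ w, (residualDeg dW T w : ℝ)) = ∑ w, (dW w : ℝ) - T.card := by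
      simp only [hres, sum_sub_distrib]
      simp
    have h3 : ((∑ v : {v : Fin m // v ≠ u}, dV v : ℕ) : ℝ) = ((∑ w, residualDeg dW T w : ℕ) : ℝ) := by
      rw [Nat.cast_sum (univ : Finset (Fin n)), h2, hT, ← Nat.cast_sum, ← hsum, h1]
      push_cast
      ring
    exact_mod_cast h3

/-- Near-regular degree sequences with equal sums are bipartite-graphic. -/
lemma bip_exists {ν : ℝ} (hν : 10 ^ 6 ≤ ν) (hn : (n : ℝ) = ν ^ 20)
    (hm : |(m : ℝ) - n| ≤ ν ^ 11 - 1) (hsum : ∑ v, dV v = ∑ w, dW w)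
    (hα : ∀ v, |normDev n (dV v)| ≤ ν) (hβ : ∀ w, |normDev n (dW w)| ≤ ν) (u : Fin m) :
    ∃ E : Fin m → Fin n → Bool, (∀ v, bdegV E v = dV v) ∧ ∀ w, bdegW E w = dW w := by
  have hν0 : 0 < ν := by linarith
  have hn1 : 1 < n := by
    have h1 : (1 : ℝ) < n := by
      rw [hn]; exact one_lt_pow₀ (by linarith) (by norm_num)
    exact_mod_cast h1
  have p11 := mul_pow_le_pow_of_lt hν (show 11 < 20 by norm_num)
  have p0 : 10 ^ 6 * ν ^ 0 ≤ ν ^ 11 := mul_pow_le_pow_of_lt hν (by norm_num)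
  rw [pow_zero] at p0
  rw [← hn] at p11
  have hdu := abs_le.1 (abs_degree_sub_half_le hν hn (hα u) (eq_normDev hn1 _))
  have hc : ∀ w, 1 ≤ dW w := by
    intro w
    have := abs_le.1 (abs_degree_sub_half_le hν hn (hβ w) (eq_normDev hn1 _))
    have h1 : (1 : ℝ) ≤ dW w := by linarith
    exact_mod_cast h1
  have hu : dV u ≤ Fintype.card (Fin n) := by
    rw [Fintype.card_fin]
    have h1 : (dV u : ℝ) ≤ n := by linarith
    exact_mod_cast h1
  obtain ⟨hpos, -, -⟩ := prob_row_near (ν := ν) u hc hu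
    (near_reduced hν hn hm hsum hα hβ u hc)
    (x := fun w => 4 / (Fintype.card {v : Fin m // v ≠ u} : ℝ) * (dW w : ℝ)) (fun _ => rfl) ∅
    (Nat.zero_le (dV u))
  obtain ⟨E, hE⟩ := card_pos.1 hpos
  simp only [biClass, mem_filter] at hE
  exact ⟨E, hE.2⟩

/-- The law of the number of neighbours of `u` in `S`, in terms of a scale `ν = n ^ (1 / 20)`. -/
lemma bip_core {ν : ℝ} (hν : 10 ^ 6 ≤ ν) (hn : (n : ℝ) = ν ^ 20)
    (hm : |(m : ℝ) - n| ≤ ν ^ 11 - 1) (hsum : ∑ v, dV v = ∑ w, dW w)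
    (hα : ∀ v, |normDev n (dV v)| ≤ ν) (hβ : ∀ w, |normDev n (dW w)| ≤ ν) (u : Fin m)
    (S : Finset (Fin n)) (hS : ν ^ 19 ≤ (S.card : ℝ)) (hSc : ν ^ 19 ≤ (n : ℝ) - S.card)
    {t : ℕ} (ht : t ≤ dV u) :
    (ν ^ 12 < |(t : ℝ) - (S.card : ℝ) / 2| →
      bipProb m n dV dW u S t ≤ Real.exp (-((t : ℝ) - (S.card : ℝ) / 2) ^ 2 / n)) ∧
    (|(t : ℝ) - (S.card : ℝ) / 2| ≤ ν ^ 12 → ∃ δ : ℝ, |δ| ≤ 20 / ν ^ 2 ∧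
      bipProb m n dV dW u S t =
        ((S.card.choose t : ℝ) * ((n - S.card).choose (dV u - t) : ℝ) / (n.choose (dV u) : ℝ)) *
          Real.exp (bLam1 m n dV dW u - bLam2 m n dV dW u S t - bLam3 m n dW +
            bLam4 m n dW S + δ)) := by
  have hν0 : 0 < ν := by linarith
  have hn1 : 1 < n := by
    have h1 : (1 : ℝ) < n := by
      rw [hn]; exact one_lt_pow₀ (by linarith) (by norm_num)
    exact_mod_cast h1
  have hm1 : 1 ≤ m := Nat.one_le_of_lt u.2
  have p11 := mul_pow_le_pow_of_lt hν (show 11 < 20 by norm_num)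
  have p12 := mul_pow_le_pow_of_lt hν (show 12 < 19 by norm_num)
  have p11' := mul_pow_le_pow_of_lt hν (show 11 < 12 by norm_num)
  have p0 : 10 ^ 6 * ν ^ 0 ≤ ν ^ 11 := mul_pow_le_pow_of_lt hν (by norm_num)
  rw [pow_zero] at p0
  rw [← hn] at p11
  have hdu := abs_le.1 (abs_degree_sub_half_le hν hn (hα u) (eq_normDev hn1 _))
  have hc : ∀ w, 1 ≤ dW w := by
    intro w
    have := abs_le.1 (abs_degree_sub_half_le hν hn (hβ w) (eq_normDev hn1 _))
    have h1 : (1 : ℝ) ≤ dW w := by linarith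
    exact_mod_cast h1
  have hu : dV u ≤ Fintype.card (Fin n) := by
    rw [Fintype.card_fin]
    have h1 : (dV u : ℝ) ≤ n := by linarith
    exact_mod_cast h1
  have hcard : (Fintype.card {v : Fin m // v ≠ u} : ℝ) = (m : ℝ) - 1 := by
    rw [Fintype.card_subtype_compl, Fintype.card_fin, Fintype.card_unique, Nat.cast_sub hm1]
    simp
  have hm' : |(m : ℝ) - n| ≤ ν ^ 11 := hm.trans (by linarith)
  have hm2 := abs_le.1 hm'
  set x : Fin n → ℝ := fun w => 4 / (Fintype.card {v : Fin m // v ≠ u} : ℝ) * (dW w : ℝ) with hx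
  obtain ⟨-, hup, hlo⟩ := prob_row_near (ν := ν) u hc hu
    (near_reduced hν hn hm hsum hα hβ u hc) (x := x) (fun _ => rfl) S ht
  rw [← bipProb_eq] at hup hlo
  set β : Fin n → ℝ := fun w => normDev n (dW w) with hβ'
  have hx' : x = fun w => 2 * ((n : ℝ) - 1) / ((m : ℝ) - 1) + tilt m n * β w := by
    funext w
    rw [hx, hβ']
    simp only
    rw [hcard]
    nth_rewrite 1 [eq_normDev hn1 (dW w)]
    rw [tilt]
    ring
  have hSn : S.card + Sᶜ.card = n := by rw [card_add_card_compl, Fintype.card_fin]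
  have hScard : Sᶜ.card = n - S.card := by omega
  have hS0 : 0 < S.card := by
    have : (0 : ℝ) < S.card := (pow_pos hν0 19).trans_le hS
    exact_mod_cast this
  refine ⟨?_, ?_⟩
  · intro hτ
    by_cases hin : t ≤ S.card ∧ dV u - t ≤ Sᶜ.card
    · obtain ⟨ψ, h1, -, h3⟩ := expSum_ratio hν hn (by rw [Fintype.card_fin]) hm' hβ (hα u) hS hSc ht
        hin.1 hin.2 (eq_normDev hn1 _) hx'
      rw [h1, Fintype.card_fin] at hup
      refine hup.trans (tail_bound hν hn rfl hSn hS0 ?_ hτ.le (h3 hτ.le))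
      rw [abs_le]
      constructor <;> linarith
    · have hz : expSum x S t * expSum x Sᶜ (dV u - t) = 0 := by
        rw [mul_eq_zero]
        rcases not_and_or.1 hin with h | h
        · left
          rw [expSum, powersetCard_eq_empty.2 (not_le.1 h), sum_empty]
        · right
          rw [expSum, powersetCard_eq_empty.2 (not_le.1 h), sum_empty]
      rw [hz, zero_div, mul_zero] at hup
      exact hup.trans (Real.exp_pos _).le
  · intro hτ
    have hτ' := abs_le.1 hτ
    have p1 : 0 < ν ^ 12 := by positivity
    have htS : t ≤ S.card := by
      have h1 : (t : ℝ) ≤ S.card := by linarith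
      exact_mod_cast h1
    have hdS : dV u - t ≤ Sᶜ.card := by
      have h1 : ((dV u - t : ℕ) : ℝ) ≤ (Sᶜ.card : ℝ) := by
        rw [Nat.cast_sub ht, hScard, Nat.cast_sub (by omega)]
        linarith
      exact_mod_cast h1
    obtain ⟨ψ, h1, h2, -⟩ := expSum_ratio hν hn (by rw [Fintype.card_fin]) hm' hβ (hα u) hS hSc ht
        htS hdS (eq_normDev hn1 _) hx'
    have h2 := h2 hτ
    rw [← lam_eq (by omega) (by omega)] at h2
    rw [h1, Fintype.card_fin, hScard] at hup hlo
    set Λ := bLam1 m n dV dW u - bLam2 m n dV dW u S t - bLam3 m n dW + bLam4 m n dW S with hΛ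
    set c := (S.card.choose t : ℝ) * ((n - S.card).choose (dV u - t) : ℝ) /
      (n.choose (dV u) : ℝ) with hcc
    have hc0 : 0 < c := by
      rw [hScard] at hdS
      rw [Fintype.card_fin] at hu
      have a1 : (0 : ℝ) < S.card.choose t := Nat.cast_pos.2 (Nat.choose_pos htS)
      have a2 : (0 : ℝ) < (n - S.card).choose (dV u - t) := Nat.cast_pos.2 (Nat.choose_pos hdS)
      have a3 : (0 : ℝ) < n.choose (dV u) := Nat.cast_pos.2 (Nat.choose_pos hu)
      positivity
    set p := bipProb m n dV dW u S t with hp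
    have hp0 : 0 < p := lt_of_lt_of_le (by positivity) hlo
    have hpc : 0 < p / c := div_pos hp0 hc0
    have q1 : Real.log (p / c) ≤ 16 * (ν ^ 2)⁻¹ + ψ := by
      rw [Real.log_le_iff_le_exp hpc, div_le_iff₀ hc0, Real.exp_add]
      linarith
    have q2 : -(16 * (ν ^ 2)⁻¹) + ψ ≤ Real.log (p / c) := by
      rw [Real.le_log_iff_exp_le hpc, le_div_iff₀ hc0, Real.exp_add]
      linarith
    have h4 : 4 / ν ^ 3 ≤ 4 * (ν ^ 2)⁻¹ := by
      rw [div_eq_mul_inv]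
      gcongr
      · linarith
      · norm_num
    have h5 : 20 / ν ^ 2 = 20 * (ν ^ 2)⁻¹ := div_eq_mul_inv _ _
    have h6 := abs_le.1 h2
    refine ⟨Real.log (p / c) - Λ, ?_, ?_⟩
    · rw [h5, abs_le]
      constructor <;> linarith
    · rw [add_sub_cancel, Real.exp_log hpc]
      field_simp

end Bridge

/-- `5 (log n) ^ 2` is eventually at most `n ^ (1 / 20)`. -/
lemma eventually_scale : ∃ n₀ : ℕ, ∀ n : ℕ, n₀ ≤ n →
    10 ^ 6 ≤ (n : ℝ) ^ ((1 : ℝ) / 20) ∧ 1 ≤ Real.log n ∧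
      5 * Real.log n ^ 2 ≤ (n : ℝ) ^ ((1 : ℝ) / 20) := by
  have h1 : ∀ᶠ x : ℝ in Filter.atTop, 10 ^ 6 ≤ x ^ ((1 : ℝ) / 20) :=
    (tendsto_rpow_atTop (by norm_num)).eventually_ge_atTop _
  have h2 : ∀ᶠ x : ℝ in Filter.atTop, 1 ≤ Real.log x :=
    Real.tendsto_log_atTop.eventually_ge_atTop _
  have h3 := (isLittleO_log_rpow_rpow_atTop (s := (1 : ℝ) / 20) (2 : ℝ) (by norm_num)).bound
    (show (0 : ℝ) < 1 / 5 by norm_num)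
  have h4 := tendsto_natCast_atTop_atTop.eventually ((h1.and h2).and h3)
  obtain ⟨N, hN⟩ := Filter.eventually_atTop.1 h4
  refine ⟨N, fun n hn => ?_⟩
  obtain ⟨⟨a, b⟩, d⟩ := hN n hn
  refine ⟨a, b, ?_⟩
  rw [Real.rpow_two, Real.norm_of_nonneg (by positivity), Real.norm_of_nonneg (by positivity)] at d
  linarith

/-- Two near-regular degree sequences with equal sums live on parts of nearly equal size. -/
lemma abs_card_sub_card_le {m n : ℕ} {dV : Fin m → ℕ} {dW : Fin n → ℕ} {ν L : ℝ}
    (hν : 10 ^ 6 ≤ ν) (hn : (n : ℝ) = ν ^ 20) (hL1 : 1 ≤ L) (hL : 5 * L ^ 2 ≤ ν)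
    (hsum : ∑ v, dV v = ∑ w, dW w) (hα : ∀ v, |normDev n (dV v)| ≤ L)
    (hβ : ∀ w, |normDev n (dW w)| ≤ L) (hmn : (m : ℝ) ≤ n * L) :
    |(m : ℝ) - n| ≤ ν ^ 11 - 1 := by
  have hν0 : 0 < ν := by linarith
  have hn1 : 1 < n := by
    have h1 : (1 : ℝ) < n := by
      rw [hn]; exact one_lt_pow₀ (by linarith) (by norm_num)
    exact_mod_cast h1
  have hn1' : (1 : ℝ) < n := by exact_mod_cast hn1
  have hn0 : (0 : ℝ) < n := by linarith
  have hs0 : 0 < √((n : ℝ) - 1) := Real.sqrt_pos.2 (by linarith)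
  have hss : √((n : ℝ) - 1) * √((n : ℝ) - 1) = n - 1 := Real.mul_self_sqrt (by linarith)
  have hcast : ∑ v, (dV v : ℝ) = ∑ w, (dW w : ℝ) := by exact_mod_cast hsum
  have e1 : ∑ v, (dV v : ℝ) = m * (((n : ℝ) - 1) / 2) +
      (∑ v, normDev n (dV v)) * √((n : ℝ) - 1) / 2 := by
    rw [sum_congr rfl fun v _ => eq_normDev hn1 (dV v), sum_add_distrib, ← sum_div, ← sum_div,
      ← sum_mul, sum_const, card_univ, Fintype.card_fin, nsmul_eq_mul, mul_div_assoc]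
  have e2 : ∑ w, (dW w : ℝ) = n * (((n : ℝ) - 1) / 2) +
      (∑ w, normDev n (dW w)) * √((n : ℝ) - 1) / 2 := by
    rw [sum_congr rfl fun v _ => eq_normDev hn1 (dW v), sum_add_distrib, ← sum_div, ← sum_div,
      ← sum_mul, sum_const, card_univ, Fintype.card_fin, nsmul_eq_mul, mul_div_assoc]
  have b1 : |∑ v, normDev n (dV v)| ≤ m * L := by
    refine (abs_sum_le_sum_abs _ _).trans ((sum_le_sum fun v _ => hα v).trans ?_)
    simp
  have b2 : |∑ w, normDev n (dW w)| ≤ n * L := by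
    refine (abs_sum_le_sum_abs _ _).trans ((sum_le_sum fun v _ => hβ v).trans ?_)
    simp
  have key : ((m : ℝ) - n) * √((n : ℝ) - 1) =
      ∑ w, normDev n (dW w) - ∑ v, normDev n (dV v) := by
    have h : (((m : ℝ) - n) * √((n : ℝ) - 1)) * √((n : ℝ) - 1) =
        (∑ w, normDev n (dW w) - ∑ v, normDev n (dV v)) * √((n : ℝ) - 1) := by
      rw [mul_assoc, hss]
      linarith
    exact mul_right_cancel₀ hs0.ne' h
  have hLL : L ≤ L ^ 2 := by nlinarith
  have b3 : |(m : ℝ) - n| * √((n : ℝ) - 1) ≤ 2 * L ^ 2 * n := by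
    nth_rewrite 1 [← abs_of_pos hs0]
    rw [← abs_mul, key]
    have := abs_sub (∑ w, normDev n (dW w)) (∑ v, normDev n (dV v))
    have h1 : (m : ℝ) * L ≤ n * L * L := mul_le_mul_of_nonneg_right hmn (by linarith)
    have h2 : (n : ℝ) * L ≤ n * L ^ 2 := mul_le_mul_of_nonneg_left hLL hn0.le
    linarith
  have hlow : ν ^ 10 / 2 ≤ √((n : ℝ) - 1) := by
    apply Real.le_sqrt_of_sq_le
    have : (ν ^ 10 / 2) ^ 2 = n / 4 := by rw [hn]; ring
    have h20 : 10 ^ 6 * ν ^ 0 ≤ ν ^ 20 := mul_pow_le_pow_of_lt hν (by norm_num)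
    rw [pow_zero, ← hn] at h20
    linarith
  have b4 : |(m : ℝ) - n| * (ν ^ 10 / 2) ≤ 2 * L ^ 2 * n :=
    (mul_le_mul_of_nonneg_left hlow (abs_nonneg _)).trans b3
  have p10 : 0 < ν ^ 10 := by positivity
  have b5 : |(m : ℝ) - n| ≤ 4 * L ^ 2 * ν ^ 10 := by
    have h1 : |(m : ℝ) - n| * (ν ^ 10 / 2) ≤ 4 * L ^ 2 * ν ^ 10 * (ν ^ 10 / 2) := by
      refine b4.trans (le_of_eq ?_)
      rw [hn]; ring
    exact le_of_mul_le_mul_right h1 (by positivity)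
  have b6 : 5 * L ^ 2 * ν ^ 10 ≤ ν ^ 11 := by
    rw [pow_succ ν 10, mul_comm (ν ^ 10) ν]
    exact mul_le_mul_of_nonneg_right hL p10.le
  have p11 : 10 ^ 6 * ν ^ 0 ≤ ν ^ 11 := mul_pow_le_pow_of_lt hν (by norm_num)
  rw [pow_zero] at p11
  linarith

/-- point probabilities for degrees into a fixed set, in a uniformly random
bipartite graph with given near-regular degree sequences. -/
theorem statement18 :
    ∃ C : ℝ, 0 < C ∧ ∃ n₀ : ℕ, ∀ n : ℕ, n₀ ≤ n → ∀ (m : ℕ) (dV : Fin m → ℕ) (dW : Fin n → ℕ),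
      (∑ v, dV v) = (∑ w, dW w) →
      ((Real.log n) ^ (-(1 : ℝ) / 4) ≤ (m : ℝ) / (n : ℝ)) →
      ((m : ℝ) / (n : ℝ) ≤ (Real.log n) ^ ((1 : ℝ) / 4)) →
      (∀ v, |normDev n (dV v)| ≤ Real.log n) →
      (∀ w, |normDev n (dW w)| ≤ Real.log n) →
      (((n : ℝ) / (m : ℝ)) * ∑ w, (normDev n (dW w)) ^ 2 ≤
        (n : ℝ) * (Real.log n) ^ ((1 : ℝ) / 9)) →
      (∃ E : Fin m → Fin n → Bool, (∀ v, bdegV E v = dV v) ∧ (∀ w, bdegW E w = dW w)) ∧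
      ∀ (u : Fin m) (S : Finset (Fin n)),
        (n : ℝ) / (Real.log n) ^ ((1 : ℝ) / 8) ≤ min (S.card : ℝ) ((n : ℝ) - (S.card : ℝ)) →
        ∀ t : ℕ, t ≤ dV u →
        ((|(t : ℝ) - (S.card : ℝ) / 2| > (n : ℝ) ^ ((3 : ℝ) / 5) →
            bipProb m n dV dW u S t ≤
              Real.exp (-((t : ℝ) - (S.card : ℝ) / 2) ^ 2 / (C * (n : ℝ)))) ∧
          (|(t : ℝ) - (S.card : ℝ) / 2| ≤ (n : ℝ) ^ ((3 : ℝ) / 5) →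
            ∃ θ : ℝ, |θ| ≤ C * (n : ℝ) ^ (-(1 : ℝ) / 10) ∧
              bipProb m n dV dW u S t =
                (1 + θ) *
                  ((S.card.choose t : ℝ) * ((n - S.card).choose (dV u - t) : ℝ) /
                    (n.choose (dV u) : ℝ)) *
                  Real.exp (bLam1 m n dV dW u - bLam2 m n dV dW u S t - bLam3 m n dW +
                    bLam4 m n dW S))) := by
  obtain ⟨n₀, hn₀⟩ := eventually_scale
  refine ⟨40, by norm_num, n₀, fun n hnn m dV dW hsum hlo hup hα hβ _ => ?_⟩
  obtain ⟨hν, hL1, hL⟩ := hn₀ n hnn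
  have hnn0 : (0 : ℝ) ≤ n := Nat.cast_nonneg n
  set ν : ℝ := (n : ℝ) ^ ((1 : ℝ) / 20) with hνd
  set L : ℝ := Real.log n
  have hν0 : 0 < ν := by linarith
  have hn : (n : ℝ) = ν ^ 20 := by
    rw [hνd, ← Real.rpow_natCast, ← Real.rpow_mul hnn0]
    norm_num
  have hn0 : (0 : ℝ) < n := by rw [hn]; positivity
  have h12 : (n : ℝ) ^ ((3 : ℝ) / 5) = ν ^ 12 := by
    rw [hνd, ← Real.rpow_natCast, ← Real.rpow_mul hnn0]
    norm_num
  have h2 : (n : ℝ) ^ (-(1 : ℝ) / 10) = (ν ^ 2)⁻¹ := by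
    rw [hνd, ← Real.rpow_natCast, ← Real.rpow_mul hnn0, ← Real.rpow_neg hnn0]
    norm_num
  have hLν : L ≤ ν := by nlinarith
  have hroot : ∀ a : ℝ, a ≤ 1 → L ^ a ≤ L := fun a ha => by
    simpa using Real.rpow_le_rpow_of_exponent_le hL1 ha
  have hm0 : 0 < m := by
    have h1 : 0 < (m : ℝ) / n := (Real.rpow_pos_of_pos (by linarith) _).trans_le hlo
    have h3 : (0 : ℝ) < m := by
      rw [div_pos_iff_of_pos_right hn0] at h1
      exact h1
    exact_mod_cast h3
  have hmn : (m : ℝ) ≤ n * L := by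
    have h1 := hup.trans (hroot _ (by norm_num))
    rw [div_le_iff₀ hn0] at h1
    linarith
  have hm := abs_card_sub_card_le hν hn hL1 hL hsum hα hβ hmn
  have hα' := fun v => (hα v).trans hLν
  have hβ' := fun w => (hβ w).trans hLν
  refine ⟨bip_exists hν hn hm hsum hα' hβ' ⟨0, hm0⟩, fun u S hS t ht => ?_⟩
  have h19 : ν ^ 19 ≤ (n : ℝ) / L ^ ((1 : ℝ) / 8) := by
    rw [le_div_iff₀ (Real.rpow_pos_of_pos (by linarith) _), hn, pow_succ ν 19]
    exact mul_le_mul_of_nonneg_left ((hroot _ (by norm_num)).trans hLν) (by positivity)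
  obtain ⟨c1, c2⟩ := bip_core hν hn hm hsum hα' hβ' u S (h19.trans (hS.trans (min_le_left _ _)))
    (h19.trans (hS.trans (min_le_right _ _))) ht
  rw [h12, h2]
  refine ⟨fun hτ => (c1 hτ).trans (Real.exp_le_exp.2 ?_), fun hτ => ?_⟩
  · rw [neg_div, neg_div, neg_le_neg_iff]
    exact div_le_div_of_nonneg_left (sq_nonneg _) hn0 (by linarith)
  · obtain ⟨δ, hδ, heq⟩ := c2 hτ
    have h20 : 20 / ν ^ 2 ≤ 1 := by
      rw [div_le_one (by positivity)]
      nlinarith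
    refine ⟨Real.exp δ - 1, ?_, ?_⟩
    · refine (Real.abs_exp_sub_one_le (hδ.trans h20)).trans ?_
      rw [div_eq_mul_inv] at hδ
      linarith
    · rw [heq, Real.exp_add]
      ring
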